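/- arXiv:1710.06131 — 3 statements merged into one kernel-verified Lean document; each statement's English description precedes it below -/
import Mathlib

section
/- Let q be a prime power and let n ≥ 3 be an integer. Then there exists an element of F_{q^n} that is simultaneously primitive and 1-normal over F_q. Furthermore, when n = 2 there is no primitive 1-normal element of F_{q^2} over F_q. -/
open Polynomial

noncomputable section

/-- For `f = Σ aᵢ xⁱ ∈ F_q[x]` and `α` in an extension, `f ∘ α = Σ aᵢ α^(qⁱ)`. -/
def frobComp {F K : Type*} [Field F] [Field K] [Algebra F K] (q : ℕ) (f : F[X]) (α : K) : K :=
  ∑ i ∈ Finset.range (f.natDegree + 1), algebraMap F K (f.coeff i) * α ^ q ^ i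

/-- `g` is the minimal polynomial of `α` with respect to the Frobenius `σ_q`:
monic, annihilates `α` under `∘`, and has least degree with these properties. -/
def IsFrobMinimal {F K : Type*} [Field F] [Field K] [Algebra F K] (q : ℕ) (g : F[X]) (α : K) :
    Prop :=
  g.Monic ∧ frobComp q g α = 0 ∧
    ∀ h : F[X], h.Monic → frobComp q h α = 0 → g.natDegree ≤ h.natDegree

/-- `α ∈ F_{qⁿ}` is `k`-normal over `F_q` if the `F_q`-span of `{α, α^q, …, α^(q^(n-1))}`
has dimension `n - k`. -/
def IskNormal (q n k : ℕ) (F : Type*) {K : Type*} [Field F] [Field K] [Algebra F K] (α : K) :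
    Prop :=
  Module.finrank F (Submodule.span F (Set.range fun i : Fin n => α ^ q ^ (i : ℕ))) = n - k

/-- `α` is primitive: it generates the multiplicative group of the field. -/
def IsPrimitiveElt {K : Type*} [Field K] (α : K) : Prop :=
  ∀ b : K, b ≠ 0 → ∃ m : ℕ, α ^ m = b

/-- `α` is `m`-free: `gcd(m, (xⁿ - 1)/m_{σ_q,α}) = 1`. -/
def IsPolyFree {F K : Type*} [Field F] [Field K] [Algebra F K] (q n : ℕ) (m : F[X]) (α : K) :
    Prop :=
  ∀ g : F[X], IsFrobMinimal q g α → IsCoprime m ((X ^ n - 1) /ₘ g)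

/-- `W(t)`: number of squarefree divisors of a positive integer `t`. -/
def Wint (t : ℕ) : ℕ := Set.ncard {d : ℕ | d ∣ t ∧ Squarefree d}

/-- `W(g)`: number of monic divisors of the polynomial `g`. -/
def Wpoly {F : Type*} [Field F] (g : F[X]) : ℕ := Set.ncard {h : F[X] | h.Monic ∧ h ∣ g}

/-- `Φ_q(f)`: number of units in `F_q[x]/⟨f⟩`. -/
def PhiPoly {F : Type*} [Field F] (f : F[X]) : ℕ := Nat.card (F[X] ⧸ Ideal.span {f})ˣ


section

theorem corr_sum {K : Type} [Field K] [Fintype K] [DecidableEq K] (χ : MulChar K ℂ) (hχ : χ ≠ 1)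
    (a b : K) (hab : a ≠ b) : ∑ x : K, χ (a + x) * (starRingEnd ℂ) (χ (b + x)) = -1 := by
  have hs : ∑ x : K, χ (a + x) * (starRingEnd ℂ) (χ (b + x))
      = ∑ x : K, χ ((a - b) + x) * χ⁻¹ x := by
    rw [← Equiv.sum_comp (Equiv.addLeft b) (fun x => χ ((a - b) + x) * χ⁻¹ x)]
    refine Finset.sum_congr rfl fun x _ => ?_
    simp only [Equiv.coe_addLeft]
    rw [← MulChar.star_apply']
    congr 2
    ring
  rw [hs]
  have hc : a - b ≠ 0 := sub_ne_zero.2 hab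
  set c := a - b with hcdef
  have h1 : ∑ x : K, χ (c + x) * χ⁻¹ x = ∑ x ∈ Finset.univ.erase (0:K), χ (1 + c * x⁻¹) := by
    rw [← Finset.add_sum_erase _ _ (Finset.mem_univ (0:K))]
    rw [MulChar.map_zero, mul_zero, zero_add]
    refine Finset.sum_congr rfl fun x hx => ?_
    have hx0 : x ≠ 0 := Finset.ne_of_mem_erase hx
    rw [MulChar.inv_apply', ← map_mul]
    congr 1
    field_simp
    ring
  have h2 : ∑ x ∈ Finset.univ.erase (0:K), χ (1 + c * x⁻¹) = ∑ y ∈ Finset.univ.erase (1:K), χ y := by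
    refine Finset.sum_bij' (fun x _ => 1 + c * x⁻¹) (fun y _ => c * (y - 1)⁻¹) ?_ ?_ ?_ ?_ ?_
    · intro x hx
      have hx0 : x ≠ 0 := Finset.ne_of_mem_erase hx
      simp [hc, hx0]
    · intro y hy
      have hx0 : y ≠ 1 := Finset.ne_of_mem_erase hy
      simp [hc, sub_ne_zero.2 hx0]
    · intro x hx
      have hx0 : x ≠ 0 := Finset.ne_of_mem_erase hx
      simp; field_simp
    · intro y hy
      have hx0 : y - 1 ≠ 0 := sub_ne_zero.2 (Finset.ne_of_mem_erase hy)
      simp; field_simp; ring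
    · intro x hx; rfl
  have h3 := Finset.add_sum_erase (Finset.univ) (fun y => χ y) (Finset.mem_univ (1:K))
  rw [MulChar.sum_eq_zero_of_ne_one hχ] at h3
  rw [h1, h2]
  simp only [map_one] at h3
  linear_combination h3

theorem char_sum_bound {K : Type} [Field K] [Fintype K] [DecidableEq K] (χ : MulChar K ℂ)
    (hχ : χ ≠ 1) (H : AddSubgroup K) [DecidablePred (· ∈ H)] :
    ‖∑ x ∈ Finset.univ.filter (· ∈ H), χ x‖ ≤ √(Fintype.card K : ℝ) := by
  set A := Finset.univ.filter (· ∈ H) with hA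
  set S := ∑ x ∈ A, χ x with hS
  have h0 : (0:K) ∈ A := by simp [hA, H.zero_mem]
  have hpos : 0 < A.card := Finset.card_pos.2 ⟨0, h0⟩
  -- total
  have tot : ∑ y : K, (∑ x ∈ A, χ (x + y)) * (starRingEnd ℂ) (∑ x ∈ A, χ (x + y))
      = (A.card : ℂ) * (Fintype.card K - A.card) := by
    have e1 : ∀ y : K, (∑ x ∈ A, χ (x + y)) * (starRingEnd ℂ) (∑ x ∈ A, χ (x + y))
      = ∑ a ∈ A, ∑ b ∈ A, χ (a + y) * (starRingEnd ℂ) (χ (b + y)) := by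
      intro y
      rw [map_sum, Finset.sum_mul_sum]
    simp_rw [e1]
    rw [Finset.sum_comm]
    have e2 : ∀ a ∈ A, ∑ y : K, ∑ b ∈ A, χ (a + y) * (starRingEnd ℂ) (χ (b + y))
        = (Fintype.card K - A.card : ℂ) := by
      intro a ha
      rw [Finset.sum_comm, ← Finset.add_sum_erase _ _ ha]
      have e3 : ∑ y : K, χ (a + y) * (starRingEnd ℂ) (χ (a + y)) = (Fintype.card K : ℂ) - 1 := by
        have e4 := Equiv.sum_comp (Equiv.addLeft a) (fun y => χ y * (starRingEnd ℂ) (χ y))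
        simp only [Equiv.coe_addLeft] at e4
        rw [e4]
        rw [← Finset.add_sum_erase _ _ (Finset.mem_univ (0:K))]
        rw [MulChar.map_zero, zero_mul, zero_add]
        rw [Finset.sum_congr rfl (g := fun _ => (1:ℂ))]
        · simp [Finset.card_univ]
          rw [Nat.cast_sub Fintype.card_pos]; simp
        · intro x hx
          have hx0 : x ≠ 0 := Finset.ne_of_mem_erase hx
          rw [starRingEnd_apply, MulChar.star_apply', MulChar.inv_apply', ← map_mul, mul_inv_cancel₀ hx0, map_one]
      rw [e3, Finset.sum_congr rfl (g := fun _ => (-1:ℂ))]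
      · simp [Finset.card_erase_of_mem ha]
        rw [Nat.cast_sub hpos]; push_cast; ring
      · intro b hb
        exact corr_sum χ hχ a b (Finset.ne_of_mem_erase hb).symm
    rw [Finset.sum_congr rfl e2]
    simp
    ring
  have tot' : ∑ y : K, ‖∑ x ∈ A, χ (x + y)‖ ^ 2 = (A.card : ℝ) * (Fintype.card K - A.card) := by
    have : ((∑ y : K, ‖∑ x ∈ A, χ (x + y)‖ ^ 2 : ℝ) : ℂ)
        = (((A.card : ℝ) * (Fintype.card K - A.card) : ℝ) : ℂ) := by
      push_cast
      rw [← tot]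
      refine Finset.sum_congr rfl fun y _ => ?_
      rw [Complex.mul_conj, Complex.normSq_eq_norm_sq]
      push_cast; rfl
    exact_mod_cast this
  have low : (A.card : ℝ) * ‖S‖ ^ 2 ≤ ∑ y : K, ‖∑ x ∈ A, χ (x + y)‖ ^ 2 := by
    calc (A.card : ℝ) * ‖S‖ ^ 2 = ∑ y ∈ A, ‖∑ x ∈ A, χ (x + y)‖ ^ 2 := by
          rw [Finset.sum_congr rfl (g := fun _ => ‖S‖ ^ 2)]
          · simp
          · intro y hy
            have hy' : y ∈ H := by simpa [hA] using hy
            congr 2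
            refine Finset.sum_bij' (fun x _ => x + y) (fun x _ => x - y) ?_ ?_ ?_ ?_ ?_
            · intro x hx
              have : x ∈ H := by simpa [hA] using hx
              simpa [hA] using H.add_mem this hy'
            · intro x hx
              have : x ∈ H := by simpa [hA] using hx
              simpa [hA] using H.sub_mem this hy'
            · intros; simp
            · intros; simp
            · intros; rfl
      _ ≤ _ := Finset.sum_le_sum_of_subset_of_nonneg (Finset.subset_univ _)
              (fun _ _ _ => by positivity)
  rw [tot'] at low
  have hposR : (0:ℝ) < A.card := by exact_mod_cast hpos
  have := le_of_mul_le_mul_left low hposR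
  apply Real.le_sqrt_of_sq_le
  linarith

/-- A family of characters indexed by primes. -/
theorem sieve_expand {K : Type} [Field K] [Fintype K] [DecidableEq K]
    (χ : ℕ → MulChar K ℂ) (c : ℕ → ℕ → ℝ) (A : Finset K) (B : ℝ)
    (hA : ∀ ψ : MulChar K ℂ, ψ ≠ 1 → ‖∑ x ∈ A, ψ x‖ ≤ B)
    (S : Finset ℕ) (hp : ∀ l ∈ S, l.Prime) (ho : ∀ l ∈ S, orderOf (χ l) = l) :
    (∀ (ψ : MulChar K ℂ) (m : ℕ), ψ ≠ 1 → ψ ^ m = 1 → (∀ l ∈ S, m.Coprime l) →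
      ‖∑ x ∈ A, ψ x * ∏ l ∈ S, ∑ j ∈ Finset.range l, (c l j : ℂ) * (χ l ^ j) x‖
        ≤ B * ∏ l ∈ S, ∑ j ∈ Finset.range l, |c l j|) ∧
    ‖∑ x ∈ A, (1 : MulChar K ℂ) x * ∏ l ∈ S, ∑ j ∈ Finset.range l, (c l j : ℂ) * (χ l ^ j) x
        - (∏ l ∈ S, (c l 0 : ℂ)) * ∑ x ∈ A, (1 : MulChar K ℂ) x‖
        ≤ B * (∏ l ∈ S, ∑ j ∈ Finset.range l, |c l j| - ∏ l ∈ S, |c l 0|) := by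
  induction S using Finset.induction_on with
  | empty =>
    refine ⟨?_, ?_⟩
    · intro ψ m h1 _ _
      simpa using hA ψ h1
    · simp
  | insert l S hl ih =>
    have ih := ih (fun a ha => hp a (Finset.mem_insert_of_mem ha))
      (fun a ha => ho a (Finset.mem_insert_of_mem ha))
    have hlp := hp l (Finset.mem_insert_self _ _)
    have hlo := ho l (Finset.mem_insert_self _ _)
    have hcop : ∀ a ∈ S, l.Coprime a := by
      intro a ha
      rw [Nat.coprime_primes hlp (hp a (Finset.mem_insert_of_mem ha))]
      rintro rfl; exact hl ha
    have key : ∀ ψ : MulChar K ℂ,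
      ∑ x ∈ A, ψ x * ∏ l ∈ insert l S, ∑ j ∈ Finset.range l, (c l j : ℂ) * (χ l ^ j) x
       = ∑ j ∈ Finset.range l, (c l j : ℂ) * ∑ x ∈ A, (ψ * χ l ^ j) x *
          ∏ l ∈ S, ∑ j ∈ Finset.range l, (c l j : ℂ) * (χ l ^ j) x := by
      intro ψ
      simp_rw [Finset.mul_sum]
      rw [Finset.sum_comm]
      refine Finset.sum_congr rfl fun x _ => ?_
      rw [Finset.prod_insert hl, Finset.sum_mul, Finset.mul_sum]
      refine Finset.sum_congr rfl fun j _ => ?_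
      rw [MulChar.mul_apply]; ring
    have hne : ∀ (j : ℕ), 0 < j → j < l → χ l ^ j ≠ 1 := by
      intro j h0 h1 h2
      have := orderOf_dvd_of_pow_eq_one h2
      rw [hlo] at this
      exact absurd (Nat.le_of_dvd h0 this) (by omega)
    have hpl : χ l ^ l = 1 := by
      have := pow_orderOf_eq_one (χ l)
      rwa [hlo] at this
    refine ⟨?_, ?_⟩
    · intro ψ m h1 h2 h3
      rw [key, Finset.prod_insert hl]
      refine (norm_sum_le _ _).trans ?_
      have hml := h3 l (Finset.mem_insert_self _ _)
      have : ∀ j ∈ Finset.range l, ‖(c l j : ℂ) * ∑ x ∈ A, (ψ * χ l ^ j) x *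
          ∏ l ∈ S, ∑ j ∈ Finset.range l, (c l j : ℂ) * (χ l ^ j) x‖ ≤
          |c l j| * (B * ∏ l ∈ S, ∑ j ∈ Finset.range l, |c l j|) := by
        intro j hj
        rw [norm_mul, Complex.norm_real, Real.norm_eq_abs]
        refine mul_le_mul_of_nonneg_left ?_ (abs_nonneg _)
        refine ih.1 (ψ * χ l ^ j) (m * l) ?_ ?_ ?_
        · intro h
          rcases Nat.eq_zero_or_pos j with rfl | hj0
          · simp at h; exact h1 h
          · have h4 : χ l ^ (j * m) = 1 := by
              have : (ψ * χ l ^ j) ^ m = 1 := by rw [h, one_pow]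
              rw [mul_pow, h2, one_mul, ← pow_mul] at this
              exact this
            have h5 := orderOf_dvd_of_pow_eq_one h4
            rw [hlo] at h5
            have h6 := (Nat.Coprime.dvd_mul_right hml.symm).1 h5
            exact absurd (Nat.le_of_dvd hj0 h6) (by simpa using hj)
        · rw [mul_pow, pow_mul, h2, one_pow, one_mul, ← pow_mul, show j * (m * l) = l * (j * m) by ring, pow_mul, hpl, one_pow]
        · intro a ha
          exact Nat.Coprime.mul_left (h3 a (Finset.mem_insert_of_mem ha)) (hcop a ha)
      refine (Finset.sum_le_sum this).trans ?_
      rw [← Finset.sum_mul]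
      apply le_of_eq; ring
    · rw [key, Finset.prod_insert hl, Finset.prod_insert hl, Finset.prod_insert hl]
      obtain ⟨k, rfl⟩ : ∃ k, l = k + 1 := ⟨l - 1, by have := hlp.pos; omega⟩
      rw [Finset.sum_range_succ', Finset.sum_range_succ']
      set PL := ∏ l ∈ S, ∑ j ∈ Finset.range l, |c l j| with hPL
      set T1 := ∑ x ∈ A, (1 : MulChar K ℂ) x with hT1
      have h1 : ∀ j ∈ Finset.range k, ‖(c (k+1) (j+1) : ℂ) * ∑ x ∈ A, ((1 : MulChar K ℂ) * χ (k+1) ^ (j+1)) x *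
          ∏ l ∈ S, ∑ j ∈ Finset.range l, (c l j : ℂ) * (χ l ^ j) x‖ ≤ |c (k+1) (j+1)| * (B * PL) := by
        intro j hj
        rw [norm_mul, Complex.norm_real, Real.norm_eq_abs]
        refine mul_le_mul_of_nonneg_left ?_ (abs_nonneg _)
        refine ih.1 _ (k+1) ?_ ?_ hcop
        · rw [one_mul]; exact hne _ (by omega) (by simp at hj; omega)
        · rw [one_mul, ← pow_mul, mul_comm, pow_mul, hpl, one_pow]
      have h2 := (norm_sum_le _ _).trans (Finset.sum_le_sum h1)
      rw [← Finset.sum_mul] at h2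
      have h3 := mul_le_mul_of_nonneg_left ih.2 (abs_nonneg (c (k+1) 0))
      rw [pow_zero, mul_one]
      have h4 : ‖(c (k+1) 0 : ℂ) * (∑ x ∈ A, (1 : MulChar K ℂ) x * ∏ l ∈ S, ∑ j ∈ Finset.range l, (c l j : ℂ) * (χ l ^ j) x
        - (∏ l ∈ S, (c l 0 : ℂ)) * T1)‖ ≤ |c (k+1) 0| * (B * (PL - ∏ l ∈ S, |c l 0|)) := by
        rw [norm_mul, Complex.norm_real, Real.norm_eq_abs]; exact h3
      calc _ = ‖(∑ j ∈ Finset.range k, (c (k+1) (j+1) : ℂ) * ∑ x ∈ A, ((1 : MulChar K ℂ) * χ (k+1) ^ (j+1)) x *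
          ∏ l ∈ S, ∑ j ∈ Finset.range l, (c l j : ℂ) * (χ l ^ j) x) + (c (k+1) 0 : ℂ) * (∑ x ∈ A, (1 : MulChar K ℂ) x * ∏ l ∈ S, ∑ j ∈ Finset.range l, (c l j : ℂ) * (χ l ^ j) x
        - (∏ l ∈ S, (c l 0 : ℂ)) * T1)‖ := by congr 1; ring
        _ ≤ _ := (norm_add_le _ _).trans (add_le_add h2 h4)
        _ = _ := by ring
end

section

theorem geom_ind {K : Type} [Field K] [Fintype K] (χ : MulChar K ℂ) (l : ℕ)
    (h : χ ^ l = 1) (x : K) (hx : x ≠ 0) :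
    ∑ j ∈ Finset.range l, (χ ^ j) x = if χ x = 1 then (l : ℂ) else 0 := by
  have hu : IsUnit x := hx.isUnit
  have h1 : ∀ j ∈ Finset.range l, (χ ^ j) x = (χ x) ^ j := by
    intro j _
    obtain ⟨u, rfl⟩ := hu
    rw [MulChar.pow_apply_coe]
  rw [Finset.sum_congr rfl h1]
  split_ifs with hc
  · simp [hc]
  · have h2 : (χ x) ^ l = 1 := by
      obtain ⟨u, rfl⟩ := hu
      rw [← MulChar.pow_apply_coe, h, MulChar.one_apply_coe]
    have := mul_geom_sum (χ x) l
    rw [h2, sub_self] at this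
    exact (mul_eq_zero.1 this).resolve_left (sub_ne_zero.2 hc)

/-- coefficients of the indicator function: free for `l ≠ l0`, power for `l = l0`. -/
def cf (l0 : ℕ) (l j : ℕ) : ℝ := if l = l0 then 1 / (l : ℝ) else (if j = 0 then 1 else 0) - 1 / (l : ℝ)

theorem cf_ind {K : Type} [Field K] [Fintype K] (χ : MulChar K ℂ) (l l0 : ℕ) (hl : 0 < l)
    (h : χ ^ l = 1) (x : K) (hx : x ≠ 0) :
    ∑ j ∈ Finset.range l, (cf l0 l j : ℂ) * (χ ^ j) x =
      if l = l0 then (if χ x = 1 then 1 else 0) else (if χ x = 1 then 0 else 1) := by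
  have hg := geom_ind χ l h x hx
  have hl' : (l : ℂ) ≠ 0 := by exact_mod_cast hl.ne'
  by_cases h0 : l = l0
  · have : ∀ j ∈ Finset.range l, (cf l0 l j : ℂ) * (χ ^ j) x = (1 / (l:ℂ)) * (χ ^ j) x := by
      intro j _; simp [cf, h0]
    rw [Finset.sum_congr rfl this, ← Finset.mul_sum, hg, if_pos h0]
    split_ifs <;> simp [hl']
  · have : ∀ j ∈ Finset.range l, (cf l0 l j : ℂ) * (χ ^ j) x =
        (if j = 0 then (χ ^ j) x else 0) - (1 / (l:ℂ)) * (χ ^ j) x := by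
      intro j _; simp only [cf, h0, if_false]; split_ifs <;> push_cast <;> ring
    rw [Finset.sum_congr rfl this, Finset.sum_sub_distrib, ← Finset.mul_sum, hg, if_neg h0]
    have h1 : (1 : MulChar K ℂ) x = 1 := MulChar.one_apply hx.isUnit
    rw [Finset.sum_ite_eq' (Finset.range l) 0]
    rw [if_pos (Finset.mem_range.2 hl), pow_zero, h1]
    split_ifs <;> simp [hl']

theorem cf_zero (l0 l : ℕ) (h : l ≠ l0) : cf l0 l 0 = 1 - 1 / (l:ℝ) := by simp [cf, h]

theorem cf_abs (l0 l : ℕ) (hl : 0 < l) (h : l ≠ l0) :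
    ∑ j ∈ Finset.range l, |cf l0 l j| = 2 * (1 - 1 / (l:ℝ)) := by
  obtain ⟨k, rfl⟩ : ∃ k, l = k + 1 := ⟨l - 1, by omega⟩
  rw [Finset.sum_range_succ']
  have h2 : (0:ℝ) ≤ 1 - 1 / ((k + 1 : ℕ) : ℝ) := by
    rw [sub_nonneg, div_le_one (by positivity)]; push_cast; linarith [Nat.cast_nonneg (α := ℝ) k]
  have h1 : ∀ j ∈ Finset.range k, |cf l0 (k+1) (j+1)| = 1 / ((k+1 : ℕ):ℝ) := by
    intro j _
    simp only [cf, h, if_false]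
    rw [if_neg (by omega), zero_sub, abs_neg, abs_of_nonneg (by positivity)]
  rw [Finset.sum_congr rfl h1, cf_zero l0 _ h, abs_of_nonneg h2]
  simp only [Finset.sum_const, Finset.card_range, nsmul_eq_mul]
  push_cast
  field_simp
  ring

theorem cf_abs_self (l : ℕ) (hl : 0 < l) :
    ∑ j ∈ Finset.range l, |cf l l j| = 1 := by
  have h1 : ∀ j ∈ Finset.range l, |cf l l j| = 1 / (l:ℝ) := by
    intro j _
    simp only [cf, if_true]
    rw [abs_of_nonneg (by positivity)]
  rw [Finset.sum_congr rfl h1]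
  have : (l:ℝ) ≠ 0 := by exact_mod_cast hl.ne'
  simp [this]

def thetaS (S : Finset ℕ) : ℝ := ∏ l ∈ S, (1 - 1 / (l:ℝ))

theorem thetaS_pos (S : Finset ℕ) (hp : ∀ l ∈ S, l.Prime) : 0 < thetaS S := by
  refine Finset.prod_pos fun l hl => ?_
  have : (2:ℝ) ≤ l := by exact_mod_cast (hp l hl).two_le
  rw [sub_pos, div_lt_one (by linarith)]; linarith

open Classical in
theorem count_free {K : Type} [Field K] [Fintype K]
    (χ : ℕ → MulChar K ℂ) (A : Finset K) (B : ℝ)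
    (hA : ∀ ψ : MulChar K ℂ, ψ ≠ 1 → ‖∑ x ∈ A, ψ x‖ ≤ B)
    (S : Finset ℕ) (hp : ∀ l ∈ S, l.Prime) (ho : ∀ l ∈ S, orderOf (χ l) = l) :
    |((A.filter (fun x => x ≠ 0 ∧ ∀ l ∈ S, χ l x ≠ 1)).card : ℝ)
      - thetaS S * ((A.filter (fun x => x ≠ 0)).card : ℝ)| ≤ B * (thetaS S * (2 ^ S.card - 1)) := by
  have h := (sieve_expand χ (cf 0) A B hA S hp ho).2
  have hne : ∀ l ∈ S, l ≠ 0 := fun l hl => (hp l hl).ne_zero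
  have h1 : ∏ l ∈ S, ∑ j ∈ Finset.range l, |cf 0 l j| = 2 ^ S.card * thetaS S := by
    rw [Finset.prod_congr rfl (fun l hl => cf_abs 0 l (hp l hl).pos (hne l hl)),
      Finset.prod_mul_distrib, thetaS]
    simp
  have h2 : ∏ l ∈ S, |cf 0 l 0| = thetaS S := by
    rw [thetaS]
    refine Finset.prod_congr rfl fun l hl => ?_
    rw [cf_zero _ _ (hne l hl), abs_of_nonneg]
    have : (1:ℝ) ≤ l := by exact_mod_cast (hp l hl).one_le
    rw [sub_nonneg, div_le_one (by linarith)]; linarith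
  have h3 : ∏ l ∈ S, (cf 0 l 0 : ℂ) = (thetaS S : ℂ) := by
    rw [thetaS]; push_cast
    refine Finset.prod_congr rfl fun l hl => ?_
    rw [cf_zero _ _ (hne l hl)]; push_cast; ring
  have h4 : ∑ x ∈ A, (1 : MulChar K ℂ) x = ((A.filter (fun x => x ≠ 0)).card : ℂ) := by
    rw [Finset.card_filter]; push_cast
    refine Finset.sum_congr rfl fun x _ => ?_
    split_ifs with hx
    · exact MulChar.one_apply (Ne.isUnit hx)
    · push Not at hx; rw [hx, MulChar.map_zero]
  have h5 : ∑ x ∈ A, (1 : MulChar K ℂ) x * ∏ l ∈ S, ∑ j ∈ Finset.range l, (cf 0 l j : ℂ) * (χ l ^ j) x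
      = ((A.filter (fun x => x ≠ 0 ∧ ∀ l ∈ S, χ l x ≠ 1)).card : ℂ) := by
    rw [Finset.card_filter]; push_cast
    refine Finset.sum_congr rfl fun x _ => ?_
    by_cases hx : x = 0
    · rw [hx, MulChar.map_zero, zero_mul]; simp
    · rw [MulChar.one_apply (Ne.isUnit hx), one_mul]
      have : ∀ l ∈ S, ∑ j ∈ Finset.range l, (cf 0 l j : ℂ) * (χ l ^ j) x = if χ l x ≠ 1 then 1 else 0 := by
        intro l hl
        rw [cf_ind (χ l) l 0 (hp l hl).pos (by have := pow_orderOf_eq_one (χ l); rwa [ho l hl] at this) x hx,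
          if_neg (hne l hl)]
        simp
      rw [Finset.prod_congr rfl this, Finset.prod_ite_zero]
      simp [hx]
  rw [h1, h2, h3, h4, h5] at h
  rw [← Real.norm_eq_abs, ← Complex.norm_real]
  push_cast
  refine h.trans (le_of_eq (by ring))

open Classical in
theorem count_free_pow {K : Type} [Field K] [Fintype K]
    (χ : ℕ → MulChar K ℂ) (A : Finset K) (B : ℝ)
    (hA : ∀ ψ : MulChar K ℂ, ψ ≠ 1 → ‖∑ x ∈ A, ψ x‖ ≤ B)
    (S : Finset ℕ) (hp : ∀ l ∈ S, l.Prime) (ho : ∀ l ∈ S, orderOf (χ l) = l)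
    (l0 : ℕ) (hl0 : l0 ∉ S) (hp0 : l0.Prime) (ho0 : orderOf (χ l0) = l0) :
    |((A.filter (fun x => x ≠ 0 ∧ (∀ l ∈ S, χ l x ≠ 1) ∧ χ l0 x = 1)).card : ℝ)
      - thetaS S / l0 * ((A.filter (fun x => x ≠ 0)).card : ℝ)| ≤
        B * (thetaS S * 2 ^ S.card - thetaS S / l0) := by
  have h := (sieve_expand χ (cf l0) A B hA (insert l0 S)
    (by intro l hl; rcases Finset.mem_insert.1 hl with rfl | hl; exacts [hp0, hp l hl])
    (by intro l hl; rcases Finset.mem_insert.1 hl with rfl | hl; exacts [ho0, ho l hl])).2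
  have hne : ∀ l ∈ S, l ≠ l0 := fun l hl h => hl0 (h ▸ hl)
  have h1 : ∏ l ∈ S, ∑ j ∈ Finset.range l, |cf l0 l j| = 2 ^ S.card * thetaS S := by
    rw [Finset.prod_congr rfl (fun l hl => cf_abs l0 l (hp l hl).pos (hne l hl)),
      Finset.prod_mul_distrib, thetaS]
    simp
  have h2 : ∏ l ∈ S, |cf l0 l 0| = thetaS S := by
    rw [thetaS]
    refine Finset.prod_congr rfl fun l hl => ?_
    rw [cf_zero _ _ (hne l hl), abs_of_nonneg]
    have : (1:ℝ) ≤ l := by exact_mod_cast (hp l hl).one_le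
    rw [sub_nonneg, div_le_one (by linarith)]; linarith
  have h3 : ∏ l ∈ S, (cf l0 l 0 : ℂ) = (thetaS S : ℂ) := by
    rw [thetaS]; push_cast
    refine Finset.prod_congr rfl fun l hl => ?_
    rw [cf_zero _ _ (hne l hl)]; push_cast; ring
  have h4 : ∑ x ∈ A, (1 : MulChar K ℂ) x = ((A.filter (fun x => x ≠ 0)).card : ℂ) := by
    rw [Finset.card_filter]; push_cast
    refine Finset.sum_congr rfl fun x _ => ?_
    split_ifs with hx
    · exact MulChar.one_apply (Ne.isUnit hx)
    · push Not at hx; rw [hx, MulChar.map_zero]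
  have h5 : ∑ x ∈ A, (1 : MulChar K ℂ) x * ∏ l ∈ insert l0 S, ∑ j ∈ Finset.range l, (cf l0 l j : ℂ) * (χ l ^ j) x
      = ((A.filter (fun x => x ≠ 0 ∧ (∀ l ∈ S, χ l x ≠ 1) ∧ χ l0 x = 1)).card : ℂ) := by
    rw [Finset.card_filter]; push_cast
    refine Finset.sum_congr rfl fun x _ => ?_
    by_cases hx : x = 0
    · rw [hx, MulChar.map_zero, zero_mul]; simp
    · rw [MulChar.one_apply (Ne.isUnit hx), one_mul, Finset.prod_insert hl0]
      have : ∀ l ∈ S, ∑ j ∈ Finset.range l, (cf l0 l j : ℂ) * (χ l ^ j) x = if χ l x ≠ 1 then 1 else 0 := by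
        intro l hl
        rw [cf_ind (χ l) l l0 (hp l hl).pos (by have := pow_orderOf_eq_one (χ l); rwa [ho l hl] at this) x hx,
          if_neg (hne l hl)]
        simp
      rw [Finset.prod_congr rfl this, Finset.prod_ite_zero,
        cf_ind (χ l0) l0 l0 hp0.pos (by have := pow_orderOf_eq_one (χ l0); rwa [ho0] at this) x hx, if_pos rfl]
      by_cases h7 : χ l0 x = 1 <;> by_cases h8 : ∀ l ∈ S, χ l x ≠ 1 <;> simp [hx, h7, h8]
  have h6 : cf l0 l0 0 = 1 / (l0 : ℝ) := by simp [cf]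
  rw [Finset.prod_insert hl0, Finset.prod_insert hl0, Finset.prod_insert hl0, cf_abs_self l0 hp0.pos,
    h1, h2, h3, h4, h5, h6, abs_of_nonneg (by positivity)] at h
  rw [← Real.norm_eq_abs, ← Complex.norm_real]
  push_cast
  push_cast at h
  refine (le_of_eq ?_).trans (h.trans (le_of_eq (by ring)))
  congr 1; ring

open Classical in
theorem sieve_main {K ι : Type} [Field K] [Fintype K]
    (χ : ℕ → MulChar K ℂ) (A : Finset K) (BA B : ℝ)
    (hA : ∀ ψ : MulChar K ℂ, ψ ≠ 1 → ‖∑ x ∈ A, ψ x‖ ≤ BA)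
    (R : Finset ι) (D : ι → Finset K)
    (hD : ∀ i ∈ R, ∀ ψ : MulChar K ℂ, ψ ≠ 1 → ‖∑ x ∈ D i, ψ x‖ ≤ B)
    (S T : Finset ℕ) (hST : Disjoint S T)
    (hpS : ∀ l ∈ S, l.Prime) (hoS : ∀ l ∈ S, orderOf (χ l) = l)
    (hpT : ∀ l ∈ T, l.Prime) (hoT : ∀ l ∈ T, orderOf (χ l) = l)
    (hmain : BA * ((2 ^ S.card - 1) + T.card * 2 ^ S.card)
      + ∑ i ∈ R, (((D i).filter (fun x => x ≠ 0)).card + B * (2 ^ S.card - 1))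
      < ((A.filter (fun x => x ≠ 0)).card : ℝ) * (1 - ∑ l ∈ T, 1 / (l:ℝ))) :
    ∃ x ∈ A, x ≠ 0 ∧ (∀ l ∈ S, χ l x ≠ 1) ∧ (∀ l ∈ T, χ l x ≠ 1) ∧ ∀ i ∈ R, x ∉ D i := by
  by_contra hcon
  push Not at hcon
  have hθ := thetaS_pos S hpS
  have hBA : 0 ≤ BA ∨ T = ∅ := by
    by_cases h : T = ∅
    · right; exact h
    · left
      obtain ⟨l, hl⟩ := Finset.nonempty_iff_ne_empty.2 h
      have h1 : χ l ≠ 1 := by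
        intro h2
        have := hoT l hl
        rw [h2, orderOf_one] at this
        exact (hpT l hl).one_lt.ne this
      exact (norm_nonneg _).trans (hA _ h1)
  -- cover
  have hcov : A.filter (fun x => x ≠ 0 ∧ ∀ l ∈ S, χ l x ≠ 1) ⊆
      (T.biUnion fun l0 => A.filter (fun x => x ≠ 0 ∧ (∀ l ∈ S, χ l x ≠ 1) ∧ χ l0 x = 1)) ∪
      (R.biUnion fun i => (D i).filter (fun x => x ≠ 0 ∧ ∀ l ∈ S, χ l x ≠ 1)) := by
    intro x hx
    rw [Finset.mem_filter] at hx
    obtain ⟨hxA, hx0, hxS⟩ := hx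
    rw [Finset.mem_union, Finset.mem_biUnion, Finset.mem_biUnion]
    by_cases hT : ∀ l ∈ T, χ l x ≠ 1
    · right
      obtain ⟨i, hi, hxi⟩ := hcon x hxA hx0 hxS hT
      exact ⟨i, hi, Finset.mem_filter.2 ⟨hxi, hx0, hxS⟩⟩
    · left
      push Not at hT
      obtain ⟨l, hl, hxl⟩ := hT
      exact ⟨l, hl, Finset.mem_filter.2 ⟨hxA, hx0, hxS, hxl⟩⟩
  have hcard := (Finset.card_le_card hcov).trans ((Finset.card_union_le _ _).trans
    (add_le_add Finset.card_biUnion_le Finset.card_biUnion_le))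
  have hcardR : ((A.filter (fun x => x ≠ 0 ∧ ∀ l ∈ S, χ l x ≠ 1)).card : ℝ) ≤
      ∑ l0 ∈ T, ((A.filter (fun x => x ≠ 0 ∧ (∀ l ∈ S, χ l x ≠ 1) ∧ χ l0 x = 1)).card : ℝ)
      + ∑ i ∈ R, (((D i).filter (fun x => x ≠ 0 ∧ ∀ l ∈ S, χ l x ≠ 1)).card : ℝ) := by
    exact_mod_cast hcard
  have h1 := (abs_le.1 (count_free χ A BA hA S hpS hoS)).1
  set a : ℝ := ((A.filter (fun x => x ≠ 0)).card : ℝ) with ha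
  have h2 : ∑ l0 ∈ T, ((A.filter (fun x => x ≠ 0 ∧ (∀ l ∈ S, χ l x ≠ 1) ∧ χ l0 x = 1)).card : ℝ)
      ≤ ∑ l0 ∈ T, (thetaS S * (a * (1 / (l0:ℝ)) + BA * 2 ^ S.card)) := by
    refine Finset.sum_le_sum fun l hl => ?_
    have h3 := (abs_le.1 (count_free_pow χ A BA hA S hpS hoS l
      (fun h => Finset.disjoint_left.1 hST h hl) (hpT l hl) (hoT l hl))).2
    have h4 : 0 ≤ BA * (thetaS S / l) := by
      rcases hBA with h | h
      · positivity
      · rw [h] at hl; simp at hl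
    have : thetaS S / (l:ℝ) * a = thetaS S * (a * (1 / (l:ℝ))) := by ring
    rw [← ha] at h3
    linarith
  have h3 : ∑ i ∈ R, (((D i).filter (fun x => x ≠ 0 ∧ ∀ l ∈ S, χ l x ≠ 1)).card : ℝ)
      ≤ ∑ i ∈ R, thetaS S * (((D i).filter (fun x => x ≠ 0)).card + B * (2 ^ S.card - 1)) := by
    refine Finset.sum_le_sum fun i hi => ?_
    have h3 := (abs_le.1 (count_free χ (D i) B (hD i hi) S hpS hoS)).2
    linarith
  rw [← Finset.mul_sum] at h2 h3
  rw [Finset.sum_add_distrib, ← Finset.mul_sum, Finset.sum_const, nsmul_eq_mul] at h2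
  have h5 := mul_lt_mul_of_pos_left hmain hθ
  linarith
end

section
set_option linter.unusedSectionVars false

def frobL (F K : Type) [Field F] [Fintype F] [Field K] [Algebra F K] : Module.End F K :=
  (FiniteField.frobeniusAlgHom F K).toLinearMap

def ap {F K : Type} [Field F] [Fintype F] [Field K] [Algebra F K] (h : F[X]) (x : K) : K :=
  aeval (frobL F K) h x

section
variable {F K : Type} [Field F] [Fintype F] [Field K] [Fintype K] [Algebra F K]

theorem frobL_pow (i : ℕ) (x : K) : (frobL F K ^ i) x = x ^ (Fintype.card F) ^ i := by
  induction i with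
  | zero => simp
  | succ k ih =>
    rw [pow_succ', Module.End.mul_apply, ih]
    simp [frobL, FiniteField.frobeniusAlgHom_apply, ← pow_mul, pow_succ]

theorem ap_mul (g h : F[X]) (x : K) : ap (g * h) x = ap g (ap h x) := by
  simp [ap]

theorem ap_add (g h : F[X]) (x : K) : ap (g + h) x = ap g x + ap h x := by
  simp [ap]

theorem ap_zero (g : F[X]) : ap g (0:K) = 0 := by simp [ap]

theorem ap_smul (c : F) (g : F[X]) (x : K) : ap g (c • x) = c • ap g x := by simp [ap]

theorem ap_dvd {g h : F[X]} (hd : g ∣ h) {x : K} (hx : ap g x = 0) : ap h x = 0 := by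
  obtain ⟨c, rfl⟩ := hd
  rw [mul_comm, ap_mul, hx, ap_zero]

theorem ap_sum (h : F[X]) (x : K) :
    ap h x = ∑ i ∈ Finset.range (h.natDegree + 1), algebraMap F K (h.coeff i) * x ^ (Fintype.card F) ^ i := by
  rw [ap, aeval_eq_sum_range, LinearMap.sum_apply]
  refine Finset.sum_congr rfl fun i _ => ?_
  rw [LinearMap.smul_apply, frobL_pow, Algebra.smul_def]

theorem ap_Xn (x : K) : ap (X ^ (Module.finrank F K) - 1 : F[X]) x = 0 := by
  simp only [ap, map_sub, map_pow, aeval_X, map_one, LinearMap.sub_apply, frobL_pow, Module.End.one_apply]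
  rw [← Module.card_eq_pow_finrank (K := F) (V := K), FiniteField.pow_card, sub_self]

open Classical in
theorem ap_gcd {g h : F[X]} {x : K} (hg : ap g x = 0) (hh : ap h x = 0) :
    ap (EuclideanDomain.gcd g h) x = 0 := by
  rw [EuclideanDomain.gcd_eq_gcd_ab, ap_add, mul_comm g, mul_comm h, ap_mul, ap_mul, hg, hh, ap_zero,
    ap_zero, add_zero]

def kerA (K : Type) [Field K] [Algebra F K] (h : F[X]) : Submodule F K := LinearMap.ker (aeval (frobL F K) h)

theorem mem_kerA (h : F[X]) (x : K) : x ∈ kerA K h ↔ ap h x = 0 := Iff.rfl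

theorem finrank_kerA_le (h : F[X]) (hh : h ≠ 0) : Module.finrank F (kerA K h) ≤ h.natDegree := by
  classical
  set q := Fintype.card F with hq
  have hq2 : 1 < q := Fintype.one_lt_card
  let H : K[X] := ∑ i ∈ Finset.range (h.natDegree + 1), C (algebraMap F K (h.coeff i)) * X ^ q ^ i
  have hcoef : H.coeff (q ^ h.natDegree) ≠ 0 := by
    simp only [H, finsetSum_coeff, coeff_C_mul, coeff_X_pow]
    rw [Finset.sum_eq_single h.natDegree]
    · simp [hh]
    · intro b hb hne
      have : q ^ h.natDegree ≠ q ^ b := fun h => hne (Nat.pow_right_injective hq2 h).symm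
      simp [this]
    · simp
  have hH0 : H ≠ 0 := by rintro h0; rw [h0] at hcoef; simp at hcoef
  have hdeg : H.natDegree ≤ q ^ h.natDegree := by
    refine natDegree_sum_le_of_forall_le _ _ fun i hi => ?_
    refine (natDegree_C_mul_X_pow_le _ _).trans (Nat.pow_le_pow_right (by omega) ?_)
    rw [Finset.mem_range] at hi; omega
  have hev : ∀ x : K, H.eval x = ap h x := by
    intro x
    rw [ap_sum]; simp [H, eval_finsetSum, hq]
  have hc : Fintype.card (kerA K h) ≤ q ^ h.natDegree := by
    have h1 : Fintype.card (kerA K h) ≤ H.roots.toFinset.card := by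
      rw [← Fintype.card_coe]
      refine Fintype.card_le_of_injective (fun x => ⟨x.1, ?_⟩) ?_
      · rw [Multiset.mem_toFinset, mem_roots hH0, IsRoot, hev]; exact x.2
      · intro x y hxy; exact Subtype.ext (congrArg (fun z => (z.1 : K)) hxy)
    exact h1.trans ((Multiset.toFinset_card_le _).trans ((card_roots' H).trans hdeg))
  rw [Module.card_eq_pow_finrank (K := F)] at hc
  exact (Nat.pow_le_pow_iff_right hq2).1 hc

theorem finrank_kerA (h : F[X]) (hd : h ∣ X ^ (Module.finrank F K) - 1) :
    Module.finrank F (kerA K h) = h.natDegree := by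
  have hn : 0 < Module.finrank F K := Module.finrank_pos
  have hX : (X ^ (Module.finrank F K) - 1 : F[X]) ≠ 0 := X_pow_sub_C_ne_zero hn 1
  obtain ⟨c, hc⟩ := hd
  have hh : h ≠ 0 := by rintro rfl; rw [zero_mul] at hc; exact hX hc
  have hc0 : c ≠ 0 := by rintro rfl; rw [mul_zero] at hc; exact hX hc
  refine le_antisymm (finrank_kerA_le h hh) ?_
  have h1 := LinearMap.finrank_range_add_finrank_ker (aeval (frobL F K) c)
  have h2 := finrank_kerA_le (K := K) c hc0
  rw [kerA] at h2
  have h3 : LinearMap.range (aeval (frobL F K) c) ≤ kerA K h := by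
    rintro _ ⟨x, rfl⟩
    rw [mem_kerA]
    change ap h (ap c x) = 0
    rw [← ap_mul, ← hc, ap_Xn]
  have h4 := Submodule.finrank_mono h3
  have h5 : h.natDegree + c.natDegree = Module.finrank F K := by
    rw [← natDegree_mul hh hc0, ← hc]; exact natDegree_X_pow_sub_C
  omega

open Classical in
def Us (K : Type) [Field K] [Fintype K] [Algebra F K] (h : F[X]) (G : Finset F[X]) : Finset K :=
  Finset.univ.filter fun x => ap h x = 0 ∧ ∀ P ∈ G, ap (h /ₘ P) x ≠ 0

theorem divByMonic_mul_self {h P : F[X]} (hP : P.Monic) (hd : P ∣ h) : P * (h /ₘ P) = h := by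
  have := modByMonic_add_div h P
  rwa [(modByMonic_eq_zero_iff_dvd hP).2 hd, zero_add] at this

/-- Monic irreducible. -/
def MI (P : F[X]) : Prop := P.Monic ∧ Irreducible P

theorem MI.coprime {P P' : F[X]} (h : MI P) (h' : MI P') (hne : P ≠ P') : IsCoprime P P' := by
  rcases em (P ∣ P') |>.symm with h1 | h1
  · exact (Irreducible.coprime_iff_not_dvd h.2).2 h1
  · exact absurd (eq_of_monic_of_associated h.1 h'.1 (h.2.associated_of_dvd h'.2 h1)) hne

theorem Us_insert (w : K → ℂ) (h : F[X]) (G : Finset F[X]) (hG : ∀ P ∈ G, MI P ∧ P ∣ h)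
    (P : F[X]) (hP : MI P) (hPd : P ∣ h) (hPG : P ∉ G) [DecidableEq F[X]] :
    ∑ x ∈ Us K h (insert P G), w x = ∑ x ∈ Us K h G, w x - ∑ x ∈ Us K (h /ₘ P) G, w x := by
  classical
  have hsub : Us K (h /ₘ P) G = (Us K h G).filter (fun x => ap (h /ₘ P) x = 0) := by
    ext x
    simp only [Us, Finset.mem_filter, Finset.mem_univ, true_and]
    have key : ∀ P' ∈ G, ap (h /ₘ P) x = 0 → (ap (h /ₘ P /ₘ P') x = 0 ↔ ap (h /ₘ P') x = 0) := by
      intro P' hP' hx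
      have hcop := hP.coprime (hG P' hP').1 (fun h => hPG (h ▸ hP'))
      have e1 := divByMonic_mul_self hP.1 hPd
      have d1 : P' ∣ h /ₘ P := by
        refine hcop.symm.dvd_of_dvd_mul_left ?_
        rw [e1]; exact (hG P' hP').2
      have e2 := divByMonic_mul_self (hG P' hP').1.1 d1
      have e3 := divByMonic_mul_self (hG P' hP').1.1 (hG P' hP').2
      set u := h /ₘ P /ₘ P' with hu
      have e4 : h /ₘ P' = P * u := by
        refine mul_left_cancel₀ (hG P' hP').1.1.ne_zero ?_
        rw [e3, ← e1, ← e2]; ring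
      rw [e4]
      constructor
      · intro h0; rw [ap_mul, h0, ap_zero]
      · intro h0
        obtain ⟨a, b, hab⟩ := hcop
        have : u = a * (P * u) + b * (P' * u) := by linear_combination (-u) * hab
        rw [this, ap_add, ap_mul a, h0, ap_mul b, e2, hx]
        simp [ap_zero]
    constructor
    · rintro ⟨h1, h2⟩
      refine ⟨⟨?_, fun P' hP' h0 => h2 P' hP' ((key P' hP' h1).2 h0)⟩, h1⟩
      exact ap_dvd ⟨P, by rw [mul_comm, divByMonic_mul_self hP.1 hPd]⟩ h1
    · rintro ⟨⟨h1, h2⟩, h3⟩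
      exact ⟨h3, fun P' hP' h0 => h2 P' hP' ((key P' hP' h3).1 h0)⟩
  have hins : Us K h (insert P G) = (Us K h G).filter (fun x => ¬ ap (h /ₘ P) x = 0) := by
    ext x
    simp only [Us, Finset.mem_filter, Finset.mem_univ, true_and, Finset.forall_mem_insert]
    tauto
  rw [hsub, hins, eq_sub_iff_add_eq, add_comm, Finset.sum_filter_add_sum_filter_not]

theorem MI_dvd_divByMonic {h P : F[X]} {G : Finset F[X]} (hG : ∀ P ∈ G, MI P ∧ P ∣ h)
    (hP : MI P) (hPd : P ∣ h) (hPG : P ∉ G) : ∀ P' ∈ G, MI P' ∧ P' ∣ h /ₘ P := by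
  intro P' hP'
  refine ⟨(hG P' hP').1, ?_⟩
  have hcop := hP.coprime (hG P' hP').1 (fun h => hPG (h ▸ hP'))
  refine hcop.symm.dvd_of_dvd_mul_left ?_
  rw [divByMonic_mul_self hP.1 hPd]; exact (hG P' hP').2

theorem Us_card (G : Finset F[X]) : ∀ (h : F[X]), h.Monic → h ∣ X ^ (Module.finrank F K) - 1 →
    (∀ P ∈ G, MI P ∧ P ∣ h) →
    ((Us K h G).card : ℝ) = (Fintype.card F : ℝ) ^ h.natDegree *
      ∏ P ∈ G, (1 - 1 / (Fintype.card F : ℝ) ^ P.natDegree) := by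
  classical
  induction G using Finset.induction_on with
  | empty =>
    intro h hm hd _
    have h1 : (Us K h ∅).card = Fintype.card (kerA K h) := by
      rw [Fintype.card_subtype]
      congr 1
      ext x; simp [Us, mem_kerA]
    rw [h1, Module.card_eq_pow_finrank (K := F), finrank_kerA h hd]
    simp
  | insert P G hPG ih =>
    intro h hm hd hG
    have hP := hG P (Finset.mem_insert_self _ _)
    have hG' : ∀ P ∈ G, MI P ∧ P ∣ h := fun P hP => hG P (Finset.mem_insert_of_mem hP)
    have hs := Us_insert (K := K) (fun _ => 1) h G hG' P hP.1 hP.2 hPG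
    have e := divByMonic_mul_self hP.1.1 hP.2
    have hm' : (h /ₘ P).Monic := by
      have : (P * (h /ₘ P)).Monic := by rwa [e]
      exact hP.1.1.of_mul_monic_left this
    have i1 := ih h hm hd hG'
    have i2 := ih (h /ₘ P) hm' ((Dvd.intro_left _ e).trans hd) (MI_dvd_divByMonic hG' hP.1 hP.2 hPG)
    simp only [Finset.sum_const, nsmul_eq_mul, mul_one] at hs
    have hs' : ((Us K h (insert P G)).card : ℝ) = (Us K h G).card - (Us K (h /ₘ P) G).card := by
      exact_mod_cast hs
    have hdeg : h.natDegree = P.natDegree + (h /ₘ P).natDegree := by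
      rw [← natDegree_mul hP.1.1.ne_zero hm'.ne_zero, e]
    have hq0 : (Fintype.card F : ℝ) ≠ 0 := by exact_mod_cast Fintype.card_ne_zero
    rw [hs', i1, i2, Finset.prod_insert hPG, hdeg, pow_add]
    field_simp

theorem Us_char (χ : MulChar K ℂ) (hχ : χ ≠ 1) (G : Finset F[X]) : ∀ (h : F[X]),
    (∀ P ∈ G, MI P ∧ P ∣ h) →
    ‖∑ x ∈ Us K h G, χ x‖ ≤ 2 ^ G.card * √(Fintype.card K) := by
  classical
  induction G using Finset.induction_on with
  | empty =>
    intro h _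
    have := char_sum_bound χ hχ (kerA K h).toAddSubgroup
    have h2 : Us K h ∅ = Finset.univ.filter (· ∈ (kerA K h).toAddSubgroup) := by
      ext x; simp [Us, mem_kerA]
    rw [h2]; simpa using this
  | insert P G hPG ih =>
    intro h hG
    have hP := hG P (Finset.mem_insert_self _ _)
    have hG' : ∀ P ∈ G, MI P ∧ P ∣ h := fun P hP => hG P (Finset.mem_insert_of_mem hP)
    have hs := Us_insert (K := K) (fun x => χ x) h G hG' P hP.1 hP.2 hPG
    rw [hs, Finset.card_insert_of_notMem hPG, pow_succ]
    refine (norm_sub_le _ _).trans ?_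
    linarith [ih h hG', ih (h /ₘ P) (MI_dvd_divByMonic hG' hP.1 hP.2 hPG)]
end
end

section
set_option linter.unusedSectionVars false

def fpol (F : Type) [Field F] (n : ℕ) : F[X] := ∑ i ∈ Finset.range n, X ^ i

open Classical in
def TT (F : Type) [Field F] (n : ℕ) : Finset F[X] :=
  (UniqueFactorizationMonoid.normalizedFactors (fpol F n)).toFinset

section
variable {F K : Type} [Field F] [Fintype F] [Field K] [Fintype K] [Algebra F K]

theorem fpol_mul (n : ℕ) : fpol F n * (X - 1) = X ^ n - 1 := geom_sum_mul _ _

theorem fpol_coeff (n i : ℕ) : (fpol F n).coeff i = if i < n then 1 else 0 := by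
  simp [fpol, finsetSum_coeff, coeff_X_pow]

theorem fpol_natDegree (n : ℕ) (hn : 1 ≤ n) : (fpol F n).natDegree = n - 1 := by
  refine natDegree_eq_of_le_of_coeff_ne_zero ?_ ?_
  · rw [natDegree_le_iff_coeff_eq_zero]
    intro N hN; rw [fpol_coeff, if_neg (by omega)]
  · rw [fpol_coeff, if_pos (by omega)]; exact one_ne_zero

theorem fpol_monic (n : ℕ) (hn : 1 ≤ n) : (fpol F n).Monic := by
  rw [Monic, leadingCoeff, fpol_natDegree n hn, fpol_coeff, if_pos (by omega)]

theorem mem_TT (n : ℕ) (hn : 1 ≤ n) (P : F[X]) : P ∈ TT F n ↔ MI P ∧ P ∣ fpol F n := by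
  classical
  rw [TT, Multiset.mem_toFinset,
    UniqueFactorizationMonoid.mem_normalizedFactors_iff' (fpol_monic n hn).ne_zero, MI]
  constructor
  · rintro ⟨h1, h2, h3⟩
    exact ⟨⟨(normalize_eq_self_iff_monic h1.ne_zero).1 h2, h1⟩, h3⟩
  · rintro ⟨⟨h1, h2⟩, h3⟩
    exact ⟨h2, (normalize_eq_self_iff_monic h2.ne_zero).2 h1, h3⟩

theorem normal_of_LI (q n : ℕ) (hn : 2 ≤ n) (α : K)
    (h1 : LinearIndependent F (fun i : Fin (n - 1) => α ^ q ^ (i : ℕ)))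
    (h2 : α ^ q ^ (n - 1) ∈ Submodule.span F (Set.range fun i : Fin (n - 1) => α ^ q ^ (i : ℕ))) :
    IskNormal q n 1 F α := by
  rw [IskNormal]
  have : Submodule.span F (Set.range fun i : Fin n => α ^ q ^ (i : ℕ)) =
      Submodule.span F (Set.range fun i : Fin (n - 1) => α ^ q ^ (i : ℕ)) := by
    apply le_antisymm
    · rw [Submodule.span_le]
      rintro _ ⟨i, rfl⟩
      by_cases hi : (i : ℕ) < n - 1
      · exact Submodule.subset_span ⟨⟨i, hi⟩, rfl⟩
      · have : (i : ℕ) = n - 1 := by omega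
        simp only [this]; exact h2
    · apply Submodule.span_mono
      rintro _ ⟨i, rfl⟩
      exact ⟨⟨i, by omega⟩, rfl⟩
  rw [this, finrank_span_eq_card h1, Fintype.card_fin]

theorem ap_fpol (n : ℕ) (x : K) : ap (fpol F n) x = ∑ i ∈ Finset.range n, x ^ (Fintype.card F) ^ i := by
  simp [ap, fpol, frobL_pow]

theorem mem_span_of_sum (q n : ℕ) (hn : 2 ≤ n) (α : K) (h1 : ∑ i ∈ Finset.range n, α ^ q ^ i = 0) :
    α ^ q ^ (n - 1) ∈ Submodule.span F (Set.range fun i : Fin (n - 1) => α ^ q ^ (i : ℕ)) := by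
  obtain ⟨m, rfl⟩ : ∃ m, n = m + 1 := ⟨n - 1, by omega⟩
  rw [Finset.sum_range_succ] at h1
  simp only [Nat.add_sub_cancel]
  rw [eq_neg_of_add_eq_zero_right h1]
  refine Submodule.neg_mem _ (Submodule.sum_mem _ fun i hi => ?_)
  exact Submodule.subset_span ⟨⟨i, Finset.mem_range.1 hi⟩, rfl⟩

theorem normal_of_free (n : ℕ) (hn : 2 ≤ n) (α : K)
    (h1 : ap (fpol F n) α = 0) (h2 : ∀ P ∈ TT F n, ap (fpol F n /ₘ P) α ≠ 0) :
    IskNormal (Fintype.card F) n 1 F α := by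
  classical
  have hf := fpol_monic (F := F) n (by omega)
  have key : ∀ g : F[X], ap g α = 0 → fpol F n ∣ g := by
    intro g hg
    have hd := ap_gcd hg h1
    set d := EuclideanDomain.gcd g (fpol F n)
    obtain ⟨c, hc⟩ : d ∣ fpol F n := EuclideanDomain.gcd_dvd_right _ _
    have hdg : d ∣ g := EuclideanDomain.gcd_dvd_left _ _
    by_cases hcu : IsUnit c
    · obtain ⟨u, rfl⟩ := hcu
      rw [hc]; exact (Units.mul_right_dvd).2 hdg
    · exfalso
      have hc0 : c ≠ 0 := by rintro rfl; rw [mul_zero] at hc; exact hf.ne_zero hc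
      obtain ⟨P, hP, hPc⟩ := WfDvdMonoid.exists_irreducible_factor hcu hc0
      have hP' : MI (normalize P) := ⟨monic_normalize hP.ne_zero, (associated_normalize P).irreducible hP⟩
      have hPc' : normalize P ∣ c := normalize_dvd_iff.2 hPc
      obtain ⟨e, he⟩ := hPc'
      have hPf : normalize P ∣ fpol F n := ⟨d * e, by rw [hc, he]; ring⟩
      apply h2 _ ((mem_TT n (by omega) _).2 ⟨hP', hPf⟩)
      refine ap_dvd (g := d) ⟨e, ?_⟩ hd
      apply mul_left_cancel₀ hP'.1.ne_zero
      rw [divByMonic_mul_self hP'.1 hPf, hc, he]; ring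
  refine normal_of_LI _ _ hn _ ?_ (mem_span_of_sum _ _ hn _ ?_)
  · rw [Fintype.linearIndependent_iff]
    intro c hc
    let g : F[X] := ∑ i : Fin (n - 1), C (c i) * X ^ (i : ℕ)
    have hg : ap g α = 0 := by
      rw [← hc]
      simp only [ap, g, map_sum, map_mul, aeval_C, map_pow, aeval_X, LinearMap.sum_apply,
        Module.End.mul_apply, frobL_pow]
      rfl
    have hdeg : g.degree < (n - 1 : ℕ) := degree_sum_fin_lt c
    have hg0 : g = 0 := by
      by_contra hne
      have := degree_le_of_dvd (key g hg) hne
      rw [degree_eq_natDegree hf.ne_zero, fpol_natDegree n (by omega)] at this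
      exact absurd hdeg (not_lt.2 this)
    intro i
    have : g.coeff i = c i := by
      simp only [g, finsetSum_coeff, coeff_C_mul, coeff_X_pow]
      rw [Finset.sum_eq_single i]
      · simp
      · intro b _ hb; rw [if_neg, mul_zero]; intro h; exact hb (Fin.ext h.symm)
      · simp
    rw [← this, hg0, coeff_zero]
  · rw [← ap_fpol]; exact h1

theorem mem_range_of_pow (x : K) (hx : x ^ Fintype.card F = x) : ∃ c : F, algebraMap F K c = x := by
  classical
  have h1 : Module.finrank F (kerA K (X - 1 : F[X])) = 1 := by
    rw [finrank_kerA]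
    · exact natDegree_X_sub_C 1
    · have := sub_dvd_pow_sub_pow (X : F[X]) 1 (Module.finrank F K)
      rwa [one_pow] at this
  have hm : ∀ y : K, y ^ Fintype.card F = y → y ∈ kerA K (X - 1 : F[X]) := by
    intro y hy
    rw [mem_kerA, ap]
    have := frobL_pow (F := F) 1 y
    rw [pow_one, pow_one, hy] at this
    simp [this]
  obtain ⟨c, hc⟩ := (finrank_eq_one_iff_of_nonzero' (⟨1, hm 1 (one_pow _)⟩ : kerA K (X - 1 : F[X]))
    (by intro h; exact one_ne_zero (congrArg Subtype.val h))).1 h1 ⟨x, hm x hx⟩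
  refine ⟨c, ?_⟩
  have := congrArg Subtype.val hc
  rw [Algebra.algebraMap_eq_smul_one]; exact this

theorem prim_scale (Q : ℕ) (hQ : Q * (Fintype.card F - 1) = Fintype.card K - 1)
    (χ : ℕ → MulChar K ℂ) (hχ : ∀ l ∈ Q.primeFactors, orderOf (χ l) = l) (α : K) (h0 : α ≠ 0)
    (hα : ∀ l ∈ Q.primeFactors, χ l α ≠ 1) :
    ∃ c : F, c ≠ 0 ∧ IsPrimitiveElt (c • α) := by
  classical
  have hq1 : 1 < Fintype.card F := Fintype.one_lt_card
  have hK1 : 1 < Fintype.card K := Fintype.one_lt_card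
  have hQ0 : Q ≠ 0 := by rintro rfl; omega
  obtain ⟨g, hg⟩ := IsCyclic.exists_monoid_generator (α := Kˣ)
  obtain ⟨a, ha⟩ := hg (Units.mk0 α h0)
  simp only at ha
  have ha' : α = (g : K) ^ a := by
    have := congrArg Units.val ha; simpa using this.symm
  have hcop : a.Coprime Q := by
    rw [Nat.coprime_comm]
    refine Nat.Coprime.symm (Nat.coprime_of_dvd ?_)
    intro l hl hla hlQ
    have hlm : l ∈ Q.primeFactors := Nat.mem_primeFactors.2 ⟨hl, hlQ, hQ0⟩
    apply hα l hlm
    obtain ⟨b, rfl⟩ := hla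
    rw [ha', mul_comm l, pow_mul, map_pow, ← MulChar.pow_apply' _ hl.ne_zero]
    have := pow_orderOf_eq_one (χ l)
    rw [hχ l hlm] at this
    rw [this, MulChar.one_apply (g.isUnit.pow b)]
  set N := Fintype.card K - 1 with hN
  have hNe : NeZero N := ⟨by omega⟩
  have hord : g ^ N = 1 := by
    rw [hN, ← Fintype.card_units]; exact pow_card_eq_one
  obtain ⟨b, hb⟩ := ZMod.unitsMap_surjective (Dvd.intro _ hQ) (ZMod.unitOfCoprime a hcop)
  set b' := (b : ZMod N).val with hb'
  have hbc : b'.Coprime N := ZMod.val_coe_unit_coprime b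
  have hmod : (b' : ZMod Q) = a := by
    have := congrArg Units.val hb
    rw [ZMod.unitsMap_val, ZMod.coe_unitOfCoprime] at this
    rw [← this, hb', ZMod.cast_eq_val]
  have hmodz : (Q : ℤ) ∣ (b' : ℤ) - a := by
    rw [← ZMod.intCast_zmod_eq_zero_iff_dvd _ _] 
    push_cast; rw [hmod, sub_self]
  obtain ⟨k, hk⟩ := hmodz
  set z : Kˣ := g ^ ((Q : ℤ) * k) with hz
  have hzq : z ^ (Fintype.card F - 1) = 1 := by
    rw [hz, ← zpow_natCast, ← zpow_mul, mul_right_comm, zpow_mul, ← Nat.cast_mul, hQ, zpow_natCast, hord, one_zpow]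
  have hzq' : (z : K) ^ Fintype.card F = z := by
    have h1 : z ^ Fintype.card F = z := by
      rw [← Nat.sub_add_cancel hq1.le, pow_succ, hzq, one_mul]
    exact_mod_cast congrArg Units.val h1
  obtain ⟨c, hc⟩ := mem_range_of_pow (F := F) (z : K) hzq'
  refine ⟨c, ?_, ?_⟩
  · rintro rfl; rw [map_zero] at hc; exact z.ne_zero hc.symm
  · have h1 : z * Units.mk0 α h0 = g ^ b' := by
      rw [← ha, hz, ← hk, ← zpow_natCast g a, ← zpow_add, sub_add_cancel, zpow_natCast]
    have h2 : c • α = ((g ^ b' : Kˣ) : K) := by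
      rw [← h1, Algebra.smul_def, hc]; simp
    rw [h2]
    have h3 : b'.Coprime (orderOf g) := hbc.coprime_dvd_right (orderOf_dvd_of_pow_eq_one hord)
    obtain ⟨m, hm⟩ := exists_pow_eq_self_of_coprime h3
    intro y hy
    obtain ⟨j, hj⟩ := hg (Units.mk0 y hy)
    refine ⟨m * j, ?_⟩
    have : (g ^ b') ^ (m * j) = Units.mk0 y hy := by rw [pow_mul, hm]; exact hj
    have h4 := congrArg Units.val this
    rw [Units.val_pow_eq_pow_val] at h4
    exact h4

open Classical in
theorem crit (q n Q : ℕ) (hn : 2 ≤ n) (hcF : Fintype.card F = q) (hrK : Module.finrank F K = n)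
    (hQ : Q * (q - 1) = q ^ n - 1) (G : Finset F[X]) (hG : G ⊆ TT F n)
    (S T : Finset ℕ) (hST : Disjoint S T) (hU : Q.primeFactors = S ∪ T)
    (h0 : 0 ≤ 1 - ∑ l ∈ T, 1 / (l:ℝ))
    (hmain : (2 ^ G.card * √((q:ℝ) ^ n)) * ((2 ^ S.card - 1) + T.card * 2 ^ S.card)
      + ∑ P ∈ TT F n \ G, ((q:ℝ) ^ (n - 1) / (q:ℝ) ^ P.natDegree + √((q:ℝ) ^ n) * (2 ^ S.card - 1))
      < ((q:ℝ) ^ (n - 1) * ∏ P ∈ G, (1 - 1 / (q : ℝ) ^ P.natDegree) - 1) * (1 - ∑ l ∈ T, 1 / (l:ℝ))) :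
    ∃ α : K, IsPrimitiveElt α ∧ IskNormal q n 1 F α := by
  have hf := fpol_monic (F := F) n (by omega)
  have hfd : fpol F n ∣ X ^ (Module.finrank F K) - 1 := by
    rw [hrK]; exact ⟨_, (fpol_mul n).symm⟩
  have hcK : Fintype.card K = q ^ n := by
    rw [Module.card_eq_pow_finrank (K := F), hcF, hrK]
  have hcK' : (Fintype.card K : ℝ) = (q:ℝ) ^ n := by rw [hcK]; push_cast; rfl
  have hq1 : 1 < q := by rw [← hcF]; exact Fintype.one_lt_card
  have hex : ∀ l ∈ Q.primeFactors, ∃ χ : MulChar K ℂ, orderOf χ = l := by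
    intro l hl
    have hl' := Nat.mem_primeFactors.1 hl
    refine MulChar.exists_mulChar_orderOf K (n := l) ?_ (Complex.isPrimitiveRoot_exp l hl'.1.ne_zero)
    rw [hcK, ← hQ]; exact hl'.2.1.mul_right _
  choose! χ hχ using hex
  have hS : ∀ l ∈ S, l ∈ Q.primeFactors := fun l hl => by rw [hU]; exact Finset.mem_union_left _ hl
  have hT : ∀ l ∈ T, l ∈ Q.primeFactors := fun l hl => by rw [hU]; exact Finset.mem_union_right _ hl
  have hTT : ∀ P ∈ TT F n, MI P ∧ P ∣ fpol F n := fun P hP => (mem_TT n (by omega) P).1 hP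
  have hGT : ∀ P ∈ G, MI P ∧ P ∣ fpol F n := fun P hP => hTT P (hG hP)
  obtain ⟨x, hxA, hx0, hxS, hxT, hxR⟩ := sieve_main χ (Us K (fpol F n) G) (2 ^ G.card * √((q:ℝ) ^ n))
    (√((q:ℝ) ^ n)) (fun ψ hψ => by rw [← hcK']; exact Us_char ψ hψ G _ hGT)
    (TT F n \ G) (fun P => Us K (fpol F n /ₘ P) ∅)
    (fun P _ ψ hψ => by
      have := Us_char ψ hψ ∅ (fpol F n /ₘ P) (by simp)
      rw [hcK'] at this; simpa using this)
    S T hST (fun l hl => (Nat.mem_primeFactors.1 (hS l hl)).1) (fun l hl => hχ l (hS l hl))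
    (fun l hl => (Nat.mem_primeFactors.1 (hT l hl)).1) (fun l hl => hχ l (hT l hl)) (by
      have e1 : (q:ℝ) ^ (n - 1) * ∏ P ∈ G, (1 - 1 / (q : ℝ) ^ P.natDegree) - 1 ≤
          (((Us K (fpol F n) G).filter (fun x => x ≠ 0)).card : ℝ) := by
        have := Us_card (K := K) G _ hf hfd hGT
        rw [fpol_natDegree n (by omega), hcF] at this
        rw [← this, sub_le_iff_le_add]
        have h2 : (Us K (fpol F n) G).card ≤ ((Us K (fpol F n) G).filter (fun x => x ≠ 0)).card + 1 := by
          rw [← Finset.card_filter_add_card_filter_not (s := Us K (fpol F n) G) (fun x => x ≠ 0)]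
          gcongr
          rw [Finset.card_le_one]
          intro a ha b hb
          simp at ha hb
          rw [ha.2, hb.2]
        exact_mod_cast h2
      refine lt_of_le_of_lt (add_le_add le_rfl ?_) (hmain.trans_le (mul_le_mul_of_nonneg_right e1 h0))
      refine Finset.sum_le_sum fun P hP => add_le_add ?_ le_rfl
      have hP' := hTT P (Finset.mem_sdiff.1 hP).1
      have e := divByMonic_mul_self hP'.1.1 hP'.2
      have hm' : (fpol F n /ₘ P).Monic := by
        have : (P * (fpol F n /ₘ P)).Monic := by rwa [e]
        exact hP'.1.1.of_mul_monic_left this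
      have := Us_card (K := K) ∅ (fpol F n /ₘ P) hm' ((Dvd.intro_left _ e).trans hfd) (by simp)
      have hdeg : n - 1 = P.natDegree + (fpol F n /ₘ P).natDegree := by
        rw [← natDegree_mul hP'.1.1.ne_zero hm'.ne_zero, e, fpol_natDegree n (by omega)]
      rw [hdeg, pow_add, mul_div_cancel_left₀ _ (by positivity)]
      simp only [Finset.prod_empty, mul_one, hcF] at this
      rw [← this]
      exact_mod_cast Finset.card_filter_le _ _)
  obtain ⟨c, hc, hcp⟩ := prim_scale (F := F) Q (by rw [hcF, hcK, hQ]) χ hχ x hx0 (by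
    intro l hl
    rw [hU] at hl
    rcases Finset.mem_union.1 hl with h | h
    exacts [hxS l h, hxT l h])
  refine ⟨c • x, hcp, ?_⟩
  rw [← hcF]
  simp only [Us, Finset.mem_filter, Finset.mem_univ, true_and] at hxA hxR
  refine normal_of_free n hn _ (by rw [ap_smul, hxA.1, smul_zero]) ?_
  intro P hP
  rw [ap_smul]
  refine smul_ne_zero hc ?_
  by_cases hPG : P ∈ G
  · exact hxA.2 P hPG
  · intro h; exact hxR P (Finset.mem_sdiff.2 ⟨hP, hPG⟩) ⟨h, by simp⟩

theorem no_two (q : ℕ) (hcF : Fintype.card F = q) (hrK : Module.finrank F K = 2) :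
    ¬ ∃ α : K, IsPrimitiveElt α ∧ IskNormal q 2 1 F α := by
  rintro ⟨α, hp, hk⟩
  have hcK : Fintype.card K = q ^ 2 := by
    rw [Module.card_eq_pow_finrank (K := F), hcF, hrK]
  have hq1 : 1 < q := by rw [← hcF]; exact Fintype.one_lt_card
  have hα : α ≠ 0 := by
    rintro rfl
    obtain ⟨m, hm⟩ := hp 1 one_ne_zero
    have hm0 : m = 0 := by by_contra h; rw [zero_pow h] at hm; exact zero_ne_one hm
    have : ∀ b : K, b ≠ 0 → b = 1 := by
      intro b hb
      obtain ⟨k, rfl⟩ := hp b hb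
      rcases Nat.eq_zero_or_pos k with h | h
      · simp [h]
      · rw [zero_pow h.ne'] at hb; exact absurd rfl hb
    have h2 : Fintype.card K ≤ 2 := by
      classical
      rw [← Finset.card_univ]
      refine (Finset.card_le_card (t := {0, 1}) ?_).trans Finset.card_le_two
      intro b _
      by_cases hb : b = 0
      · simp [hb]
      · simp [this b hb]
    nlinarith
  rw [IskNormal] at hk
  have hm0 : α ∈ Submodule.span F (Set.range fun i : Fin 2 => α ^ q ^ (i : ℕ)) :=
    Submodule.subset_span ⟨0, by simp⟩
  have hm1 : α ^ q ∈ Submodule.span F (Set.range fun i : Fin 2 => α ^ q ^ (i : ℕ)) :=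
    Submodule.subset_span ⟨1, by simp⟩
  obtain ⟨c, hc⟩ := (finrank_eq_one_iff_of_nonzero' (⟨α, hm0⟩ : Submodule.span F (Set.range fun i : Fin 2 => α ^ q ^ (i : ℕ)))
    (by intro h; exact hα (congrArg Subtype.val h))).1 hk ⟨_, hm1⟩
  have hc' : c • α = α ^ q := congrArg Subtype.val hc
  have hcc : algebraMap F K c = α ^ (q - 1) := by
    have : algebraMap F K c * α = α ^ (q - 1) * α := by
      rw [← pow_succ, Nat.sub_add_cancel hq1.le, ← hc', Algebra.smul_def]
    exact mul_right_cancel₀ hα this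
  have hc2 : α ^ (q * q) = α := by
    rw [← sq, ← hcK]; exact FiniteField.pow_card α
  have hcq : c ^ q = c := by rw [← hcF]; exact FiniteField.pow_card c
  have h4 : (algebraMap F K c) * (algebraMap F K c) = 1 := by
    have h5 : α ^ (q * q) = algebraMap F K c * (algebraMap F K c * α) := by
      rw [pow_mul, ← hc', Algebra.smul_def, mul_pow, ← map_pow, hcq, ← hc', Algebra.smul_def]
    rw [hc2, ← mul_assoc] at h5
    exact mul_right_cancel₀ hα (by rw [one_mul]; exact h5.symm)
  have h6 : α ^ (2 * (q - 1)) = 1 := by rw [two_mul, pow_add, ← hcc, h4]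
  have h7 : Fintype.card K - 1 ≤ 2 * (q - 1) := by
    classical
    have : Finset.univ.erase (0:K) ⊆ (Finset.range (2 * (q - 1))).image (fun i => α ^ i) := by
      intro b hb
      obtain ⟨m, rfl⟩ := hp b (Finset.ne_of_mem_erase hb)
      refine Finset.mem_image.2 ⟨m % (2 * (q - 1)), Finset.mem_range.2 (Nat.mod_lt _ (by omega)), ?_⟩
      exact (pow_eq_pow_mod m h6).symm
    have h8 := (Finset.card_le_card this).trans Finset.card_image_le
    rwa [Finset.card_erase_of_mem (Finset.mem_univ _), Finset.card_univ, Finset.card_range] at h8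
  rw [hcK] at h7
  obtain ⟨r, rfl⟩ : ∃ r, q = r + 2 := ⟨q - 2, by omega⟩
  have h9 : (r + 2) ^ 2 = r * r + 4 * r + 4 := by ring
  have := Nat.zero_le (r * r)
  omega
end
end

section
set_option linter.unusedSectionVars false

/-- Upper bound for the number of irreducible factors of degree `d`. -/
def tb (q n d : ℕ) : ℕ :=
  if d = 1 ∧ 1 < Nat.gcd n q then Nat.gcd n (q ^ d - 1) else (Nat.gcd n (q ^ d - 1) - 1) / d

section
variable {F : Type} [Field F] [Fintype F]

theorem MI_deg_sum (G : Finset F[X]) (h : F[X]) (hh : h ≠ 0) (hG : ∀ P ∈ G, MI P ∧ P ∣ h) :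
    ∑ P ∈ G, P.natDegree ≤ h.natDegree := by
  have hd : ∏ P ∈ G, P ∣ h := by
    refine Finset.prod_dvd_of_coprime ?_ (fun P hP => (hG P hP).2)
    intro P hP P' hP' hne
    exact (hG P hP).1.coprime (hG P' hP').1 hne
  rw [← natDegree_prod_of_monic _ _ (fun P hP => (hG P hP).1.1)]
  exact natDegree_le_of_dvd hd hh

theorem dvd_gcd_pow {P : F[X]} (a b : ℕ) (ha : P ∣ X ^ a - 1) (hb : P ∣ X ^ b - 1) :
    P ∣ X ^ (Nat.gcd a b) - 1 := by
  have conv : ∀ k, P ∣ X ^ k - 1 ↔ (AdjoinRoot.root P) ^ k = 1 := by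
    intro k
    rw [← AdjoinRoot.mk_eq_zero]
    simp [sub_eq_zero]
  rw [conv] at *
  exact orderOf_dvd_iff_pow_eq_one.1 (Nat.dvd_gcd (orderOf_dvd_of_pow_eq_one ha) (orderOf_dvd_of_pow_eq_one hb))

theorem TT_dvd {n : ℕ} (hn : 1 ≤ n) {P : F[X]} (hP : P ∈ TT F n) :
    P ∣ X ^ (Nat.gcd n (Fintype.card F ^ P.natDegree - 1)) - 1 := by
  have h := (mem_TT n hn P).1 hP
  have h1 : P ∣ X ^ n - 1 := h.2.trans ⟨_, (fpol_mul n).symm⟩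
  refine dvd_gcd_pow _ _ h1 ?_
  have h2 := (Irreducible.natDegree_dvd_iff_dvd_X_pow_card_pow_sub_X h.1.2 (n := P.natDegree)).1 dvd_rfl
  have hq : 1 ≤ Fintype.card F ^ P.natDegree := Nat.one_le_pow _ _ Fintype.card_pos
  rw [Nat.card_eq_fintype_card] at h2
  have h3 : (X ^ (Fintype.card F) ^ P.natDegree - X : F[X]) = X * (X ^ (Fintype.card F ^ P.natDegree - 1) - 1) := by
    rw [mul_sub, ← pow_succ', Nat.sub_add_cancel hq, mul_one]
  rw [h3] at h2
  rcases h.1.2.prime.dvd_or_dvd h2 with h4 | h4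
  · exfalso
    have h5 : P ∣ 1 := by
      have : (1 : F[X]) = X ^ n - (X ^ n - 1) := by ring
      rw [this]
      exact dvd_sub (h4.trans (dvd_pow_self _ (by omega))) h1
    exact h.1.2.not_isUnit (isUnit_of_dvd_one h5)
  · exact h4

theorem Xsub1_MI : MI (X - 1 : F[X]) := ⟨monic_X_sub_C 1, irreducible_X_sub_C 1⟩

theorem not_mem_TT {n : ℕ} (hn : 1 ≤ n) (h : Nat.gcd n (Fintype.card F) = 1) : (X - 1 : F[X]) ∉ TT F n := by
  intro hm
  have h1 := ((mem_TT n hn _).1 hm).2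
  have h2 : (fpol F n).eval 1 = 0 := by
    rw [← IsRoot, ← dvd_iff_isRoot, C_1]; exact h1
  simp [fpol, eval_finsetSum] at h2
  obtain ⟨p, hp⟩ := CharP.exists F
  have := Fact.mk (CharP.char_is_prime F p)
  have h3 : p ∣ n := (CharP.cast_eq_zero_iff F p n).1 h2
  have h4 : p ∣ Fintype.card F := by
    rw [← CharP.cast_eq_zero_iff F p]; exact FiniteField.cast_card_eq_zero F
  have := Nat.dvd_gcd h3 h4
  rw [h] at this
  exact (CharP.char_is_prime F p).one_lt.ne' (Nat.dvd_one.1 this)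

open Classical in
theorem TT_count {n d : ℕ} (hn : 1 ≤ n) (hd : 1 ≤ d) :
    ((TT F n).filter (fun P => P.natDegree = d)).card ≤ tb (Fintype.card F) n d := by
  set q := Fintype.card F with hq
  have hq1 : 1 < q := Fintype.one_lt_card
  set g := Nat.gcd n (q ^ d - 1) with hg
  have hg0 : 0 < g := Nat.gcd_pos_of_pos_left _ (by omega)
  have hX : (X ^ g - 1 : F[X]) ≠ 0 := X_pow_sub_C_ne_zero hg0 1
  have hXd : (X ^ g - 1 : F[X]).natDegree = g := natDegree_X_pow_sub_C
  set G := (TT F n).filter (fun P => P.natDegree = d) with hG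
  have hG1 : ∀ P ∈ G, MI P ∧ P ∣ X ^ g - 1 := by
    intro P hP
    rw [hG, Finset.mem_filter] at hP
    refine ⟨((mem_TT n hn P).1 hP.1).1, ?_⟩
    have := TT_dvd hn hP.1
    rwa [hP.2] at this
  have hdegG : ∑ P ∈ G, P.natDegree = G.card * d := by
    rw [Finset.sum_congr rfl (g := fun _ => d) (fun P hP => (Finset.mem_filter.1 hP).2),
      Finset.sum_const, smul_eq_mul]
  rw [tb]
  split_ifs with hc
  · have := MI_deg_sum G _ hX hG1
    rw [hdegG, hXd, hc.1, mul_one] at this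
    rw [hc.1] at hg ⊢; rw [hg] at this; exact this
  · have hnot : (X - 1 : F[X]) ∉ G := by
      intro hm
      rw [hG, Finset.mem_filter] at hm
      have hd1 : d = 1 := by rw [← hm.2]; exact natDegree_X_sub_C 1
      refine not_mem_TT hn ?_ hm.1
      rw [← hq]
      have : 0 < Nat.gcd n q := Nat.gcd_pos_of_pos_left _ (by omega)
      have h2 : ¬ 1 < Nat.gcd n q := fun h => hc ⟨hd1, h⟩
      omega
    have h3 := MI_deg_sum (insert (X - 1) G) _ hX (by
      intro P hP
      rcases Finset.mem_insert.1 hP with rfl | hP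
      · refine ⟨Xsub1_MI, ?_⟩
        have := sub_dvd_pow_sub_pow (X : F[X]) 1 g
        rwa [one_pow] at this
      · exact hG1 P hP)
    have h4 : (X - 1 : F[X]).natDegree = 1 := natDegree_X_sub_C 1
    rw [Finset.sum_insert hnot, hdegG, hXd, h4] at h3
    rw [Nat.le_div_iff_mul_le (by omega)]
    omega

theorem TT_deg_pos {n : ℕ} (hn : 1 ≤ n) {P : F[X]} (hP : P ∈ TT F n) : 1 ≤ P.natDegree :=
  ((mem_TT n hn P).1 hP).1.2.natDegree_pos

theorem TT_deg_sum {n : ℕ} (hn : 1 ≤ n) : ∑ P ∈ TT F n, P.natDegree ≤ n - 1 := by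
  rw [← fpol_natDegree (F := F) n hn]
  exact MI_deg_sum _ _ (fpol_monic n hn).ne_zero (fun P hP => (mem_TT n hn P).1 hP)

theorem TT_card {n : ℕ} (hn : 1 ≤ n) : (TT F n).card ≤ n - 1 := by
  refine le_trans ?_ (TT_deg_sum (F := F) hn)
  rw [Finset.card_eq_sum_ones]
  exact Finset.sum_le_sum fun P hP => TT_deg_pos hn hP

open Classical in
theorem TT_count_big {n D : ℕ} (hn : 1 ≤ n) :
    ((TT F n).filter (fun P => D < P.natDegree)).card ≤ (n - 1) / (D + 1) := by
  rw [Nat.le_div_iff_mul_le (by omega)]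
  refine le_trans ?_ (TT_deg_sum (F := F) hn)
  rw [← smul_eq_mul, ← Finset.sum_const]
  refine le_trans (Finset.sum_le_sum (g := fun P => P.natDegree) fun P hP => (Finset.mem_filter.1 hP).2) ?_
  exact Finset.sum_le_sum_of_subset (Finset.filter_subset _ _)
end
end

section
set_option linter.unusedSectionVars false

theorem prod_primes_64 (A : Finset ℕ) (hA : ∀ l ∈ A, l.Prime) :
    64 ^ A.card ≤ 2800000000 * ∏ l ∈ A, l := by
  classical
  set P0 := (Finset.range 64).filter Nat.Prime with hP0
  have hc : P0.card = 18 := by decide +kernel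
  have hpr : 64 ^ 18 ≤ 2800000000 * ∏ l ∈ P0, l := by decide +kernel
  set A1 := A.filter (fun l => l < 64)
  set A2 := A.filter (fun l => ¬ l < 64)
  have hcard : A.card = A1.card + A2.card := (Finset.card_filter_add_card_filter_not _).symm
  have hprod : ∏ l ∈ A, l = (∏ l ∈ A1, l) * ∏ l ∈ A2, l := (Finset.prod_filter_mul_prod_filter_not _ _ _).symm
  have h2 : 64 ^ A2.card ≤ ∏ l ∈ A2, l := by
    rw [← Finset.prod_const]
    exact Finset.prod_le_prod' fun l hl => by have := (Finset.mem_filter.1 hl).2; omega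
  have hsub : A1 ⊆ P0 := by
    intro l hl
    rw [Finset.mem_filter] at hl
    rw [hP0, Finset.mem_filter, Finset.mem_range]; exact ⟨hl.2, hA l hl.1⟩
  have h3 : ∏ l ∈ P0 \ A1, l ≤ 64 ^ (P0 \ A1).card := by
    rw [← Finset.prod_const]
    refine Finset.prod_le_prod' fun l hl => ?_
    have := (Finset.mem_sdiff.1 hl).1
    rw [hP0, Finset.mem_filter, Finset.mem_range] at this; omega
  have h4 : (∏ l ∈ P0 \ A1, l) * ∏ l ∈ A1, l = ∏ l ∈ P0, l := Finset.prod_sdiff hsub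
  have h5 : (P0 \ A1).card + A1.card = 18 := by rw [← hc]; exact Finset.card_sdiff_add_card_eq_card hsub
  have h6 : 64 ^ A1.card ≤ 2800000000 * ∏ l ∈ A1, l := by
    have h7 : (64:ℕ) ^ (P0 \ A1).card * 64 ^ A1.card ≤ 64 ^ (P0 \ A1).card * (2800000000 * ∏ l ∈ A1, l) := by
      rw [← pow_add, h5]
      refine hpr.trans ?_
      rw [← h4]
      calc 2800000000 * ((∏ l ∈ P0 \ A1, l) * ∏ l ∈ A1, l) = (∏ l ∈ P0 \ A1, l) * (2800000000 * ∏ l ∈ A1, l) := by ring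
        _ ≤ _ := Nat.mul_le_mul_right _ h3
    exact Nat.le_of_mul_le_mul_left h7 (by positivity)
  rw [hcard, hprod, pow_add]
  calc _ ≤ (2800000000 * ∏ l ∈ A1, l) * ∏ l ∈ A2, l := Nat.mul_le_mul h6 h2
    _ = _ := by ring

theorem W_bound (Q : ℕ) (hQ : Q ≠ 0) : ((2:ℝ) ^ Q.primeFactors.card) ^ 12 ≤ (2800000000 * (Q:ℝ)) ^ 2 := by
  have h1 := prod_primes_64 Q.primeFactors (fun l hl => Nat.prime_of_mem_primeFactors hl)
  have h2 : ∏ l ∈ Q.primeFactors, l ≤ Q := Nat.le_of_dvd (by omega) (Nat.prod_primeFactors_dvd Q)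
  have h3 : 64 ^ Q.primeFactors.card ≤ 2800000000 * Q := h1.trans (Nat.mul_le_mul_left _ h2)
  have h4 : ((64:ℝ)) ^ Q.primeFactors.card ≤ 2800000000 * Q := by exact_mod_cast h3
  calc ((2:ℝ) ^ Q.primeFactors.card) ^ 12 = (((64:ℝ)) ^ Q.primeFactors.card) ^ 2 := by
        rw [← pow_mul, ← pow_mul, mul_comm _ 12, mul_comm _ 2, pow_mul, pow_mul]; norm_num
    _ ≤ _ := by gcongr

section
variable {F K : Type} [Field F] [Fintype F] [Field K] [Fintype K] [Algebra F K]

def wP (q d : ℕ) : ℝ := 2 / (1 - 1 / (q:ℝ) ^ d)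

theorem one_sub_pos {q d : ℕ} (hq : 2 ≤ q) (hd : 1 ≤ d) : 0 < 1 - 1 / (q:ℝ) ^ d := by
  have h1 : (1:ℝ) < (q:ℝ) ^ d := one_lt_pow₀ (by exact_mod_cast hq) (by omega)
  rw [sub_pos, div_lt_one (by linarith)]; exact h1

theorem asym (q n Q : ℕ) (hn : 2 ≤ n) (hcF : Fintype.card F = q) (hrK : Module.finrank F K = n)
    (hQ : Q * (q - 1) = q ^ n - 1)
    (h : (∏ P ∈ TT F n, wP q P.natDegree) ^ 12 * (4 * 2800000000 ^ 2 * (q:ℝ) ^ 10) ≤ (q:ℝ) ^ (4 * n)) :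
    ∃ α : K, IsPrimitiveElt α ∧ IskNormal q n 1 F α := by
  classical
  have hq1 : 2 ≤ q := by rw [← hcF]; exact Fintype.one_lt_card
  have hqR : (2:ℝ) ≤ q := by exact_mod_cast hq1
  have hpos : ∀ P ∈ TT F n, 0 < 1 - 1 / (q:ℝ) ^ P.natDegree := fun P hP =>
    one_sub_pos hq1 (TT_deg_pos (by omega) hP)
  have hQ0 : Q ≠ 0 := by
    rintro rfl
    have : 2 ^ 1 ≤ q ^ n := (Nat.pow_le_pow_left hq1 1).trans (Nat.pow_le_pow_right (by omega) (by omega))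
    omega
  have hQle : (Q:ℝ) ≤ 2 * (q:ℝ) ^ (n - 1) := by
    have h1 : Q * (q - 1) ≤ q ^ n := by omega
    have h2 : q ^ n = q ^ (n - 1) * q := by rw [← pow_succ, Nat.sub_add_cancel (by omega)]
    have h3 : Q * (q - 1) ≤ 2 * q ^ (n - 1) * (q - 1) := by
      rw [h2] at h1
      refine h1.trans ?_
      calc q ^ (n - 1) * q ≤ q ^ (n - 1) * (2 * (q - 1)) := Nat.mul_le_mul_left _ (by omega)
        _ = _ := by ring
    exact_mod_cast Nat.le_of_mul_le_mul_right h3 (by omega)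
  set V := ∏ P ∈ TT F n, wP q P.natDegree with hV
  set θ := ∏ P ∈ TT F n, (1 - 1 / (q:ℝ) ^ P.natDegree) with hθ
  have hθ0 : 0 < θ := Finset.prod_pos hpos
  have hVθ : 2 ^ (TT F n).card = V * θ := by
    rw [hV, hθ, ← Finset.prod_mul_distrib, ← Finset.prod_const]
    refine Finset.prod_congr rfl fun P hP => ?_
    rw [wP, div_mul_cancel₀ _ (hpos P hP).ne']
  have hV0 : 0 < V := by
    have : 0 < V * θ := by rw [← hVθ]; positivity
    exact (pos_iff_pos_of_mul_pos this).2 hθ0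
  set W : ℝ := 2 ^ Q.primeFactors.card with hW
  have hW0 : 0 < W := by positivity
  set B := √((q:ℝ) ^ n) with hB
  have hB2 : B ^ 2 = (q:ℝ) ^ n := Real.sq_sqrt (by positivity)
  have hB1 : 1 ≤ B := by
    rw [hB, Real.one_le_sqrt]; exact one_le_pow₀ (by linarith)
  have key : V * B * W ≤ (q:ℝ) ^ (n - 1) := by
    have h12 : (V * B * W) ^ 12 ≤ ((q:ℝ) ^ (n - 1)) ^ 12 := by
      have e1 : W ^ 12 ≤ (2800000000 * (2 * (q:ℝ) ^ (n - 1))) ^ 2 := by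
        refine (W_bound Q hQ0).trans ?_
        gcongr
      have e2 : B ^ 12 = (q:ℝ) ^ (6 * n) := by
        rw [show (12:ℕ) = 2 * 6 by norm_num, pow_mul, hB2, ← pow_mul, mul_comm]
      calc (V * B * W) ^ 12 = V ^ 12 * (q:ℝ) ^ (6 * n) * W ^ 12 := by rw [mul_pow, mul_pow, e2]
        _ ≤ V ^ 12 * (q:ℝ) ^ (6 * n) * (2800000000 * (2 * (q:ℝ) ^ (n - 1))) ^ 2 := by gcongr
        _ ≤ _ := by
          obtain ⟨m, rfl⟩ : ∃ m, n = m + 1 := ⟨n - 1, by omega⟩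
          simp only [Nat.add_sub_cancel]
          have e3 : (q:ℝ) ^ 10 * (V ^ 12 * (q:ℝ) ^ (6 * (m + 1)) * (2800000000 * (2 * (q:ℝ) ^ m)) ^ 2)
            = (V ^ 12 * (4 * 2800000000 ^ 2 * (q:ℝ) ^ 10)) * (q:ℝ) ^ (8 * m + 6) := by ring
          have e4 : (q:ℝ) ^ 10 * ((q:ℝ) ^ m) ^ 12 = (q:ℝ) ^ (4 * (m + 1)) * (q:ℝ) ^ (8 * m + 6) := by ring
          have hq10 : (0:ℝ) < (q:ℝ) ^ 10 := by positivity
          refine le_of_mul_le_mul_left ?_ hq10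
          rw [e3, e4]
          gcongr
    exact (pow_le_pow_iff_left₀ (by positivity) (by positivity) (by norm_num)).1 h12
  refine crit q n Q hn hcF hrK hQ (TT F n) subset_rfl Q.primeFactors ∅ (Finset.disjoint_empty_right _)
    (Finset.union_empty _).symm (by simp) ?_
  simp only [Finset.card_empty, Finset.sum_empty, Finset.sdiff_self, Nat.cast_zero, zero_mul, add_zero, sub_zero, mul_one]
  rw [← hB, ← hW, ← hθ, hVθ]
  have h5 : θ * (V * B * W) ≤ θ * (q:ℝ) ^ (n - 1) := by gcongr
  by_cases hT : TT F n = ∅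
  · exfalso
    have hu : IsUnit (fpol F n) := by
      by_contra hu
      obtain ⟨P, hP, hPc⟩ := WfDvdMonoid.exists_irreducible_factor hu (fpol_monic n (by omega)).ne_zero
      have hm := (mem_TT n (by omega) (normalize P)).2 ⟨⟨monic_normalize hP.ne_zero, (associated_normalize P).irreducible hP⟩,
        normalize_dvd_iff.2 hPc⟩
      rw [hT] at hm; simp at hm
    have := natDegree_eq_zero_of_isUnit hu
    rw [fpol_natDegree n (by omega)] at this
    omega
  · have h6 : (2:ℝ) ≤ V * θ := by
      rw [← hVθ]
      exact le_self_pow₀ (by norm_num) (by rw [Ne, Finset.card_eq_zero]; exact hT)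
    have h7 : (2:ℝ) ≤ V * θ * B := by nlinarith
    nlinarith

theorem asym_big (q n Q lo n0 : ℕ) (hn0 : 3 ≤ n0) (hn : n0 ≤ n) (hlo : 2 ≤ lo) (hq : lo ≤ q)
    (hcF : Fintype.card F = q) (hrK : Module.finrank F K = n)
    (hQ : Q * (q - 1) = q ^ n - 1) (hmono : n = n0 ∨ 16 ≤ lo)
    (hchk : 4 * 2800000000 ^ 2 * (2 * lo) ^ (12 * (n0 - 1)) ≤ lo ^ (4 * n0 - 10) * (lo - 1) ^ (12 * (n0 - 1))) :
    ∃ α : K, IsPrimitiveElt α ∧ IskNormal q n 1 F α := by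
  have hqR : (2:ℝ) ≤ q := by exact_mod_cast hlo.trans hq
  have hloR : (2:ℝ) ≤ lo := by exact_mod_cast hlo
  have hloq : (lo:ℝ) ≤ q := by exact_mod_cast hq
  set r : ℝ := 2 * lo / (lo - 1) with hr
  have hr1 : 1 ≤ r := by rw [hr, one_le_div (by linarith)]; linarith
  have hw : ∀ d, 1 ≤ d → 0 ≤ wP q d ∧ wP q d ≤ r := by
    intro d hd
    have h1 := one_sub_pos (hlo.trans hq) hd
    have h2 : 1 / (q:ℝ) ^ d ≤ 1 / (lo:ℝ) := by
      refine one_div_le_one_div_of_le (by linarith) ?_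
      exact hloq.trans (le_self_pow₀ (by linarith) (by omega))
    have h3 : (0:ℝ) < 1 - 1 / (lo:ℝ) := by
      rw [sub_pos, div_lt_one (by linarith)]; linarith
    refine ⟨by unfold wP; positivity, ?_⟩
    have h4 : r = 2 / (1 - 1 / (lo:ℝ)) := by
      rw [hr]; field_simp
    rw [h4, wP]
    gcongr
  have hV0 : 0 ≤ ∏ P ∈ TT F n, wP q P.natDegree :=
    Finset.prod_nonneg fun P hP => (hw _ (TT_deg_pos (by omega) hP)).1
  have hV : ∏ P ∈ TT F n, wP q P.natDegree ≤ r ^ (n - 1) := by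
    calc ∏ P ∈ TT F n, wP q P.natDegree ≤ ∏ P ∈ TT F n, r :=
          Finset.prod_le_prod (fun P hP => (hw _ (TT_deg_pos (by omega) hP)).1)
            (fun P hP => (hw _ (TT_deg_pos (by omega) hP)).2)
      _ = r ^ (TT F n).card := by rw [Finset.prod_const]
      _ ≤ _ := pow_le_pow_right₀ hr1 (TT_card (by omega))
  have hchkR : r ^ (12 * (n0 - 1)) * (4 * 2800000000 ^ 2) ≤ (lo:ℝ) ^ (4 * n0 - 10) := by
    have h1 : ((4 * 2800000000 ^ 2 * (2 * lo) ^ (12 * (n0 - 1)) : ℕ) : ℝ) ≤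
      ((lo ^ (4 * n0 - 10) * (lo - 1) ^ (12 * (n0 - 1)) : ℕ) : ℝ) := by exact_mod_cast hchk
    push_cast [Nat.cast_sub (show 1 ≤ lo by omega)] at h1
    rw [hr, div_pow, div_mul_eq_mul_div, div_le_iff₀ (pow_pos (by linarith) _)]
    linarith
  refine asym q n Q (by omega) hcF hrK hQ ?_
  obtain ⟨m, rfl⟩ : ∃ m, n = n0 + m := ⟨n - n0, by omega⟩
  have hstep : (r ^ 12) ^ m ≤ ((q:ℝ) ^ 4) ^ m := by
    rcases hmono with h | h
    · have : m = 0 := by omega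
      simp [this]
    · have h16 : (16:ℝ) ≤ lo := by exact_mod_cast h
      have hr2 : r ≤ 32 / 15 := by
        rw [hr, div_le_iff₀ (by linarith)]; linarith
      have h12 : r ^ 12 ≤ (q:ℝ) ^ 4 := by
        calc r ^ 12 ≤ (32 / 15) ^ 12 := by gcongr
          _ ≤ (16:ℝ) ^ 4 := by norm_num
          _ ≤ _ := by gcongr; linarith
      gcongr
  calc (∏ P ∈ TT F (n0 + m), wP q P.natDegree) ^ 12 * (4 * 2800000000 ^ 2 * (q:ℝ) ^ 10)
      ≤ (r ^ (n0 + m - 1)) ^ 12 * (4 * 2800000000 ^ 2 * (q:ℝ) ^ 10) := by gcongr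
    _ = (r ^ (12 * (n0 - 1)) * (4 * 2800000000 ^ 2)) * (r ^ 12) ^ m * (q:ℝ) ^ 10 := by
        rw [← pow_mul, ← pow_mul, show (n0 + m - 1) * 12 = 12 * (n0 - 1) + 12 * m by omega, pow_add]; ring
    _ ≤ ((lo:ℝ) ^ (4 * n0 - 10)) * ((q:ℝ) ^ 4) ^ m * (q:ℝ) ^ 10 := by gcongr
    _ ≤ ((q:ℝ) ^ (4 * n0 - 10)) * ((q:ℝ) ^ 4) ^ m * (q:ℝ) ^ 10 := by gcongr
    _ = _ := by
      rw [← pow_mul, ← pow_add, ← pow_add]; congr 1; omega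

open Classical in
theorem asym_small (q n Q : ℕ) (M : ℕ → ℝ) (E : ℝ) (hn : 3 ≤ n)
    (hcF : Fintype.card F = q) (hrK : Module.finrank F K = n)
    (hQ : Q * (q - 1) = q ^ n - 1)
    (hM1 : ∀ d ∈ Finset.Icc 1 4, 1 ≤ M d) (hM : ∀ d ∈ Finset.Icc 1 4, wP q d ^ 4 ≤ M d * (q:ℝ) ^ d)
    (hE : ∏ d ∈ Finset.Icc 1 4, M d ^ ((q ^ d - 1) / d) ≤ E)
    (n0 : ℕ) (hn0 : n0 ≤ n) (hfin : 4 * 2800000000 ^ 2 * E ^ 3 * (q:ℝ) ^ 7 ≤ (q:ℝ) ^ n0) :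
    ∃ α : K, IsPrimitiveElt α ∧ IskNormal q n 1 F α := by
  have hq1 : 2 ≤ q := by rw [← hcF]; exact Fintype.one_lt_card
  have hqR : (2:ℝ) ≤ q := by exact_mod_cast hq1
  have hw0 : ∀ d, 1 ≤ d → 0 ≤ wP q d := fun d hd => by
    have := one_sub_pos hq1 hd
    unfold wP; positivity
  have hbig : ∀ d, 5 ≤ d → wP q d ^ 4 ≤ (q:ℝ) ^ d := by
    intro d hd
    have h1 : (32:ℝ) ≤ (q:ℝ) ^ d := by
      calc (32:ℝ) = 2 ^ 5 := by norm_num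
        _ ≤ 2 ^ d := pow_le_pow_right₀ (by norm_num) hd
        _ ≤ _ := by gcongr
    have h2 : 1 / (q:ℝ) ^ d ≤ 1 / 32 := one_div_le_one_div_of_le (by norm_num) h1
    have h3 : wP q d ≤ 64 / 31 := by
      rw [wP, div_le_iff₀ (by linarith)]; linarith
    calc wP q d ^ 4 ≤ (64 / 31) ^ 4 := by
          have := hw0 d (by omega)
          gcongr
      _ ≤ 32 := by norm_num
      _ ≤ _ := h1
  have hdeg := TT_deg_sum (F := F) (n := n) (by omega)
  have hcnt : ∀ d ∈ Finset.Icc 1 4, ((TT F n).filter (fun P => P.natDegree = d)).card ≤ (q ^ d - 1) / d := by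
    intro d hd
    rw [Finset.mem_Icc] at hd
    have h1 := TT_count (F := F) (n := n) (d := d) (by omega) hd.1
    rw [hcF] at h1
    refine h1.trans ?_
    have hpos : 0 < q ^ d - 1 := by
      have : q ^ 1 ≤ q ^ d := Nat.pow_le_pow_right (by omega) hd.1
      rw [pow_one] at this
      omega
    have hg : Nat.gcd n (q ^ d - 1) ≤ q ^ d - 1 := Nat.gcd_le_right _ hpos
    rw [tb]
    split_ifs with hc
    · rw [hc.1] at hg ⊢; simpa using hg
    · exact Nat.div_le_div_right (by omega)
  have hV4 : (∏ P ∈ TT F n, wP q P.natDegree) ^ 4 ≤ E * (q:ℝ) ^ (n - 1) := by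
    rw [← Finset.prod_pow]
    calc ∏ P ∈ TT F n, wP q P.natDegree ^ 4
        ≤ ∏ P ∈ TT F n, ((∏ d ∈ Finset.Icc 1 4, if P.natDegree = d then M d else 1) * (q:ℝ) ^ P.natDegree) := by
          refine Finset.prod_le_prod (fun P hP => pow_nonneg (hw0 _ (TT_deg_pos (by omega) hP)) _) fun P hP => ?_
          have hp := TT_deg_pos (by omega) hP
          rw [Finset.prod_ite_eq]
          split_ifs with hc
          · exact hM _ hc
          · rw [one_mul]; apply hbig
            rw [Finset.mem_Icc] at hc; omega
      _ = (∏ d ∈ Finset.Icc 1 4, M d ^ ((TT F n).filter (fun P => P.natDegree = d)).card) *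
            (q:ℝ) ^ (∑ P ∈ TT F n, P.natDegree) := by
          rw [Finset.prod_mul_distrib, Finset.prod_comm, Finset.prod_pow_eq_pow_sum]
          congr 1
          refine Finset.prod_congr rfl fun d _ => ?_
          rw [Finset.prod_ite, Finset.prod_const, Finset.prod_const_one, mul_one]
      _ ≤ (∏ d ∈ Finset.Icc 1 4, M d ^ ((q ^ d - 1) / d)) * (q:ℝ) ^ (n - 1) := by
          have h0 : ∀ d ∈ Finset.Icc 1 4, 0 ≤ M d := fun d hd => zero_le_one.trans (hM1 d hd)
          refine mul_le_mul ?_ (pow_le_pow_right₀ (by linarith) hdeg) (by positivity)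
            (Finset.prod_nonneg fun d hd => pow_nonneg (h0 d hd) _)
          exact Finset.prod_le_prod (fun d hd => pow_nonneg (h0 d hd) _)
            (fun d hd => pow_le_pow_right₀ (hM1 d hd) (hcnt d hd))
      _ ≤ _ := by gcongr
  refine asym q n Q (by omega) hcF hrK hQ ?_
  set V := ∏ P ∈ TT F n, wP q P.natDegree
  have hV12 : V ^ 12 ≤ (E * (q:ℝ) ^ (n - 1)) ^ 3 := by
    rw [show (12:ℕ) = 4 * 3 by norm_num, pow_mul]
    have : 0 ≤ V ^ 4 := by positivity
    gcongr
  obtain ⟨m, rfl⟩ : ∃ m, n = m + 1 := ⟨n - 1, by omega⟩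
  simp only [Nat.add_sub_cancel] at hV12
  calc V ^ 12 * (4 * 2800000000 ^ 2 * (q:ℝ) ^ 10) ≤ (E * (q:ℝ) ^ m) ^ 3 * (4 * 2800000000 ^ 2 * (q:ℝ) ^ 10) := by gcongr
    _ = (4 * 2800000000 ^ 2 * E ^ 3 * (q:ℝ) ^ 7) * (q:ℝ) ^ (3 * (m + 1)) := by ring
    _ ≤ (q:ℝ) ^ n0 * (q:ℝ) ^ (3 * (m + 1)) := by gcongr
    _ ≤ (q:ℝ) ^ (m + 1) * (q:ℝ) ^ (3 * (m + 1)) := by gcongr; linarith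
    _ = _ := by ring
end
end

section
set_option linter.unusedSectionVars false

section
variable {F K : Type} [Field F] [Fintype F] [Field K] [Fintype K] [Algebra F K]

theorem asym_small4 (q n Q : ℕ) (a b c d E : ℝ) (hn : 3 ≤ n)
    (hcF : Fintype.card F = q) (hrK : Module.finrank F K = n)
    (hQ : Q * (q - 1) = q ^ n - 1)
    (ha : 1 ≤ a) (hb : 1 ≤ b) (hc : 1 ≤ c) (hd : 1 ≤ d)
    (ha' : wP q 1 ^ 4 ≤ a * (q:ℝ) ^ 1) (hb' : wP q 2 ^ 4 ≤ b * (q:ℝ) ^ 2)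
    (hc' : wP q 3 ^ 4 ≤ c * (q:ℝ) ^ 3) (hd' : wP q 4 ^ 4 ≤ d * (q:ℝ) ^ 4)
    (hE : a ^ ((q ^ 1 - 1) / 1) * b ^ ((q ^ 2 - 1) / 2) * c ^ ((q ^ 3 - 1) / 3) * d ^ ((q ^ 4 - 1) / 4) ≤ E)
    (n0 : ℕ) (hn0 : n0 ≤ n) (hfin : 4 * 2800000000 ^ 2 * E ^ 3 * (q:ℝ) ^ 7 ≤ (q:ℝ) ^ n0) :
    ∃ α : K, IsPrimitiveElt α ∧ IskNormal q n 1 F α := by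
  have hI : Finset.Icc 1 4 = {1, 2, 3, 4} := by decide
  refine asym_small q n Q (fun i => if i = 1 then a else if i = 2 then b else if i = 3 then c else d) E hn hcF hrK hQ
    ?_ ?_ ?_ n0 hn0 hfin
  · rw [hI]; simp [ha, hb, hc, hd]
  · rw [hI]; simp at ha'; simp [ha', hb', hc', hd']
  · rw [hI]; simp at hE; simp [← mul_assoc]; exact hE

def N0 (q : ℕ) : ℕ :=
  if q = 2 then 124 else if q = 3 then 84 else if q = 4 then 65 else if q = 5 then 55
  else if q = 7 then 48 else if q = 8 then 45 else if q = 9 then 43 else if q = 11 then 40 else 36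

theorem large_n_small_q (q n Q : ℕ) (hq : q ∈ [2, 3, 4, 5, 7, 8, 9, 11, 13]) (hn3 : 3 ≤ n) (hn : N0 q < n)
    (hcF : Fintype.card F = q) (hrK : Module.finrank F K = n)
    (hQ : Q * (q - 1) = q ^ n - 1) :
    ∃ α : K, IsPrimitiveElt α ∧ IskNormal q n 1 F α := by
  unfold N0 at hn
  simp only [List.mem_cons, List.not_mem_nil, or_false] at hq
  rcases hq with rfl | rfl | rfl | rfl | rfl | rfl | rfl | rfl | rfl
  · exact asym_small4 2 n Q (128) (253/20) (171/50) (13/10) 41609 (by omega) hcF hrK hQ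
      (by norm_num) (by norm_num) (by norm_num) (by norm_num)
      (by norm_num [wP]) (by norm_num [wP]) (by norm_num [wP]) (by norm_num [wP]) (by norm_num) 118 (by simp at hn; omega) (by norm_num)
  · exact asym_small4 3 n Q (27) (57/20) (1) (1) 48096 (by omega) hcF hrK hQ
      (by norm_num) (by norm_num) (by norm_num) (by norm_num)
      (by norm_num [wP]) (by norm_num [wP]) (by norm_num [wP]) (by norm_num [wP]) (by norm_num) 78 (by simp at hn; omega) (by norm_num)
  · exact asym_small4 4 n Q (253/20) (13/10) (1) (1) 12703 (by omega) hcF hrK hQ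
      (by norm_num) (by norm_num) (by norm_num) (by norm_num)
      (by norm_num [wP]) (by norm_num [wP]) (by norm_num [wP]) (by norm_num [wP]) (by norm_num) 60 (by simp at hn; omega) (by norm_num)
  · exact asym_small4 5 n Q (391/50) (1) (1) (1) 3740 (by omega) hcF hrK hQ
      (by norm_num) (by norm_num) (by norm_num) (by norm_num)
      (by norm_num [wP]) (by norm_num [wP]) (by norm_num [wP]) (by norm_num [wP]) (by norm_num) 51 (by simp at hn; omega) (by norm_num)
  · exact asym_small4 7 n Q (106/25) (1) (1) (1) 5811 (by omega) hcF hrK hQ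
      (by norm_num) (by norm_num) (by norm_num) (by norm_num)
      (by norm_num [wP]) (by norm_num [wP]) (by norm_num [wP]) (by norm_num [wP]) (by norm_num) 44 (by simp at hn; omega) (by norm_num)
  · exact asym_small4 8 n Q (171/50) (1) (1) (1) 5473 (by omega) hcF hrK hQ
      (by norm_num) (by norm_num) (by norm_num) (by norm_num)
      (by norm_num [wP]) (by norm_num [wP]) (by norm_num [wP]) (by norm_num [wP]) (by norm_num) 42 (by simp at hn; omega) (by norm_num)
  · exact asym_small4 9 n Q (57/20) (1) (1) (1) 4353 (by omega) hcF hrK hQ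
      (by norm_num) (by norm_num) (by norm_num) (by norm_num)
      (by norm_num [wP]) (by norm_num [wP]) (by norm_num [wP]) (by norm_num [wP]) (by norm_num) 39 (by simp at hn; omega) (by norm_num)
  · exact asym_small4 11 n Q (213/100) (1) (1) (1) 1923 (by omega) hcF hrK hQ
      (by norm_num) (by norm_num) (by norm_num) (by norm_num)
      (by norm_num [wP]) (by norm_num [wP]) (by norm_num [wP]) (by norm_num [wP]) (by norm_num) 36 (by simp at hn; omega) (by norm_num)
  · exact asym_small4 13 n Q (17/10) (1) (1) (1) 583 (by omega) hcF hrK hQ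
      (by norm_num) (by norm_num) (by norm_num) (by norm_num)
      (by norm_num [wP]) (by norm_num [wP]) (by norm_num [wP]) (by norm_num [wP]) (by norm_num) 32 (by simp at hn; omega) (by norm_num)

def qhi (n : ℕ) : ℕ :=
  if n = 3 then 2 ^ 45 else if n = 4 then 2 ^ 17 else if n = 5 then 2560 else if n = 6 then 512 else
  if n = 7 then 198 else if n = 8 then 113 else if n = 9 then 77 else if n < 14 then 58 else if n < 20 then 32 else
  if n < 32 then 23 else 16

theorem large_q (q n Q : ℕ) (hn3 : 3 ≤ n) (hq : qhi n ≤ q)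
    (hcF : Fintype.card F = q) (hrK : Module.finrank F K = n)
    (hQ : Q * (q - 1) = q ^ n - 1) :
    ∃ α : K, IsPrimitiveElt α ∧ IskNormal q n 1 F α := by
  unfold qhi at hq
  split_ifs at hq with h1 h2 h3 h4 h5 h6 h7 h8 h9 h10
  · exact asym_big q n Q _ 3 (by omega) (by omega) (by omega) hq hcF hrK hQ (Or.inl h1) (by norm_num)
  · exact asym_big q n Q _ 4 (by omega) (by omega) (by omega) hq hcF hrK hQ (Or.inl h2) (by norm_num)
  · exact asym_big q n Q _ 5 (by omega) (by omega) (by omega) hq hcF hrK hQ (Or.inl h3) (by norm_num)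
  · exact asym_big q n Q _ 6 (by omega) (by omega) (by omega) hq hcF hrK hQ (Or.inl h4) (by norm_num)
  · exact asym_big q n Q _ 7 (by omega) (by omega) (by omega) hq hcF hrK hQ (Or.inl h5) (by norm_num)
  · exact asym_big q n Q _ 8 (by omega) (by omega) (by omega) hq hcF hrK hQ (Or.inl h6) (by norm_num)
  · exact asym_big q n Q _ 9 (by omega) (by omega) (by omega) hq hcF hrK hQ (Or.inl h7) (by norm_num)
  · exact asym_big q n Q _ 10 (by omega) (by omega) (by omega) hq hcF hrK hQ (Or.inr (by norm_num)) (by norm_num)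
  · exact asym_big q n Q _ 14 (by omega) (by omega) (by omega) hq hcF hrK hQ (Or.inr (by norm_num)) (by norm_num)
  · exact asym_big q n Q _ 20 (by omega) (by omega) (by omega) hq hcF hrK hQ (Or.inr (by norm_num)) (by norm_num)
  · exact asym_big q n Q _ 32 (by omega) (by omega) (by omega) hq hcF hrK hQ (Or.inr (by norm_num)) (by decide +kernel)
end
end

section
set_option linter.unusedSectionVars false

theorem first_bound (Pr : ℕ → Prop) [DecidablePred Pr] (p : ℕ → ℕ) (N : ℕ)
    (hp0 : ∀ i < N, 0 < p i)
    (hp : ∀ i < N, ((Finset.range (p i)).filter Pr).card ≤ i) (k : ℕ) (hk : k ≤ N) :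
    ∀ A : Finset ℕ, (∀ l ∈ A, Pr l) → A.card = k →
    ∏ i ∈ Finset.range k, p i ≤ ∏ l ∈ A, l ∧
    ∑ l ∈ A, 1 / (l:ℝ) ≤ ∑ i ∈ Finset.range k, 1 / (p i : ℝ) := by
  classical
  induction k with
  | zero =>
    intro A _ hA
    rw [Finset.card_eq_zero] at hA
    simp [hA]
  | succ k ih =>
    intro A hA hc
    have hne : A.Nonempty := by rw [← Finset.card_pos]; omega
    set m := A.max' hne with hm
    have hmA : m ∈ A := A.max'_mem hne
    have hmp : p k ≤ m := by
      by_contra hlt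
      push Not at hlt
      have hsub : A ⊆ (Finset.range (p k)).filter Pr := by
        intro l hl
        rw [Finset.mem_filter, Finset.mem_range]
        exact ⟨(A.le_max' l hl).trans_lt hlt, hA l hl⟩
      have h1 := Finset.card_le_card hsub
      have h2 := hp k (by omega)
      omega
    obtain ⟨h1, h2⟩ := ih (by omega) (A.erase m) (fun l hl => hA l (Finset.mem_of_mem_erase hl))
      (by rw [Finset.card_erase_of_mem hmA]; omega)
    rw [Finset.prod_range_succ, Finset.sum_range_succ, ← Finset.mul_prod_erase _ _ hmA, ← Finset.add_sum_erase _ _ hmA]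
    constructor
    · rw [mul_comm m]; exact Nat.mul_le_mul h1 hmp
    · rw [add_comm]
      have h3 : (0:ℝ) < p k := by exact_mod_cast hp0 k (by omega)
      have h4 : (p k : ℝ) ≤ m := by exact_mod_cast hmp
      exact add_le_add h2 (one_div_le_one_div_of_le h3 h4)

theorem first_bound' (Pr : ℕ → Prop) [DecidablePred Pr] (p : ℕ → ℕ) (s : ℕ)
    (hp0 : ∀ i < s + 1, 0 < p i)
    (hp : ∀ i < s + 1, ((Finset.range (p i)).filter Pr).card ≤ i)
    (A : Finset ℕ) (hA : ∀ l ∈ A, Pr l) (hApos : ∀ l ∈ A, 0 < l) (M : ℕ) (hM : ∏ l ∈ A, l ≤ M)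
    (hMs : M < ∏ i ∈ Finset.range (s + 1), p i) :
    A.card ≤ s ∧ ∑ l ∈ A, 1 / (l:ℝ) ≤ ∑ i ∈ Finset.range s, 1 / (p i : ℝ) := by
  have hc : A.card ≤ s := by
    by_contra h
    push Not at h
    obtain ⟨A', hA', hcA'⟩ := Finset.exists_subset_card_eq (show s + 1 ≤ A.card by omega)
    have h1 := (first_bound Pr p (s + 1) hp0 hp (s + 1) le_rfl A' (fun l hl => hA l (hA' hl)) hcA').1
    have h2 : ∏ l ∈ A', l ≤ ∏ l ∈ A, l :=
      Finset.prod_le_prod_of_subset_of_one_le' hA' (fun l hl _ => hApos l hl)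
    omega
  refine ⟨hc, ?_⟩
  refine (first_bound Pr p (s + 1) hp0 hp A.card (by omega) A hA rfl).2.trans ?_
  refine Finset.sum_le_sum_of_subset_of_nonneg (Finset.range_mono hc) ?_
  intros; positivity

section
variable {F K : Type} [Field F] [Fintype F] [Field K] [Fintype K] [Algebra F K]

theorem Q_facts (q n Q : ℕ) (hn : 2 ≤ n) (hq1 : 2 ≤ q) (hQ : Q * (q - 1) = q ^ n - 1) :
    Q ≠ 0 ∧ Q ≤ 2 * q ^ (n - 1) := by
  constructor
  · rintro rfl
    have : 2 ^ 1 ≤ q ^ n := (Nat.pow_le_pow_left hq1 1).trans (Nat.pow_le_pow_right (by omega) (by omega))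
    omega
  · have h1 : Q * (q - 1) ≤ q ^ n := by omega
    have h2 : q ^ n = q ^ (n - 1) * q := by rw [← pow_succ, Nat.sub_add_cancel (by omega)]
    have h3 : Q * (q - 1) ≤ 2 * q ^ (n - 1) * (q - 1) := by
      rw [h2] at h1
      refine h1.trans ?_
      calc q ^ (n - 1) * q ≤ q ^ (n - 1) * (2 * (q - 1)) := Nat.mul_le_mul_left _ (by omega)
        _ = _ := by ring
    exact Nat.le_of_mul_le_mul_right h3 (by omega)

open Classical in
theorem range_gen (q n Q lo hi s : ℕ) (hn : 3 ≤ n) (hlo : 2 ≤ lo) (hql : lo ≤ q) (hqh : q ≤ hi)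
    (hcF : Fintype.card F = q) (hrK : Module.finrank F K = n)
    (hQ : Q * (q - 1) = q ^ n - 1) (core : Finset ℕ)
    (Pr : ℕ → Prop) [DecidablePred Pr] (p : ℕ → ℕ)
    (hPr : ∀ l ∈ Q.primeFactors, l ∉ core → Pr l)
    (hp0 : ∀ i < s + 1, 0 < p i)
    (hp : ∀ i < s + 1, ((Finset.range (p i)).filter Pr).card ≤ i)
    (hMs : 2 * hi ^ (n - 1) < ∏ i ∈ Finset.range (s + 1), p i)
    (δ : ℝ) (hδ0 : 0 ≤ δ) (hδ : δ ≤ 1 - ∑ i ∈ Finset.range s, 1 / (p i : ℝ) - n / lo)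
    (hfin : ((n:ℝ) * (2 ^ core.card - 1) + 2 ^ core.card * s) ^ 2 < (lo:ℝ) ^ (n - 2) * δ ^ 2) :
    ∃ α : K, IsPrimitiveElt α ∧ IskNormal q n 1 F α := by
  have hq1 : 2 ≤ q := hlo.trans hql
  have hqR : (2:ℝ) ≤ q := by exact_mod_cast hq1
  have hloR : (2:ℝ) ≤ lo := by exact_mod_cast hlo
  have hlq : (lo:ℝ) ≤ q := by exact_mod_cast hql
  obtain ⟨hQ0, hQle⟩ := Q_facts q n Q (by omega) hq1 hQ
  set S := Q.primeFactors.filter (· ∈ core) with hS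
  set T := Q.primeFactors.filter (¬ · ∈ core) with hT
  have hTpos : ∀ l ∈ T, 0 < l := fun l hl => (Nat.prime_of_mem_primeFactors (Finset.mem_filter.1 hl).1).pos
  have hTprod : ∏ l ∈ T, l ≤ 2 * hi ^ (n - 1) := by
    calc ∏ l ∈ T, l ≤ ∏ l ∈ Q.primeFactors, l :=
          Finset.prod_le_prod_of_subset_of_one_le' (Finset.filter_subset _ _)
            (fun l hl _ => (Nat.prime_of_mem_primeFactors hl).pos)
      _ ≤ Q := Nat.le_of_dvd (by omega) (Nat.prod_primeFactors_dvd Q)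
      _ ≤ 2 * q ^ (n - 1) := hQle
      _ ≤ _ := by gcongr
  obtain ⟨hTc, hTs⟩ := first_bound' Pr p s hp0 hp T
    (fun l hl => hPr l (Finset.mem_filter.1 hl).1 (Finset.mem_filter.1 hl).2) hTpos _ hTprod hMs
  have hScard : S.card ≤ core.card := Finset.card_le_card (fun l hl => (Finset.mem_filter.1 hl).2)
  set B := √((q:ℝ) ^ n) with hB
  have hB2 : B ^ 2 = (q:ℝ) ^ n := Real.sq_sqrt (by positivity)
  have hB0 : 0 ≤ B := Real.sqrt_nonneg _
  set W : ℝ := 2 ^ core.card with hW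
  set W' : ℝ := 2 ^ S.card with hW'
  have hWW : W' ≤ W := pow_le_pow_right₀ (by norm_num) hScard
  have hW1 : 1 ≤ W' := one_le_pow₀ (by norm_num)
  have hnlo : 0 ≤ (n:ℝ) / lo := by positivity
  have hTcR : (T.card : ℝ) ≤ s := by exact_mod_cast hTc
  have hTTR : ((TT F n).card : ℝ) ≤ n - 1 := by
    have := TT_card (F := F) (n := n) (by omega)
    have h2 : (TT F n).card + 1 ≤ n := by omega
    have h3 : ((TT F n).card : ℝ) + 1 ≤ n := by exact_mod_cast h2
    linarith
  obtain ⟨m, rfl⟩ : ∃ m, n = m + 2 := ⟨n - 2, by omega⟩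
  simp only [Nat.add_sub_cancel] at hfin
  have hm1 : m + 2 - 1 = m + 1 := by omega
  set c : ℝ := ((m + 2 : ℕ):ℝ) * (W - 1) + W * s with hc
  have hc0 : 0 ≤ c := by
    have : 0 ≤ W - 1 := by linarith
    positivity
  have hfin2 : B * c < (q:ℝ) ^ (m + 1) * δ := by
    have h1 : (B * c) ^ 2 < ((q:ℝ) ^ (m + 1) * δ) ^ 2 := by
      calc (B * c) ^ 2 = (q:ℝ) ^ (m + 2) * c ^ 2 := by rw [mul_pow, hB2]
        _ < (q:ℝ) ^ (m + 2) * ((lo:ℝ) ^ m * δ ^ 2) := by gcongr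
        _ ≤ (q:ℝ) ^ (m + 2) * ((q:ℝ) ^ m * δ ^ 2) := by gcongr
        _ = _ := by ring
    exact lt_of_pow_lt_pow_left₀ 2 (by positivity) h1
  have hqm : (1:ℝ) ≤ (q:ℝ) ^ m := one_le_pow₀ (by linarith)
  refine crit q (m + 2) Q (by omega) hcF hrK hQ ∅ (Finset.empty_subset _) S T
    (Finset.disjoint_filter_filter_not _ _ _) (Finset.filter_union_filter_not_eq _ _).symm (by linarith) ?_
  simp only [Finset.card_empty, pow_zero, one_mul, Finset.prod_empty, mul_one, Finset.sdiff_empty, hm1]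
  rw [← hB, ← hW']
  have hsum : ∑ P ∈ TT F (m + 2), ((q:ℝ) ^ (m + 1) / (q:ℝ) ^ P.natDegree + B * (W' - 1)) ≤
      (((m + 2 : ℕ):ℝ) - 1) * ((q:ℝ) ^ m + B * (W - 1)) := by
    calc _ ≤ ∑ P ∈ TT F (m + 2), ((q:ℝ) ^ m + B * (W - 1)) := by
          refine Finset.sum_le_sum fun P hP => add_le_add ?_ (by gcongr)
          have hd := TT_deg_pos (by omega) hP
          rw [div_le_iff₀ (by positivity), pow_succ]
          gcongr
          exact le_self_pow₀ (by linarith) (by omega)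
      _ = (TT F (m + 2)).card * ((q:ℝ) ^ m + B * (W - 1)) := by rw [Finset.sum_const, nsmul_eq_mul]
      _ ≤ _ := by
        have : 0 ≤ B * (W - 1) := mul_nonneg hB0 (by linarith)
        gcongr
  have h1 : B * ((W' - 1) + T.card * W') ≤ B * ((W - 1) + s * W) := by gcongr
  have h2 : δ + ((m + 2 : ℕ):ℝ) / q ≤ 1 - ∑ l ∈ T, 1 / (l:ℝ) := by
    have : ((m + 2 : ℕ):ℝ) / q ≤ ((m + 2 : ℕ):ℝ) / lo := by gcongr
    linarith
  have hpos : 0 ≤ (q:ℝ) ^ (m + 1) - 1 := by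
    have : (1:ℝ) ≤ (q:ℝ) ^ (m + 1) := one_le_pow₀ (by linarith)
    linarith
  have h3 : ∑ l ∈ T, 1 / (l:ℝ) ≥ 0 := Finset.sum_nonneg fun _ _ => by positivity
  have h4 : (q:ℝ) ^ (m + 1) * (δ + ((m + 2 : ℕ):ℝ) / q) ≤ (q:ℝ) ^ (m + 1) * (1 - ∑ l ∈ T, 1 / (l:ℝ)) := by gcongr
  have h5 : (q:ℝ) ^ (m + 1) * (((m + 2 : ℕ):ℝ) / q) = (q:ℝ) ^ m * ((m + 2 : ℕ):ℝ) := by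
    rw [pow_succ]; field_simp
  have h6 : B * c = B * ((W - 1) + s * W) + (((m + 2 : ℕ):ℝ) - 1) * (B * (W - 1)) := by rw [hc]; ring
  nlinarith

def pA (i : ℕ) : ℕ := [5, 7, 11, 13, 17, 19, 23, 29, 31, 37, 41, 43, 47].getD i 1
def pB (i : ℕ) : ℕ := [7, 13, 19, 31, 37, 43, 61, 67, 73, 79, 97, 103, 109, 127, 139, 151, 157].getD i 1

theorem range_A (n lo hi s : ℕ) (q Q : ℕ) (hn : 3 ≤ n) (hlo : 2 ≤ lo) (hs : s < 13) (hql : lo ≤ q) (hqh : q ≤ hi)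
    (hcF : Fintype.card F = q) (hrK : Module.finrank F K = n)
    (hQ : Q * (q - 1) = q ^ n - 1)
    (hMs : 2 * hi ^ (n - 1) < ∏ i ∈ Finset.range (s + 1), pA i)
    (δ : ℝ) (hδ0 : 0 ≤ δ) (hδ : δ ≤ 1 - ∑ i ∈ Finset.range s, 1 / (pA i : ℝ) - n / lo)
    (hfin : ((n:ℝ) * 3 + 4 * s) ^ 2 < (lo:ℝ) ^ (n - 2) * δ ^ 2) :
    ∃ α : K, IsPrimitiveElt α ∧ IskNormal q n 1 F α := by
  refine range_gen q n Q lo hi s hn hlo hql hqh hcF hrK hQ {2, 3} (fun l => l.Prime ∧ 5 ≤ l) pA ?_ ?_ ?_ hMs δ hδ0 hδ ?_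
  · intro l hl hc
    have hp := Nat.prime_of_mem_primeFactors hl
    refine ⟨hp, ?_⟩
    simp at hc
    have := hp.two_le
    have h4 : l ≠ 4 := by rintro rfl; norm_num at hp
    omega
  · have : ∀ i < 13, 0 < pA i := by decide +kernel
    intro i hi; exact this i (by omega)
  · have : ∀ i < 13, ((Finset.range (pA i)).filter (fun l => l.Prime ∧ 5 ≤ l)).card ≤ i := by decide +kernel
    intro i hi; exact this i (by omega)
  · norm_num; norm_num at hfin; linarith

theorem mod3 (q Q l : ℕ) (hq1 : 2 ≤ q) (hQ : Q * (q - 1) = q ^ 3 - 1) (hl : l ∈ Q.primeFactors) (hl3 : l ≠ 3) :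
    l % 3 = 1 := by
  have hp := Nat.prime_of_mem_primeFactors hl
  have hd := Nat.dvd_of_mem_primeFactors hl
  have hQ' : Q = q ^ 2 + q + 1 := by
    refine Nat.eq_of_mul_eq_mul_right (show 0 < q - 1 by omega) ?_
    rw [hQ]
    obtain ⟨r, rfl⟩ : ∃ r, q = r + 1 := ⟨q - 1, by omega⟩
    simp only [Nat.add_sub_cancel]
    have : (r + 1) ^ 3 = ((r + 1) ^ 2 + (r + 1) + 1) * r + 1 := by ring
    omega
  have : Fact l.Prime := ⟨hp⟩
  have h0 : ((q:ZMod l)) ^ 2 + q + 1 = 0 := by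
    have := (ZMod.natCast_eq_zero_iff Q l).2 hd
    rw [hQ'] at this; push_cast at this; exact this
  have h3 : ((q:ZMod l)) ^ 3 = 1 := by linear_combination ((q:ZMod l) - 1) * h0
  have h1 : (q:ZMod l) ≠ 1 := by
    intro h; rw [h] at h0
    have : ((3:ℕ) : ZMod l) = 0 := by push_cast; linear_combination h0
    rw [ZMod.natCast_eq_zero_iff] at this
    exact hl3 ((Nat.prime_dvd_prime_iff_eq hp Nat.prime_three).1 this)
  have hne : (q : ZMod l) ≠ 0 := by intro h; rw [h] at h3; simp at h3
  have ho : orderOf (q:ZMod l) = 3 := orderOf_eq_prime h3 h1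
  have h4 : 3 ∣ l - 1 := by rw [← ho]; exact ZMod.orderOf_dvd_card_sub_one hne
  have := hp.two_le
  omega

theorem range_B (lo hi s : ℕ) (q Q : ℕ) (hlo : 2 ≤ lo) (hs : s < 17) (hql : lo ≤ q) (hqh : q ≤ hi)
    (hcF : Fintype.card F = q) (hrK : Module.finrank F K = 3)
    (hQ : Q * (q - 1) = q ^ 3 - 1)
    (hMs : 2 * hi ^ 2 < ∏ i ∈ Finset.range (s + 1), pB i)
    (δ : ℝ) (hδ0 : 0 ≤ δ) (hδ : δ ≤ 1 - ∑ i ∈ Finset.range s, 1 / (pB i : ℝ) - 3 / lo)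
    (hfin : (3 + 2 * (s:ℝ)) ^ 2 < (lo:ℝ) * δ ^ 2) :
    ∃ α : K, IsPrimitiveElt α ∧ IskNormal q 3 1 F α := by
  refine range_gen q 3 Q lo hi s le_rfl hlo hql hqh hcF hrK hQ {3} (fun l => l.Prime ∧ l % 3 = 1) pB ?_ ?_ ?_ hMs δ hδ0 hδ ?_
  · intro l hl hc
    exact ⟨Nat.prime_of_mem_primeFactors hl, mod3 q Q l (hlo.trans hql) hQ hl (by simpa using hc)⟩
  · have : ∀ i < 17, 0 < pB i := by decide +kernel
    intro i hi; exact this i (by omega)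
  · have : ∀ i < 17, ((Finset.range (pB i)).filter (fun l => l.Prime ∧ l % 3 = 1)).card ≤ i := by decide +kernel
    intro i hi; exact this i (by omega)
  · norm_num; norm_num at hfin; linarith
end
end

section
set_option linter.unusedSectionVars false

/-- Lower limit of the `q`-range handled by interval arguments. -/
def qlo (n : ℕ) : ℕ :=
  if n = 3 then 300 else if n = 4 then 140 else if n = 5 then 64 else if n = 6 then 54
  else if n = 7 then 46 else if n = 8 then 40 else qhi n

section
variable {F K : Type} [Field F] [Fintype F] [Field K] [Fintype K] [Algebra F K]

theorem mid_q (q n Q : ℕ) (hn3 : 3 ≤ n) (hq : qlo n ≤ q)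
    (hcF : Fintype.card F = q) (hrK : Module.finrank F K = n) (hQ : Q * (q - 1) = q ^ n - 1) :
    ∃ α : K, IsPrimitiveElt α ∧ IskNormal q n 1 F α := by
  by_cases hbig : qhi n ≤ q
  · exact large_q q n Q hn3 hbig hcF hrK hQ
  push Not at hbig
  have h9 : n < 9 := by
    by_contra h
    have : qlo n = qhi n := by
      unfold qlo
      rw [if_neg (by omega), if_neg (by omega), if_neg (by omega), if_neg (by omega), if_neg (by omega), if_neg (by omega)]
    omega
  interval_cases n
  · norm_num [qlo, qhi] at hq hbig
    by_cases h0 : q ≤ 811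
    · exact range_B 300 811 4 q Q (by norm_num) (by norm_num) (by omega) (by omega) hcF hrK hQ (by decide +kernel) (6853 / 10000) (by norm_num)
        (by norm_num [Finset.sum_range_succ, pB]) (by norm_num)
    by_cases h1 : q ≤ 262954
    · exact range_B 811 262954 7 q Q (by norm_num) (by norm_num) (by omega) (by omega) hcF hrK hQ (by decide +kernel) (6249 / 10000) (by norm_num)
        (by norm_num [Finset.sum_range_succ, pB]) (by norm_num)
    exact range_B 262954 35184372088832 15 q Q (by norm_num) (by norm_num) (by omega) (by omega) hcF hrK hQ (by decide +kernel) (5430 / 10000) (by norm_num)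
      (by norm_num [Finset.sum_range_succ, pB]) (by norm_num)
  · norm_num [qlo, qhi] at hq hbig
    by_cases h0 : q ≤ 651
    · exact range_A 4 140 651 7 q Q (by norm_num) (by norm_num) (by norm_num) (by omega) (by omega) hcF hrK hQ (by decide +kernel) (3058 / 10000) (by norm_num)
        (by norm_num [Finset.sum_range_succ, pA]) (by norm_num)
    exact range_A 4 651 131072 12 q Q (by norm_num) (by norm_num) (by norm_num) (by omega) (by omega) hcF hrK hQ (by decide +kernel) (1868 / 10000) (by norm_num)
      (by norm_num [Finset.sum_range_succ, pA]) (by norm_num)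
  · norm_num [qlo, qhi] at hq hbig
    exact range_A 5 64 2560 11 q Q (by norm_num) (by norm_num) (by norm_num) (by omega) (by omega) hcF hrK hQ (by decide +kernel) (1380 / 10000) (by norm_num)
      (by norm_num [Finset.sum_range_succ, pA]) (by norm_num)
  · norm_num [qlo, qhi] at hq hbig
    exact range_A 6 54 512 11 q Q (by norm_num) (by norm_num) (by norm_num) (by omega) (by omega) hcF hrK hQ (by decide +kernel) (1051 / 10000) (by norm_num)
      (by norm_num [Finset.sum_range_succ, pA]) (by norm_num)
  · norm_num [qlo, qhi] at hq hbig
    exact range_A 7 46 198 11 q Q (by norm_num) (by norm_num) (by norm_num) (by omega) (by omega) hcF hrK hQ (by decide +kernel) (640 / 10000) (by norm_num)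
      (by norm_num [Finset.sum_range_succ, pA]) (by norm_num)
  · norm_num [qlo, qhi] at hq hbig
    exact range_A 8 40 113 11 q Q (by norm_num) (by norm_num) (by norm_num) (by omega) (by omega) hcF hrK hQ (by decide +kernel) (162 / 10000) (by norm_num)
      (by norm_num [Finset.sum_range_succ, pA]) (by norm_num)
end
end

section
set_option linter.unusedSectionVars false

def PL : List ℕ := [2, 3, 5, 7, 11, 13, 17, 19, 23, 29, 31, 37, 41, 43, 47, 53, 59, 61, 67, 71, 73, 79, 83, 89, 97,
  101, 103, 107, 109, 113, 127, 131, 137, 139, 149, 151, 157, 163, 167, 173, 179, 181, 191, 193, 197, 199]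

theorem PL_prime : ∀ l ∈ PL, l.Prime := by decide +kernel
theorem PL_nodup : PL.Nodup := by decide +kernel
theorem mem_PL : ∀ l < 200, l.Prime → l ∈ PL := by decide +kernel

def L1 (Q c1 : ℕ) : List ℕ := PL.filter fun l => Nat.blt l c1 && Nat.beq (Q % l) 0
def L2 (Q c1 c2 : ℕ) : List ℕ := PL.filter fun l => Nat.ble c1 l && (Nat.blt l c2 && Nat.beq (Q % l) 0)

def chkA (q n Q c2 D W pr t σ u : ℕ) : Bool :=
  let s := t + u
  let τ := σ + u * (1000000 / c2 + 1)
  let g := ((List.range 6).map fun i => if i + 1 ≤ D then tb q n (i + 1) else 0).sum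
  let c := ((List.range 6).map fun i => if i + 1 ≤ D then 0 else tb q n (i + 1)).sum + (n - 1) / 7
  let A := ((List.range 6).map fun i => if i + 1 ≤ D then 0 else tb q n (i + 1) * q ^ (n - 1 - (i + 1))).sum
    + (n - 1) / 7 * q ^ (n - 1 - 7)
  let N := ((List.range 6).map fun i => if i + 1 ≤ D then (q ^ (i + 1) - 1) ^ tb q n (i + 1) else 1).prod
  let E := ((List.range 6).map fun i => if i + 1 ≤ D then (q ^ (i + 1)) ^ tb q n (i + 1) else 1).prod
  let X := (q ^ (n - 1) * N / E - 1) * (1000000 - τ) - 1000000 * A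
  let Y := 2 ^ g * ((W - 1) + s * W) + c * (W - 1)
  Nat.blt Q (c2 ^ (u + 1) * pr) && (Nat.blt τ 1000000 && Nat.blt (1000000 ^ 2 * q ^ n * Y ^ 2) (X ^ 2))

def chk (q n Q c1 b D : ℕ) : Bool :=
  let l1 := L1 Q c1
  let l2 := L2 Q c1 (2 ^ b)
  let pr := l1.prod * l2.prod
  chkA q n Q (2 ^ b) D (2 ^ l1.length) pr l2.length ((l2.map fun l => 1000000 / l + 1).sum) (Nat.log2 (Q / pr) / b)

def notpp (q : ℕ) : Bool := PL.any fun a => Nat.beq (q % a) 0 && PL.any fun b => Nat.beq (q % b) 0 && !(Nat.beq a b)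

def exc (n : ℕ) : List ℕ := 
  if n = 3 then [2, 3, 4, 7, 9, 13, 16, 25, 37]
  else if n = 4 then [2, 3, 4, 5, 7, 8, 9, 11, 13, 17, 29]
  else if n = 6 then [2, 3, 4, 5, 7] else if n = 8 then [2, 3, 5]
  else if n = 10 then [2] else if n = 12 then [2, 3] else []

def good (q n : ℕ) : Bool :=
  notpp q || ((exc n).contains q || 
   (let Q := (q ^ n - 1) / (q - 1)
    chk q n Q 18 7 0 || (chk q n Q 6 7 4 || (chk q n Q 3 6 0 || (chk q n Q 4 5 2 || (chk q n Q 12 5 1 || chk q n Q 6 7 0))))))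

def reg (q n : ℕ) : Bool :=
  ([2, 3, 4, 5, 7, 8, 9, 11, 13].contains q && Nat.blt (N0 q) n) || good q n

def allq (n : ℕ) : Bool := (List.range (qlo n)).all fun q => Nat.blt q 2 || reg q n

theorem all_good : ∀ n < 125, n < 3 ∨ allq n = true := by
  decide +kernel
end

section
set_option linter.unusedSectionVars false
section
variable {F K : Type} [Field F] [Fintype F] [Field K] [Fintype K] [Algebra F K]

theorem L1_fin (Q c1 : ℕ) (hQ : Q ≠ 0) (h : c1 ≤ 200) : (L1 Q c1).toFinset = Q.primeFactors.filter (· < c1) := by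
  ext l
  simp only [L1, List.mem_toFinset, List.mem_filter, Finset.mem_filter, Nat.mem_primeFactors, Bool.and_eq_true,
    Nat.blt_eq]
  constructor
  · rintro ⟨h1, h2, h3⟩
    exact ⟨⟨PL_prime l h1, Nat.dvd_of_mod_eq_zero (by simpa using h3), hQ⟩, h2⟩
  · rintro ⟨⟨h1, h2, _⟩, h3⟩
    exact ⟨mem_PL l (by omega) h1, h3, by simpa using Nat.mod_eq_zero_of_dvd h2⟩

theorem L2_fin (Q c1 c2 : ℕ) (hQ : Q ≠ 0) (h : c2 ≤ 200) :
    (L2 Q c1 c2).toFinset = Q.primeFactors.filter (fun l => c1 ≤ l ∧ l < c2) := by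
  ext l
  simp only [L2, List.mem_toFinset, List.mem_filter, Finset.mem_filter, Nat.mem_primeFactors, Bool.and_eq_true,
    Nat.blt_eq, Nat.ble_eq]
  constructor
  · rintro ⟨h1, h2, h4, h3⟩
    exact ⟨⟨PL_prime l h1, Nat.dvd_of_mod_eq_zero (by simpa using h3), hQ⟩, h2, h4⟩
  · rintro ⟨⟨h1, h2, _⟩, h3, h4⟩
    exact ⟨mem_PL l (by omega) h1, h3, h4, by simpa using Nat.mod_eq_zero_of_dvd h2⟩

theorem L1_nodup (Q c1 : ℕ) : (L1 Q c1).Nodup := PL_nodup.filter _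
theorem L2_nodup (Q c1 c2 : ℕ) : (L2 Q c1 c2).Nodup := PL_nodup.filter _

/-- the arithmetic part -/
theorem prime_part (Q c1 c2 u pr : ℕ) (hQ : Q ≠ 0) (h12 : c1 ≤ c2) (h0 : 2 ≤ c2) (h : c2 ≤ 200)
    (hpr : pr = (L1 Q c1).prod * (L2 Q c1 c2).prod)
    (hu : Q < c2 ^ (u + 1) * pr) :
    (Q.primeFactors.filter (· < c1)).card = (L1 Q c1).length ∧
    (Q.primeFactors.filter (¬ · < c1)).card ≤ (L2 Q c1 c2).length + u ∧
    ∑ l ∈ Q.primeFactors.filter (¬ · < c1), 1 / (l:ℝ) ≤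
      (((L2 Q c1 c2).map fun l => 1000000 / l + 1).sum + u * (1000000 / c2 + 1) : ℕ) / 1000000 := by
  classical
  set A := Q.primeFactors.filter (· < c1) with hA
  set B := Q.primeFactors.filter (fun l => c1 ≤ l ∧ l < c2) with hB
  set C := Q.primeFactors.filter (c2 ≤ ·) with hC
  have hT : Q.primeFactors.filter (¬ · < c1) = B ∪ C := by
    ext l; simp only [hB, hC, Finset.mem_filter, Finset.mem_union]
    constructor
    · rintro ⟨h1, h2⟩
      by_cases h3 : l < c2
      · exact Or.inl ⟨h1, by omega, h3⟩
      · exact Or.inr ⟨h1, by omega⟩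
    · rintro (⟨h1, h2⟩ | ⟨h1, h2⟩)
      · exact ⟨h1, by omega⟩
      · exact ⟨h1, by omega⟩
  have hd : Disjoint B C := by
    rw [Finset.disjoint_left]; intro l hl hl'
    simp only [hB, hC, Finset.mem_filter] at hl hl'; omega
  have hdA : Disjoint A (B ∪ C) := by
    rw [← hT]; exact Finset.disjoint_filter_filter_not _ _ _
  have hUn : A ∪ (B ∪ C) = Q.primeFactors := by rw [← hT]; exact Finset.filter_union_filter_not_eq _ _
  have e1 : A.card = (L1 Q c1).length := by
    rw [hA, ← L1_fin Q c1 hQ (by omega), List.toFinset_card_of_nodup (L1_nodup _ _)]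
  have e2 : B.card = (L2 Q c1 c2).length := by
    rw [hB, ← L2_fin Q c1 c2 hQ (by omega), List.toFinset_card_of_nodup (L2_nodup _ _ _)]
  have p1 : ∏ l ∈ A, l = (L1 Q c1).prod := by
    rw [hA, ← L1_fin Q c1 hQ (by omega), List.prod_toFinset _ (L1_nodup _ _)]; simp
  have p2 : ∏ l ∈ B, l = (L2 Q c1 c2).prod := by
    rw [hB, ← L2_fin Q c1 c2 hQ (by omega), List.prod_toFinset _ (L2_nodup _ _ _)]; simp
  have s2 : ∑ l ∈ B, (1000000 / l + 1) = ((L2 Q c1 c2).map fun l => 1000000 / l + 1).sum := by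
    rw [hB, ← L2_fin Q c1 c2 hQ (by omega), List.sum_toFinset _ (L2_nodup _ _ _)]
  have hCu : C.card ≤ u := by
    by_contra hcon
    push Not at hcon
    have h1 : c2 ^ C.card ≤ ∏ l ∈ C, l := by
      apply Finset.pow_card_le_prod
      intro l hl; exact (Finset.mem_filter.1 hl).2
    have h2 : (∏ l ∈ A, l) * ((∏ l ∈ B, l) * ∏ l ∈ C, l) ≤ Q := by
      rw [← Finset.prod_union hd, ← Finset.prod_union hdA, hUn]
      exact Nat.le_of_dvd (by omega) (Nat.prod_primeFactors_dvd Q)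
    have h3 : c2 ^ (u + 1) ≤ c2 ^ C.card := Nat.pow_le_pow_right (by omega) hcon
    rw [p1, p2] at h2
    have : c2 ^ (u + 1) * pr ≤ Q := by
      calc c2 ^ (u + 1) * pr ≤ (∏ l ∈ C, l) * pr := Nat.mul_le_mul_right _ (h3.trans h1)
        _ = _ := by rw [hpr]; ring
        _ ≤ Q := h2
    omega
  refine ⟨e1, ?_, ?_⟩
  · rw [hT, Finset.card_union_of_disjoint hd]; omega
  · have key : ∀ a l : ℕ, 0 < a → a ≤ l → 1 / (l:ℝ) ≤ ((1000000 / a + 1 : ℕ) : ℝ) / 1000000 := by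
      intro a l ha hal
      have h1 : (0:ℝ) < a := by exact_mod_cast ha
      have h2 : (a:ℝ) ≤ l := by exact_mod_cast hal
      refine (one_div_le_one_div_of_le h1 h2).trans ?_
      rw [div_le_div_iff₀ h1 (by norm_num)]
      have : 1000000 < a * (1000000 / a + 1) := Nat.lt_mul_div_succ _ ha
      have h4 : (1000000 : ℝ) < a * ((1000000 / a + 1 : ℕ) : ℝ) := by exact_mod_cast this
      linarith
    rw [hT, Finset.sum_union hd]
    have hBs : ∑ l ∈ B, 1 / (l:ℝ) ≤ ((∑ l ∈ B, (1000000 / l + 1) : ℕ) : ℝ) / 1000000 := by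
      rw [Nat.cast_sum, Finset.sum_div]
      refine Finset.sum_le_sum fun l hl => key l l ?_ le_rfl
      exact (Nat.prime_of_mem_primeFactors (Finset.mem_filter.1 hl).1).pos
    have hCs : ∑ l ∈ C, 1 / (l:ℝ) ≤ ((u * (1000000 / c2 + 1) : ℕ) : ℝ) / 1000000 := by
      calc ∑ l ∈ C, 1 / (l:ℝ) ≤ ∑ l ∈ C, ((1000000 / c2 + 1 : ℕ) : ℝ) / 1000000 :=
            Finset.sum_le_sum fun l hl => key c2 l (by omega) (Finset.mem_filter.1 hl).2
        _ = C.card * (((1000000 / c2 + 1 : ℕ) : ℝ) / 1000000) := by rw [Finset.sum_const, nsmul_eq_mul]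
        _ ≤ u * (((1000000 / c2 + 1 : ℕ) : ℝ) / 1000000) := by gcongr
        _ = _ := by push_cast; ring
    rw [s2] at hBs
    calc _ ≤ _ := add_le_add hBs hCs
      _ = _ := by rw [← add_div]; push_cast; ring
end
end

section
set_option linter.unusedSectionVars false
section
variable {F K : Type} [Field F] [Fintype F] [Field K] [Fintype K] [Algebra F K]

open Classical in
theorem TT_sum (q n : ℕ) (hn : 1 ≤ n) (hcF : Fintype.card F = q) (h : ℕ → ℝ) (h7 : ℝ) (h0 : ∀ d, 0 ≤ h d)
    (h70 : 0 ≤ h7) (hb : ∀ d, 6 < d → h d ≤ h7) :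
    ∑ P ∈ TT F n, h P.natDegree ≤ ∑ i ∈ Finset.range 6, (tb q n (i + 1) : ℝ) * h (i + 1) + ((n - 1) / 7 : ℕ) * h7 := by
  rw [← Finset.sum_filter_add_sum_filter_not (TT F n) (fun P => 6 < P.natDegree), add_comm]
  refine add_le_add ?_ ?_
  · have hmap : ∀ P ∈ (TT F n).filter (fun P => ¬ 6 < P.natDegree), P.natDegree - 1 ∈ Finset.range 6 := by
      intro P hP
      have := TT_deg_pos hn (Finset.mem_filter.1 hP).1
      have := (Finset.mem_filter.1 hP).2
      rw [Finset.mem_range]; omega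
    rw [← Finset.sum_fiberwise_of_maps_to hmap]
    refine Finset.sum_le_sum fun i _ => ?_
    have hc := TT_count (F := F) (n := n) (d := i + 1) hn (by omega)
    rw [hcF] at hc
    have hsub : ((TT F n).filter (fun P => ¬ 6 < P.natDegree)).filter (fun P => P.natDegree - 1 = i) ⊆
        (TT F n).filter (fun P => P.natDegree = i + 1) := by
      intro P hP
      simp only [Finset.mem_filter] at hP ⊢
      have := TT_deg_pos hn hP.1.1
      exact ⟨hP.1.1, by omega⟩
    calc _ ≤ ∑ P ∈ (TT F n).filter (fun P => P.natDegree = i + 1), h P.natDegree :=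
          Finset.sum_le_sum_of_subset_of_nonneg hsub (fun _ _ _ => h0 _)
      _ = ∑ P ∈ (TT F n).filter (fun P => P.natDegree = i + 1), h (i + 1) :=
          Finset.sum_congr rfl fun P hP => by rw [(Finset.mem_filter.1 hP).2]
      _ = ((TT F n).filter (fun P => P.natDegree = i + 1)).card * h (i + 1) := by
          rw [Finset.sum_const, nsmul_eq_mul]
      _ ≤ _ := by have := h0 (i + 1); gcongr
  · calc _ ≤ ∑ P ∈ (TT F n).filter (fun P => 6 < P.natDegree), h7 :=
          Finset.sum_le_sum fun P hP => hb _ (Finset.mem_filter.1 hP).2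
      _ = ((TT F n).filter (fun P => 6 < P.natDegree)).card * h7 := by
          rw [Finset.sum_const, nsmul_eq_mul]
      _ ≤ _ := by
          have := TT_count_big (F := F) (n := n) (D := 6) hn
          gcongr

set_option maxHeartbeats 1000000 in
open Classical in
theorem chkA_sound (q n Q c1 c2 D W pr t τ u : ℕ) (hn : 3 ≤ n) (hD : D ≤ 6)
    (hcF : Fintype.card F = q) (hrK : Module.finrank F K = n) (hQ : Q * (q - 1) = q ^ n - 1)
    (h12 : c1 ≤ c2) (h0 : 2 ≤ c2) (h : c2 ≤ 200)
    (hpr : pr = (L1 Q c1).prod * (L2 Q c1 c2).prod) (hW : W = 2 ^ (L1 Q c1).length)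
    (ht : t = (L2 Q c1 c2).length) (hτ : τ = ((L2 Q c1 c2).map fun l => 1000000 / l + 1).sum)
    (hchk : chkA q n Q c2 D W pr t τ u = true) :
    ∃ α : K, IsPrimitiveElt α ∧ IskNormal q n 1 F α := by
  have hq1 : 2 ≤ q := by rw [← hcF]; exact Fintype.one_lt_card
  have hqR : (2:ℝ) ≤ q := by exact_mod_cast hq1
  obtain ⟨hQ0, -⟩ := Q_facts q n Q (by omega) hq1 hQ
  unfold chkA at hchk
  simp only [Bool.and_eq_true, Nat.blt_eq] at hchk
  obtain ⟨hu, hτ1, hX⟩ := hchk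
  obtain ⟨hS, hTc, hTs⟩ := prime_part Q c1 c2 u pr hQ0 h12 h0 h hpr hu
  rw [← ht] at hTc
  rw [← hτ] at hTs
  set σ := τ + u * (1000000 / c2 + 1) with hσ
  set s := t + u with hs
  set S := Q.primeFactors.filter (· < c1) with hSd
  set T := Q.primeFactors.filter (¬ · < c1) with hTd
  have hWS : (2:ℝ) ^ S.card = W := by rw [hS, hW]; push_cast; rfl
  have hW1 : 1 ≤ W := by rw [hW]; exact Nat.one_le_two_pow
  have hW1R : (1:ℝ) ≤ W := by exact_mod_cast hW1
  set B := √((q:ℝ) ^ n) with hB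
  have hB2 : B ^ 2 = (q:ℝ) ^ n := Real.sq_sqrt (by positivity)
  have hB0 : 0 ≤ B := Real.sqrt_nonneg _
  set g := ((List.range 6).map fun i => if i + 1 ≤ D then tb q n (i + 1) else 0).sum with hg
  set c := ((List.range 6).map fun i => if i + 1 ≤ D then 0 else tb q n (i + 1)).sum + (n - 1) / 7 with hc
  set A := ((List.range 6).map fun i => if i + 1 ≤ D then 0 else tb q n (i + 1) * q ^ (n - 1 - (i + 1))).sum
    + (n - 1) / 7 * q ^ (n - 1 - 7) with hA
  set N := ((List.range 6).map fun i => if i + 1 ≤ D then (q ^ (i + 1) - 1) ^ tb q n (i + 1) else 1).prod with hN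
  set E := ((List.range 6).map fun i => if i + 1 ≤ D then (q ^ (i + 1)) ^ tb q n (i + 1) else 1).prod with hE
  have lsum : ∀ f : ℕ → ℕ, ((List.range 6).map f).sum = ∑ i ∈ Finset.range 6, f i := fun f => by
    simp [List.range_succ, Finset.sum_range_succ]; ring
  have lprod : ∀ f : ℕ → ℕ, ((List.range 6).map f).prod = ∏ i ∈ Finset.range 6, f i := fun f => by
    simp [List.range_succ, Finset.prod_range_succ]; ring
  rw [lsum] at hg hc hA
  rw [lprod] at hN hE
  clear_value N E A c g σ s
  set G := (TT F n).filter (fun P => P.natDegree ≤ D) with hG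
  have hsd : TT F n \ G = (TT F n).filter (fun P => ¬ P.natDegree ≤ D) := by
    rw [hG, Finset.filter_not]
  -- card of G
  have hGc : (G.card : ℝ) ≤ g := by
    have h1 := TT_sum (F := F) q n (by omega) hcF (fun d => if d ≤ D then 1 else 0) 0
      (fun d => by split_ifs <;> norm_num) le_rfl (fun d hd => by rw [if_neg (by omega)])
    have h2 : (G.card : ℝ) = ∑ P ∈ TT F n, (if P.natDegree ≤ D then (1:ℝ) else 0) := by
      rw [hG, Finset.card_filter]; push_cast; rfl
    rw [h2]
    refine h1.trans (le_of_eq ?_)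
    rw [hg]; push_cast
    rw [mul_zero, add_zero]
    refine Finset.sum_congr rfl fun i _ => ?_
    split_ifs <;> simp
  have hGcN : G.card ≤ g := by exact_mod_cast hGc
  -- the additive part
  have hadd : ∑ P ∈ TT F n \ G, ((q:ℝ) ^ (n - 1) / (q:ℝ) ^ P.natDegree + B * (W - 1)) ≤ A + c * (B * (W - 1)) := by
    have hBW : 0 ≤ B * ((W:ℝ) - 1) := mul_nonneg hB0 (by linarith)
    have hdiv : ∀ d e, d ≤ e → (q:ℝ) ^ (n - 1) / (q:ℝ) ^ e ≤ (q:ℝ) ^ (n - 1 - d) := by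
      intro d e hde
      rw [div_le_iff₀ (by positivity), ← pow_add]
      exact pow_le_pow_right₀ (by linarith) (by omega)
    have h1 := TT_sum (F := F) q n (by omega) hcF
      (fun d => if d ≤ D then 0 else (q:ℝ) ^ (n - 1) / (q:ℝ) ^ d + B * (W - 1)) ((q:ℝ) ^ (n - 1 - 7) + B * (W - 1))
      (fun d => by split_ifs <;> positivity) (by positivity)
      (fun d hd => by
        rw [if_neg (by omega)]
        have := hdiv 7 d (by omega)
        linarith)
    have h2 : ∑ P ∈ TT F n \ G, ((q:ℝ) ^ (n - 1) / (q:ℝ) ^ P.natDegree + B * (W - 1)) =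
       ∑ P ∈ TT F n, (if P.natDegree ≤ D then 0 else ((q:ℝ) ^ (n - 1) / (q:ℝ) ^ P.natDegree + B * (W - 1))) := by
      rw [hsd, Finset.sum_filter]
      refine Finset.sum_congr rfl fun P _ => ?_
      split_ifs <;> simp_all
    rw [h2]
    refine h1.trans ?_
    rw [hA, hc]; push_cast
    have h3 : ∑ i ∈ Finset.range 6, (tb q n (i + 1) : ℝ) *
        (if i + 1 ≤ D then 0 else (q:ℝ) ^ (n - 1) / (q:ℝ) ^ (i + 1) + B * (W - 1)) ≤
        ∑ i ∈ Finset.range 6, (if i + 1 ≤ D then (0:ℝ) else tb q n (i + 1) * (q:ℝ) ^ (n - 1 - (i + 1))) +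
        (∑ i ∈ Finset.range 6, (if i + 1 ≤ D then (0:ℝ) else tb q n (i + 1))) * (B * (W - 1)) := by
      rw [Finset.sum_mul, ← Finset.sum_add_distrib]
      refine Finset.sum_le_sum fun i _ => ?_
      split_ifs
      · simp
      · rw [← mul_add]
        have := hdiv (i + 1) (i + 1) le_rfl
        gcongr
    nlinarith
  -- the product
  have hprod : (N:ℝ) / E ≤ ∏ P ∈ G, (1 - 1 / (q : ℝ) ^ P.natDegree) := by
    set k : ℕ → ℝ := fun d => if d ≤ D then (if 1 ≤ d then 1 - 1 / (q:ℝ) ^ d else 1) else 1 with hk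
    have hk0 : ∀ d, 0 < k d := by
      intro d; simp only [hk]; split_ifs with h1 h2
      · exact one_sub_pos hq1 h2
      · norm_num
      · norm_num
    have hk1 : ∀ d, k d ≤ 1 := by
      intro d; simp only [hk]; split_ifs with h1 h2
      · have : 0 ≤ 1 / (q:ℝ) ^ d := by positivity
        linarith
      · norm_num
      · norm_num
    have h1 := TT_sum (F := F) q n (by omega) hcF (fun d => - Real.log (k d)) 0
      (fun d => neg_nonneg.2 (Real.log_nonpos (hk0 d).le (hk1 d))) le_rfl
      (fun d hd => by simp only [hk]; rw [if_neg (by omega)]; simp)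
    have h2 : ∏ P ∈ G, (1 - 1 / (q : ℝ) ^ P.natDegree) = ∏ P ∈ TT F n, k P.natDegree := by
      rw [hG, Finset.prod_filter]
      refine Finset.prod_congr rfl fun P hP => ?_
      have := TT_deg_pos (by omega) hP
      simp only [hk, if_pos this]
    have h3 : (N:ℝ) / E = ∏ i ∈ Finset.range 6, k (i + 1) ^ tb q n (i + 1) := by
      rw [hN, hE, Nat.cast_prod, Nat.cast_prod, ← Finset.prod_div_distrib]
      refine Finset.prod_congr rfl fun i _ => ?_
      simp only [hk]
      rw [if_pos (show 1 ≤ i + 1 by omega)]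
      split_ifs
      · rw [Nat.cast_pow, Nat.cast_pow, ← div_pow]
        congr 1
        rw [Nat.cast_sub (Nat.one_le_pow _ _ (by omega))]
        push_cast
        field_simp
      · simp
    rw [h2, h3]
    have e1 : ∏ P ∈ TT F n, k P.natDegree = Real.exp (∑ P ∈ TT F n, Real.log (k P.natDegree)) := by
      rw [Real.exp_sum]
      exact Finset.prod_congr rfl fun P _ => (Real.exp_log (hk0 _)).symm
    have e2 : ∏ i ∈ Finset.range 6, k (i + 1) ^ tb q n (i + 1) =
        Real.exp (∑ i ∈ Finset.range 6, (tb q n (i + 1) : ℝ) * Real.log (k (i + 1))) := by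
      rw [Real.exp_sum]
      refine Finset.prod_congr rfl fun i _ => ?_
      rw [Real.exp_nat_mul, Real.exp_log (hk0 _)]
    rw [e1, e2, Real.exp_le_exp]
    simp only [mul_zero, add_zero, mul_neg, Finset.sum_neg_distrib] at h1
    linarith
  set U := q ^ (n - 1) * N / E with hU
  have hUle : (U:ℝ) ≤ (q:ℝ) ^ (n - 1) * ∏ P ∈ G, (1 - 1 / (q : ℝ) ^ P.natDegree) := by
    calc (U:ℝ) ≤ ((q ^ (n - 1) * N : ℕ) : ℝ) / E := Nat.cast_div_le
      _ = (q:ℝ) ^ (n - 1) * ((N:ℝ) / E) := by push_cast; ring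
      _ ≤ _ := by gcongr
  set Y := 2 ^ g * ((W - 1) + s * W) + c * (W - 1) with hY
  have hYR : (Y:ℝ) = 2 ^ g * (((W:ℝ) - 1) + s * W) + c * (W - 1) := by
    rw [hY]; push_cast [Nat.cast_sub hW1]; ring
  clear_value Y U
  have hXpos : 0 < (U - 1) * (1000000 - σ) - 1000000 * A := by
    by_contra hcon
    have : (U - 1) * (1000000 - σ) - 1000000 * A = 0 := by omega
    rw [this] at hX; omega
  have hU1 : 1 ≤ U := by
    by_contra hcon
    have : U - 1 = 0 := by omega
    rw [this, zero_mul] at hXpos; omega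
  have hXR : (((U - 1) * (1000000 - σ) - 1000000 * A : ℕ) : ℝ) = ((U:ℝ) - 1) * (1000000 - σ) - 1000000 * A := by
    rw [Nat.cast_sub (Nat.lt_of_sub_pos hXpos).le, Nat.cast_mul, Nat.cast_mul, Nat.cast_sub hU1, Nat.cast_sub hτ1.le]
    push_cast; ring
  have hfin : 1000000 * B * Y < ((U:ℝ) - 1) * (1000000 - σ) - 1000000 * A := by
    rw [← hXR]
    refine lt_of_pow_lt_pow_left₀ 2 (by positivity) ?_
    have : (1000000 * B * (Y:ℝ)) ^ 2 = ((1000000 ^ 2 * q ^ n * Y ^ 2 : ℕ) : ℝ) := by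
      push_cast; rw [mul_pow, mul_pow, hB2]; ring
    rw [this]
    exact_mod_cast hX
  have hσR : (σ:ℝ) < 1000000 := by exact_mod_cast hτ1
  have hσle : ∑ l ∈ T, 1 / (l:ℝ) ≤ (σ:ℝ) / 1000000 := hTs
  have hTcR : (T.card : ℝ) ≤ s := by exact_mod_cast hTc
  have h1σ : (0:ℝ) ≤ 1 - σ / 1000000 := by linarith
  refine crit q n Q (by omega) hcF hrK hQ G (Finset.filter_subset _ _) S T
    (Finset.disjoint_filter_filter_not _ _ _) (Finset.filter_union_filter_not_eq _ _).symm (by linarith) ?_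
  rw [← hB, hWS]
  have hg2 : (2:ℝ) ^ G.card ≤ 2 ^ g := pow_le_pow_right₀ (by norm_num) hGcN
  have hUR : (1:ℝ) ≤ U := by exact_mod_cast hU1
  calc _ ≤ (2 ^ g * B) * (((W:ℝ) - 1) + s * W) + (A + c * (B * (W - 1))) := by
        refine add_le_add ?_ hadd
        have : (0:ℝ) ≤ W - 1 := by linarith
        gcongr
    _ = B * Y + A := by rw [hYR]; ring
    _ < ((U:ℝ) - 1) * (1 - σ / 1000000) := by
        have : ((U:ℝ) - 1) * (1 - σ / 1000000) = (((U:ℝ) - 1) * (1000000 - σ)) / 1000000 := by ring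
        rw [this, lt_div_iff₀ (by norm_num)]
        linarith
    _ ≤ _ := by gcongr <;> linarith

theorem chk_sound (q n Q c1 b D : ℕ) (hn : 3 ≤ n) (hD : D ≤ 6)
    (hcF : Fintype.card F = q) (hrK : Module.finrank F K = n) (hQ : Q * (q - 1) = q ^ n - 1)
    (h12 : c1 ≤ 2 ^ b) (h0 : 2 ≤ 2 ^ b) (h : 2 ^ b ≤ 200) (hchk : chk q n Q c1 b D = true) :
    ∃ α : K, IsPrimitiveElt α ∧ IskNormal q n 1 F α :=
  chkA_sound q n Q c1 (2 ^ b) D _ _ _ _ _ hn hD hcF hrK hQ h12 h0 h rfl rfl rfl rfl hchk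

theorem notpp_sound (q : ℕ) (hq : IsPrimePow q) : notpp q = false := by
  rw [Bool.eq_false_iff]
  intro h
  simp only [notpp, List.any_eq_true, Bool.and_eq_true] at h
  obtain ⟨a, ha, ha', b, hb, hb', hab⟩ := h
  obtain ⟨p, k, hp, hk, rfl⟩ := hq
  have hpn := hp.nat_prime
  have h1 : ∀ x ∈ PL, Nat.beq (p ^ k % x) 0 = true → x = p := by
    intro x hx h
    have h2 : x ∣ p ^ k := Nat.dvd_of_mod_eq_zero (by simpa using h)
    exact (Nat.prime_dvd_prime_iff_eq (PL_prime x hx) hpn).1 ((PL_prime x hx).dvd_of_dvd_pow h2)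
  rw [h1 a ha ha', h1 b hb hb'] at hab
  simp at hab

theorem main_split (q n Q : ℕ) (hq : IsPrimePow q) (hn : 3 ≤ n)
    (hcF : Fintype.card F = q) (hrK : Module.finrank F K = n) (hQ : Q * (q - 1) = q ^ n - 1)
    (hne : q ∉ exc n) :
    ∃ α : K, IsPrimitiveElt α ∧ IskNormal q n 1 F α := by
  have hq1 : 2 ≤ q := hq.two_le
  by_cases hmid : qlo n ≤ q
  · exact mid_q q n Q hn hmid hcF hrK hQ
  push Not at hmid
  by_cases hL : q ∈ [2, 3, 4, 5, 7, 8, 9, 11, 13] ∧ N0 q < n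
  · exact large_n_small_q q n Q hL.1 hn hL.2 hcF hrK hQ
  by_cases hn125 : n < 125
  · have h1 := (all_good n hn125).resolve_left (by omega)
    unfold allq at h1
    rw [List.all_eq_true] at h1
    have h2 := h1 q (List.mem_range.2 hmid)
    have h3 : Nat.blt q 2 = false := by rw [Bool.eq_false_iff, Ne, Nat.blt_eq]; omega
    rw [h3, Bool.false_or] at h2
    unfold reg at h2
    rw [Bool.or_eq_true, Bool.and_eq_true, List.contains_iff_mem, Nat.blt_eq] at h2
    have h4 := h2.resolve_left hL
    unfold good at h4
    rw [notpp_sound q hq, Bool.false_or, Bool.or_eq_true, List.contains_iff_mem] at h4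
    have h5 := h4.resolve_left hne
    have hQe : (q ^ n - 1) / (q - 1) = Q := by
      rw [← hQ]; exact Nat.mul_div_cancel _ (by omega)
    simp only [hQe, Bool.or_eq_true] at h5
    rcases h5 with h | h | h | h | h | h
    all_goals exact chk_sound q n Q _ _ _ hn (by norm_num) hcF hrK hQ (by norm_num) (by norm_num) (by norm_num) h
  · exfalso
    have e1 : qlo n = 16 := by
      simp only [qlo, qhi]
      repeat rw [if_neg (by omega)]
    rw [e1] at hmid
    apply hL
    have h6 : ∀ q < 16, 2 ≤ q → notpp q = false → q ∈ [2, 3, 4, 5, 7, 8, 9, 11, 13] ∧ N0 q < 125 := by decide +kernel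
    obtain ⟨h7, h8⟩ := h6 q hmid hq1 (notpp_sound q hq)
    exact ⟨h7, by omega⟩
end
end

section
set_option linter.unusedSectionVars false

def frc {α : Type} (v : ℕ) (f : ℕ → α) : α := Nat.rec (f 0) (fun n _ => f (Nat.succ n)) v
def frcL {α : Type} (l : List ℕ) : (List ℕ → α) → α :=
  List.rec (motive := fun _ => (List ℕ → α) → α) (fun k => k []) (fun a _ ih k => frc a fun a' => ih fun t' => k (a' :: t')) l

/-- coefficientwise `c * b + s + t * r` modulo `p` -/
def fz (p c t : ℕ) (b : List ℕ) : List ℕ → List ℕ → List ℕ :=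
  List.rec (motive := fun _ => List ℕ → List ℕ → List ℕ) (fun _ _ => [])
    (fun b0 _ ih s r => List.rec (motive := fun _ => List ℕ) [] (fun s0 s' _ => List.rec (motive := fun _ => List ℕ) []
      (fun r0 r' _ => Nat.mod (Nat.add (Nat.add (Nat.mul c b0) s0) (Nat.mul t r0)) p :: ih s' r') r) s) b

def stp (p : ℕ) (r b : List ℕ) (c : ℕ) (acc : List ℕ) : List ℕ := fz p c (acc.headD 0) b (acc.tail ++ [0]) r

def zer (r : List ℕ) : List ℕ := r.map fun _ => 0
def one' (r : List ℕ) : List ℕ := (zer r).tail ++ [1]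
def xx (r : List ℕ) : List ℕ := (zer r).tail.tail ++ [1, 0]

def mulL (p : ℕ) (r a b : List ℕ) : List ℕ :=
  List.rec (motive := fun _ => List ℕ → List ℕ) (fun acc => acc) (fun c _ ih acc => frcL (stp p r b c acc) ih) a (zer r)

def addL (p : ℕ) (r a b : List ℕ) : List ℕ := fz p 1 0 a b r

def powL (p : ℕ) (r a : List ℕ) (fuel : ℕ) : ℕ → List ℕ :=
  Nat.rec (motive := fun _ => ℕ → List ℕ) (fun _ => []) (fun _ ih k =>
    cond (Nat.beq k 1) a (frc (Nat.div k 2) fun k' => frcL (ih k') fun h => frcL (mulL p r h h) fun h2 =>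
      cond (Nat.beq (Nat.mod k 2) 0) h2 (mulL p r h2 a))) fuel

/-- `acc + y + y^q + ...` with `n` terms -/
def trL (p q : ℕ) (r : List ℕ) (n : ℕ) : List ℕ → List ℕ → List ℕ :=
  Nat.rec (motive := fun _ => List ℕ → List ℕ → List ℕ) (fun _ acc => acc) (fun _ ih y acc =>
    frcL (addL p r acc y) fun acc' => frcL (powL p r y 6 q) fun y' => ih y' acc') n

/-- all dual conditions: `Tr(β y)= 0`, `y = y₀, y₀^q, ...` -/
def dualL (p q n : ℕ) (r be : List ℕ) (m : ℕ) : List ℕ → Bool :=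
  Nat.rec (motive := fun _ => List ℕ → Bool) (fun _ => true) (fun _ ih y =>
    frcL (powL p r y 6 q) fun y' => frcL (mulL p r be y') fun z =>
      cond (decide (trL p q r n z (zer r) = zer r)) (ih y') false) m

def prL (p M : ℕ) (r : List ℕ) (ps : List ℕ) : List ℕ :=
  List.rec (motive := fun _ => List ℕ) (one' r) (fun l _ ih => frcL ih fun t => frcL (powL p r (xx r) 24 (Nat.div M l)) fun u =>
    frcL (fz p (Nat.sub p 1) 0 (one' r) u r) fun v => mulL p r v t) ps

def chkE (p q n : ℕ) (r be ps : List ℕ) : Bool :=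
  frc (Nat.sub (Nat.pow p r.length) 1) fun M =>
    Nat.beq (Nat.mod (Nat.pow ps.prod 24) M) 0 && (Nat.ble 2 r.length && (Nat.beq (Nat.pow q n) (M + 1) && (
    decide (powL p r (xx r) 24 M = one' r) && (
    frcL (prL p M r ps) (fun P => decide (powL p r P 24 M = one' r)) && (
    decide (trL p q r n (mulL p r be (xx r)) (zer r) = one' r) && (
    dualL p q n r be (n - 2) (xx r)))))))

def chkT (p q n : ℕ) (r : List ℕ) : Bool := decide (trL p q r n (xx r) (zer r) = zer r)

def exL : List (ℕ × ℕ × ℕ × List ℕ × List ℕ × List ℕ) :=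
  [(2, 2, 3, [0, 1, 1], [1, 0, 0], [7]),
   (3, 3, 3, [0, 1, 2], [2, 2, 0], [2, 13]),
   (7, 7, 3, [0, 4, 5], [1, 0, 0], [2, 3, 19]),
   (3, 9, 3, [0, 2, 2, 2, 1, 1], [0, 0, 2, 2, 0, 0], [2, 7, 13]),
   (13, 13, 3, [0, 4, 7], [8, 10, 0], [2, 3, 61]),
   (2, 16, 3, [0, 0, 1, 1, 1, 0, 1, 0, 0, 0, 1, 1], [0, 0, 1, 0, 0, 0, 0, 0, 0, 1, 0, 0], [3, 5, 7, 13]),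
   (5, 25, 3, [0, 4, 1, 4, 0, 3], [2, 0, 2, 2, 0, 0], [2, 3, 7, 31]),
   (37, 37, 3, [0, 30, 20], [36, 30, 0], [2, 3, 7, 67]),
   (2, 2, 4, [0, 0, 1, 1], [1, 1, 0, 0], [3, 5]),
   (3, 3, 4, [0, 0, 1, 1], [1, 1, 0, 0], [2, 5]),
   (2, 4, 4, [0, 1, 1, 0, 1, 0, 0, 1], [0, 0, 1, 0, 0, 1, 0, 0], [3, 5, 17]),
   (5, 5, 4, [0, 1, 4, 2], [3, 4, 4, 0], [2, 3, 13]),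
   (7, 7, 4, [0, 2, 4, 4], [0, 6, 5, 0], [2, 3, 5]),
   (2, 8, 4, [0, 1, 1, 0, 1, 0, 1, 0, 0, 1, 0, 1], [1, 1, 0, 0, 1, 1, 1, 0, 0, 1, 0, 0], [3, 5, 7, 13]),
   (3, 9, 4, [0, 1, 0, 1, 0, 1, 2, 1], [1, 1, 0, 1, 2, 1, 0, 0], [2, 5, 41]),
   (11, 11, 4, [0, 5, 5, 3], [2, 0, 2, 0], [2, 3, 5, 61]),
   (13, 13, 4, [0, 5, 10, 7], [12, 3, 8, 0], [2, 3, 5, 7, 17]),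
   (17, 17, 4, [0, 3, 7, 3], [2, 12, 2, 0], [2, 3, 5, 29]),
   (29, 29, 4, [0, 14, 19, 10], [24, 16, 27, 0], [2, 3, 5, 7, 421]),
   (2, 2, 6, [0, 0, 0, 0, 1, 1], [1, 1, 0, 0, 0, 0], [3, 7]),
   (3, 3, 6, [0, 0, 0, 0, 1, 1], [2, 2, 0, 0, 0, 0], [2, 7, 13]),
   (2, 4, 6, [0, 0, 0, 1, 1, 1, 0, 1, 1, 1, 1, 1], [0, 0, 1, 0, 1, 0, 0, 1, 1, 0, 1, 0], [3, 5, 7, 13]),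
   (5, 5, 6, [0, 3, 1, 0, 1, 2], [1, 1, 1, 3, 0, 0], [2, 3, 7, 31]),
   (7, 7, 6, [0, 5, 1, 3, 6, 4], [2, 3, 1, 6, 3, 0], [2, 3, 19, 43]),
   (2, 2, 8, [0, 1, 0, 0, 1, 1, 0, 1], [1, 0, 0, 1, 1, 0, 1, 0], [3, 5, 17]),
   (3, 3, 8, [0, 0, 2, 1, 2, 1, 2, 1], [0, 1, 1, 2, 1, 1, 1, 0], [2, 5, 41]),
   (5, 5, 8, [0, 4, 4, 4, 1, 1, 2, 3], [2, 3, 4, 0, 1, 2, 0, 0], [2, 3, 13, 313]),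
   (2, 2, 10, [0, 1, 0, 0, 0, 0, 1, 1, 0, 1], [1, 0, 0, 1, 1, 1, 0, 1, 0, 0], [3, 11, 31]),
   (2, 2, 12, [0, 0, 1, 0, 0, 1, 1, 1, 0, 0, 1, 1], [1, 0, 0, 0, 0, 1, 0, 1, 0, 1, 1, 0], [3, 5, 7, 13]),
   (3, 3, 12, [0, 1, 0, 1, 0, 2, 2, 1, 0, 0, 1, 1], [1, 2, 1, 0, 2, 1, 1, 0, 0, 2, 0, 0], [2, 5, 7, 13, 73])]

theorem exL_ok : (exL.all fun d => chkE d.1 d.2.1 d.2.2.1 d.2.2.2.1 d.2.2.2.2.1 d.2.2.2.2.2 &&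
    chkT d.1 d.2.1 d.2.2.1 d.2.2.2.1) = true := by decide +kernel
end

section
set_option linter.unusedSectionVars false

theorem frc_eq {α : Type} (v : ℕ) (f : ℕ → α) : frc v f = f v := by cases v <;> rfl
theorem frcL_eq {α : Type} (l : List ℕ) (k : List ℕ → α) : frcL l k = k l := by
  induction l generalizing k with
  | nil => rfl
  | cons a t ih =>
    change frc a (fun a' => frcL t fun t' => k (a' :: t')) = _
    rw [frc_eq, ih]

section
variable {R : Type} [CommRing R]

def evL (x : R) : List ℕ → R
  | [] => 0
  | a :: t => a * x ^ t.length + evL x t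

theorem evL_append (x : R) (l m : List ℕ) : evL x (l ++ m) = evL x l * x ^ m.length + evL x m := by
  induction l with
  | nil => simp [evL]
  | cons a t ih => simp only [List.cons_append, evL, ih, List.length_append]; ring

theorem cast_mod (p m : ℕ) (hp : (p : R) = 0) : ((m % p : ℕ) : R) = m := by
  conv_rhs => rw [← Nat.mod_add_div m p]
  push_cast; rw [hp]; ring

theorem fz_cons (p c t b0 s0 r0 : ℕ) (b s r : List ℕ) :
    fz p c t (b0 :: b) (s0 :: s) (r0 :: r) = ((c * b0 + s0 + t * r0) % p) :: fz p c t b s r := rfl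

theorem fz_spec (p c t : ℕ) (hp : (p : R) = 0) (x : R) : ∀ (N : ℕ) (b s r : List ℕ), b.length = N → s.length = N → r.length = N →
    (fz p c t b s r).length = N ∧ evL x (fz p c t b s r) = c * evL x b + evL x s + t * evL x r := by
  intro N
  induction N with
  | zero =>
    intro b s r hb hs hr
    rw [List.length_eq_zero_iff] at hb hs hr
    subst hb hs hr
    exact ⟨rfl, by change evL x [] = _; simp [evL]⟩
  | succ N ih =>
    intro b s r hb hs hr
    obtain ⟨b0, b, rfl⟩ := List.exists_cons_of_length_eq_add_one hb
    obtain ⟨s0, s, rfl⟩ := List.exists_cons_of_length_eq_add_one hs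
    obtain ⟨r0, r, rfl⟩ := List.exists_cons_of_length_eq_add_one hr
    simp only [List.length_cons, Nat.add_right_cancel_iff] at hb hs hr
    obtain ⟨h1, h2⟩ := ih b s r hb hs hr
    rw [fz_cons]
    refine ⟨by simp [h1], ?_⟩
    simp only [evL, h1, h2, cast_mod p _ hp, hb, hs, hr]
    push_cast; ring

/-- `l` represents `y`. -/
def Repr0 (r : List ℕ) (x : R) (l : List ℕ) (y : R) : Prop := l.length = r.length ∧ evL x l = y

variable {p : ℕ} (hp : (p : R) = 0) {r : List ℕ} {x : R} (hr : 2 ≤ r.length) (hx : evL x r = x ^ r.length)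

theorem evL_zeros (x : R) (l : List ℕ) : evL x (l.map fun _ => 0) = 0 := by
  induction l with
  | nil => rfl
  | cons a t ih =>
    simp only [List.map_cons, evL, Nat.cast_zero, zero_mul, zero_add]; exact ih

theorem rep_zer : Repr0 r x (zer r) 0 := ⟨by simp [zer], evL_zeros x r⟩

include hr in
theorem rep_one : Repr0 r x (one' r) 1 := by
  obtain ⟨a, t, rfl⟩ : ∃ a t, r = a :: t := List.exists_cons_of_length_pos (by omega)
  refine ⟨by simp [one', zer], ?_⟩
  simp only [one', zer, List.map_cons, List.tail_cons, evL_append, evL_zeros]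
  simp [evL]

include hr in
theorem rep_xx : Repr0 r x (xx r) x := by
  obtain ⟨a, t, rfl⟩ : ∃ a t, r = a :: t := List.exists_cons_of_length_pos (by omega)
  obtain ⟨b, t, rfl⟩ : ∃ b s, t = b :: s := List.exists_cons_of_length_pos (by simp at hr; omega)
  refine ⟨by simp [xx, zer], ?_⟩
  simp only [xx, zer, List.map_cons, List.tail_cons, evL_append, evL_zeros]
  simp [evL]

include hp hr hx in
theorem rep_stp (b acc : List ℕ) (c : ℕ) (u v : R) (hb : Repr0 r x b u) (ha : Repr0 r x acc v) :
    Repr0 r x (stp p r b c acc) (c * u + x * v) := by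
  obtain ⟨hb1, hb2⟩ := hb
  obtain ⟨ha1, ha2⟩ := ha
  obtain ⟨h, t, rfl⟩ : ∃ a t, acc = a :: t := List.exists_cons_of_length_pos (by omega)
  simp only [List.length_cons] at ha1
  obtain ⟨h1, h2⟩ := fz_spec p c h hp x r.length b (t ++ [0]) r hb1 (by simp [ha1]) rfl
  refine ⟨h1, ?_⟩
  change evL x (fz p c h b (t ++ [0]) r) = _
  rw [h2, hb2, hx, ← ha2, evL_append, ← ha1]
  simp [evL]; ring

include hp hr hx in
theorem rep_mul {a b : List ℕ} {u v : R} (ha : Repr0 r x a u) (hb : Repr0 r x b v) : Repr0 r x (mulL p r a b) (u * v) := by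
  have key : ∀ (l acc : List ℕ) (w : R), Repr0 r x acc w →
      Repr0 r x (List.rec (motive := fun _ => List ℕ → List ℕ) (fun acc => acc)
        (fun c _ ih acc => frcL (stp p r b c acc) ih) l acc) (w * x ^ l.length + evL x l * v) := by
    intro l
    induction l with
    | nil => intro acc w h; simpa [evL] using h
    | cons c t ih =>
      intro acc w h
      change Repr0 r x (frcL (stp p r b c acc) _) _
      rw [frcL_eq]
      have := ih _ _ (rep_stp hp hr hx b acc c v w hb h)
      convert this using 1
      simp only [evL, List.length_cons]; ring
  have := key a (zer r) 0 rep_zer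
  rw [ha.2, zero_mul, zero_add] at this
  exact this

include hp in
theorem rep_fz (c : ℕ) {a b : List ℕ} {u v : R} (ha : Repr0 r x a u) (hb : Repr0 r x b v) : Repr0 r x (fz p c 0 a b r) (c * u + v) := by
  obtain ⟨h1, h2⟩ := fz_spec p c 0 hp x r.length a b r ha.1 hb.1 rfl
  refine ⟨h1, ?_⟩
  rw [h2, ha.2, hb.2]; simp

include hp in
theorem rep_add {a b : List ℕ} {u v : R} (ha : Repr0 r x a u) (hb : Repr0 r x b v) : Repr0 r x (addL p r a b) (u + v) := by
  have := rep_fz hp 1 ha hb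
  rw [Nat.cast_one, one_mul] at this
  exact this

include hp hr hx in
theorem rep_pow {a : List ℕ} {u : R} (ha : Repr0 r x a u) (fuel : ℕ) : ∀ k, 1 ≤ k → k < 2 ^ fuel →
    Repr0 r x (powL p r a fuel k) (u ^ k) := by
  induction fuel with
  | zero => intro k h1 h2; simp at h2; omega
  | succ f ih =>
    intro k h1 h2
    change Repr0 r x (cond (Nat.beq k 1) a (frc (k / 2) fun k' => frcL (powL p r a f k') fun h => frcL (mulL p r h h) fun h2 =>
      cond (Nat.beq (k % 2) 0) h2 (mulL p r h2 a))) _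
    rw [frc_eq, frcL_eq, frcL_eq]
    by_cases hk : k = 1
    · subst hk; simpa using ha
    · have e1 : Nat.beq k 1 = false := by rw [Bool.eq_false_iff, Ne, Nat.beq_eq]; exact hk
      rw [e1, cond_false]
      have h3 := ih (k / 2) (by omega) (by rw [pow_succ] at h2; omega)
      have h4 := rep_mul hp hr hx h3 h3
      by_cases hk2 : k % 2 = 0
      · rw [hk2]
        change Repr0 r x (mulL p r _ _) _
        have : u ^ k = u ^ (k / 2) * u ^ (k / 2) := by rw [← pow_add]; congr 1; omega
        rw [this]; exact h4
      · have hk3 : k % 2 = 1 := by omega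
        rw [hk3]
        change Repr0 r x (mulL p r (mulL p r _ _) _) _
        have : u ^ k = u ^ (k / 2) * u ^ (k / 2) * u := by rw [← pow_add, ← pow_succ]; congr 1; omega
        rw [this]; exact rep_mul hp hr hx h4 ha

include hp hr hx in
theorem rep_tr (q : ℕ) (hq : 1 ≤ q) (hq2 : q < 64) (n : ℕ) : ∀ (y acc : List ℕ) (u v : R), Repr0 r x y u → Repr0 r x acc v →
    Repr0 r x (trL p q r n y acc) (v + ∑ i ∈ Finset.range n, u ^ q ^ i) := by
  induction n with
  | zero => intro y acc u v _ h; rw [Finset.range_zero, Finset.sum_empty, add_zero]; exact h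
  | succ n ih =>
    intro y acc u v hy h
    change Repr0 r x (frcL (addL p r acc y) fun acc' => frcL (powL p r y 6 q) fun y' => trL p q r n y' acc') _
    rw [frcL_eq, frcL_eq]
    have := ih _ _ _ _ (rep_pow hp hr hx hy 6 q hq (by omega)) (rep_add hp h hy)
    convert this using 1
    rw [Finset.sum_range_succ', pow_zero, pow_one]
    simp only [← pow_mul, ← pow_succ']
    ring

include hp hr hx in
theorem rep_dual (q n : ℕ) (hq : 1 ≤ q) (hq2 : q < 64) (be : List ℕ) (β : R) (hbe : Repr0 r x be β) (m : ℕ) :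
    ∀ (y : List ℕ) (u : R), Repr0 r x y u → dualL p q n r be m y = true →
    ∀ i < m, ∑ j ∈ Finset.range n, (β * u ^ q ^ (i + 1)) ^ q ^ j = 0 := by
  induction m with
  | zero => intro y u _ _ i hi; omega
  | succ m ih =>
    intro y u hy h i hi
    change (frcL (powL p r y 6 q) fun y' => frcL (mulL p r be y') fun z =>
      cond (decide (trL p q r n z (zer r) = zer r)) (dualL p q n r be m y') false) = true at h
    rw [frcL_eq, frcL_eq] at h
    have h1 := rep_pow hp hr hx hy 6 q hq (by omega)
    have h2 := rep_tr hp hr hx q hq hq2 n _ _ _ _ (rep_mul hp hr hx hbe h1) rep_zer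
    by_cases hd : trL p q r n (mulL p r be (powL p r y 6 q)) (zer r) = zer r
    · rw [decide_eq_true hd, cond_true] at h
      have h3 := ih _ _ h1 h
      rcases i with _ | i
      · have := h2.2
        rw [hd, rep_zer.2, zero_add] at this
        rw [zero_add, pow_one]; exact this.symm
      · have := h3 i (by omega)
        simp only [← pow_mul, ← pow_succ'] at this
        simpa [pow_mul] using this
    · rw [decide_eq_false hd, cond_false] at h
      exact absurd h (by simp)

include hp hr hx in
theorem rep_pr (M : ℕ) (hM : M < 2 ^ 24) (ps : List ℕ) (hps : ∀ l ∈ ps, 1 ≤ M / l) (hp1 : 1 ≤ p) :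
    Repr0 r x (prL p M r ps) (ps.map fun l => x ^ (M / l) - 1).prod := by
  induction ps with
  | nil => exact rep_one hr
  | cons l t ih =>
    change Repr0 r x (frcL (prL p M r t) fun t => frcL (powL p r (xx r) 24 (M / l)) fun u =>
      frcL (fz p (p - 1) 0 (one' r) u r) fun v => mulL p r v t) _
    rw [frcL_eq, frcL_eq, frcL_eq, List.map_cons, List.prod_cons]
    refine rep_mul hp hr hx ?_ (ih fun l hl => hps l (List.mem_cons_of_mem _ hl))
    have h1 := rep_fz hp (p - 1) (rep_one (x := x) hr) (rep_pow hp hr hx (rep_xx (x := x) hr) 24 (M / l) (hps l List.mem_cons_self)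
      ((Nat.div_le_self _ _).trans_lt hM))
    convert h1 using 1
    rw [Nat.cast_sub hp1, hp]; ring
end
end

section
set_option linter.unusedSectionVars false

theorem evL_map {R S : Type} [CommRing R] [CommRing S] (f : R →+* S) (x : R) (l : List ℕ) :
    f (evL x l) = evL (f x) l := by
  induction l with
  | nil => simp [evL]
  | cons a t ih => simp [evL, ih]

theorem evL_deg {K : Type} [Field K] (l : List ℕ) : (evL (X : K[X]) l).degree < ((l.length : ℕ) : WithBot ℕ) := by
  induction l with
  | nil => simp [evL]
  | cons a t ih =>
    rw [evL]
    refine (degree_add_le _ _).trans_lt (max_lt ?_ (ih.trans ?_))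
    · have h : ((a : K[X]) * X ^ t.length).degree ≤ ((t.length : ℕ) : WithBot ℕ) := by
        have := degree_C_mul_X_pow_le (t.length) (a : K)
        rwa [map_natCast] at this
      refine h.trans_lt ?_
      simp only [List.length_cons]
      exact_mod_cast Nat.lt_succ_self _
    · simp only [List.length_cons]
      exact_mod_cast Nat.lt_succ_self _

/-- a root of `x ^ N = evL x r` in `K` -/
theorem exists_root {K : Type} [Field K] [Fintype K] (p : ℕ) (hp : (p : K) = 0) (r : List ℕ) (hr : 2 ≤ r.length)
    (M : ℕ) (hM : 1 ≤ M) (hM2 : M < 2 ^ 24) (hc : Fintype.card K = M + 1) (h1 : powL p r (xx r) 24 M = one' r) :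
    ∃ α : K, evL α r = α ^ r.length := by
  set g : K[X] := X ^ r.length - evL X r with hg
  have hmon : g.Monic := monic_X_pow_sub (by
    have := evL_deg (K := K) r
    exact this)
  have hdeg : g.degree = r.length := by
    rw [hg, degree_sub_eq_left_of_degree_lt] <;> rw [degree_X_pow]
    exact evL_deg r
  let R := AdjoinRoot g
  let x : R := AdjoinRoot.root g
  have hx : evL x r = x ^ r.length := by
    have h : AdjoinRoot.mk g (X ^ r.length - evL X r) = 0 := AdjoinRoot.mk_self
    rw [map_sub, map_pow, evL_map, AdjoinRoot.mk_X, sub_eq_zero] at h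
    exact h.symm
  have hpR : (p : R) = 0 := by
    have := congrArg (AdjoinRoot.of g) hp
    simpa using this
  have hxM : x ^ M = 1 := by
    have h2 := rep_pow hpR hr hx (rep_xx (x := x) hr) 24 M hM hM2
    rw [h1] at h2
    rw [← h2.2, (rep_one (x := x) hr).2]
  have hdvd : g ∣ X ^ Fintype.card K - X := by
    rw [← AdjoinRoot.mk_eq_zero, map_sub, map_pow, AdjoinRoot.mk_X, hc, pow_succ]
    change x ^ M * x - x = 0
    rw [hxM]; ring
  have hsp : (X ^ Fintype.card K - X : K[X]).Splits := by
    rw [splits_iff_card_roots]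
    rw [FiniteField.roots_X_pow_card_sub_X, FiniteField.X_pow_card_sub_X_natDegree_eq _ Fintype.one_lt_card]
    rfl
  have hs : g.Splits := hsp.of_dvd (FiniteField.X_pow_card_sub_X_ne_zero _ Fintype.one_lt_card) hdvd
  obtain ⟨α, hα⟩ := hs.exists_eval_eq_zero (by rw [hdeg]; exact_mod_cast (by omega : r.length ≠ 0))
  refine ⟨α, ?_⟩
  have h3 : (evalRingHom α) g = 0 := hα
  rw [hg, map_sub, map_pow, evL_map, sub_eq_zero] at h3
  simpa using h3.symm

theorem prim_of_order {K : Type} [Field K] [Fintype K] (α : K) (M : ℕ) (hM : 1 ≤ M) (hc : Fintype.card K = M + 1)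
    (h1 : α ^ M = 1) (h2 : ∀ l, l.Prime → l ∣ M → α ^ (M / l) ≠ 1) : IsPrimitiveElt α := by
  classical
  have h0 : α ≠ 0 := by
    rintro rfl; rw [zero_pow (by omega)] at h1; exact zero_ne_one h1
  set u : Kˣ := Units.mk0 α h0
  have ho : orderOf u = M := by
    refine orderOf_eq_of_pow_and_pow_div_prime (by omega) (Units.ext (by simpa [u] using h1)) ?_
    intro l hl hd h
    exact h2 l hl hd (by simpa [u] using congrArg Units.val h)
  intro b hb
  have hcu : orderOf u = Nat.card Kˣ := by
    rw [ho, Nat.card_eq_fintype_card, Fintype.card_units, hc]; rfl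
  have ht : Subgroup.zpowers u = ⊤ := Subgroup.eq_top_of_card_eq _ (by rw [Nat.card_zpowers, hcu])
  have hz : Units.mk0 b hb ∈ Submonoid.powers u := mem_powers_iff_mem_zpowers.2 (by rw [ht]; exact Subgroup.mem_top _)
  obtain ⟨m, hm⟩ := hz
  exact ⟨m, by simpa [u] using congrArg Units.val hm⟩

section
variable {F K : Type} [Field F] [Fintype F] [Field K] [Fintype K] [Algebra F K]

theorem li_of_dual (q n : ℕ) (hn : 2 ≤ n) (hcF : Fintype.card F = q) (α β : K)
    (h1 : ∑ j ∈ Finset.range n, (β * α) ^ q ^ j = 1)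
    (h2 : ∀ i < n - 2, ∑ j ∈ Finset.range n, (β * α ^ q ^ (i + 1)) ^ q ^ j = 0) :
    LinearIndependent F (fun i : Fin (n - 1) => α ^ q ^ (i : ℕ)) := by
  classical
  have hap : ∀ y : K, ap (fpol F n) y = ∑ j ∈ Finset.range n, y ^ q ^ j := by
    intro y; rw [ap_fpol, hcF]
  have hX : ∀ (k : ℕ) (y : K), ap (X ^ k : F[X]) y = y ^ q ^ k := by
    intro k y; rw [ap, map_pow, aeval_X, frobL_pow, hcF]
  have hfr : ∀ (k : ℕ) (y : K), ap (fpol F n) (y ^ q ^ k) = (ap (fpol F n) y) ^ q ^ k := by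
    intro k y
    rw [← hX, ← hX, ← ap_mul, ← ap_mul, mul_comm]
  rw [Fintype.linearIndependent_iff]
  intro c hc
  have key : ∀ k, ∀ hk : k < n - 1, c ⟨k, hk⟩ = 0 := by
    intro k
    induction k using Nat.strong_induction_on with
    | _ k ih =>
      intro hk
      have e : ∑ i : Fin (n - 1), c i • ap (fpol F n) (β ^ q ^ k * α ^ q ^ (i : ℕ)) = 0 := by
        have := congrArg (fun y => aeval (frobL F K) (fpol F n) (β ^ q ^ k * y)) hc
        simpa [Finset.mul_sum, ap] using this
      rw [Finset.sum_eq_single ⟨k, hk⟩] at e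
      · simp only at e
        rw [← mul_pow, hfr, hap, h1, one_pow] at e
        rcases smul_eq_zero.1 e with h | h
        · exact h
        · exact absurd h one_ne_zero
      · intro i _ hik
        rcases lt_trichotomy (i : ℕ) k with h | h | h
        · rw [ih i h i.2, zero_smul]
        · exact absurd (Fin.ext h) hik
        · obtain ⟨m, hm⟩ : ∃ m, (i : ℕ) = m + 1 + k := ⟨i - k - 1, by omega⟩
          have hi := i.2
          rw [hm, pow_add q, pow_mul, ← mul_pow, hfr, hap, h2 m (by omega), zero_pow, smul_zero]
          have : 0 < q := by rw [← hcF]; exact Fintype.card_pos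
          positivity
      · intro h; exact absurd (Finset.mem_univ _) h
  exact fun i => key i i.2
end
end

section
set_option linter.unusedSectionVars false

def sideE (p q n : ℕ) (r ps : List ℕ) : Prop :=
  1 ≤ p ∧ 1 ≤ q ∧ q < 64 ∧ 3 ≤ n ∧ 1 ≤ p ^ r.length - 1 ∧ p ^ r.length - 1 < 2 ^ 24 ∧
    ∀ l ∈ ps, 1 ≤ (p ^ r.length - 1) / l ∧ 2 ≤ l ∧ ∀ m < l, m ∣ l → m = 1

instance (p q n : ℕ) (r ps : List ℕ) : Decidable (sideE p q n r ps) := by unfold sideE; infer_instance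

theorem exL_side : ∀ d ∈ exL, sideE d.1 d.2.1 d.2.2.1 d.2.2.2.1 d.2.2.2.2.2 := by decide +kernel

section
variable {F K : Type} [Field F] [Fintype F] [Field K] [Fintype K] [Algebra F K]

theorem exc_core (p q n : ℕ) (r be ps : List ℕ) (hE : chkE p q n r be ps = true) (hs : sideE p q n r ps)
    (hbe : be.length = r.length)
    (hcF : Fintype.card F = q) (hrK : Module.finrank F K = n) :
    ∃ α : K, (p : K) = 0 ∧ evL α r = α ^ r.length ∧ α ^ (q ^ n - 1) = 1 ∧ IsPrimitiveElt α ∧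
      LinearIndependent F (fun i : Fin (n - 1) => α ^ q ^ (i : ℕ)) := by
  obtain ⟨hp1, hq1, hq2, hn, hM1, hM2, hps⟩ := hs
  rw [chkE, frc_eq] at hE
  simp only [Bool.and_eq_true, frcL_eq, decide_eq_true_eq, Nat.beq_eq, Nat.ble_eq] at hE
  obtain ⟨e1, hr, e2, e3, e4, e5, e6⟩ := hE
  change p ^ r.length - 1 < _ at hM2
  change q ^ n = p ^ r.length - 1 + 1 at e2
  change ps.prod ^ 24 % (p ^ r.length - 1) = 0 at e1
  set M := p ^ r.length - 1 with hM
  change powL p r (xx r) 24 M = _ at e3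
  change powL p r (prL p M r ps) 24 M = _ at e4
  have hcK : Fintype.card K = M + 1 := by
    rw [← e2, Module.card_eq_pow_finrank (K := F) (V := K), hcF, hrK]
  have hp : (p : K) = 0 := by
    have h1 : ((Fintype.card K : ℕ) : K) = 0 := FiniteField.cast_card_eq_zero K
    have h2 : M + 1 = p ^ r.length := by omega
    rw [hcK, h2, Nat.cast_pow] at h1
    exact pow_eq_zero_iff (by omega) |>.1 h1
  obtain ⟨α, hα⟩ := exists_root (K := K) p hp r hr M hM1 hM2 hcK e3
  have h1 := rep_one (x := α) hr
  have hαM : α ^ M = 1 := by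
    have h2 := rep_pow hp hr hα (rep_xx (x := α) hr) 24 M hM1 hM2
    rw [e3] at h2
    rw [← h2.2, h1.2]
  refine ⟨α, hp, hα, by rw [e2]; exact hαM, prim_of_order α M hM1 hcK hαM ?_, ?_⟩
  · intro l hl hd hl1
    have h2 := rep_pow hp hr hα (rep_pr hp hr hα M hM2 ps (fun l hl => (hps l hl).1) hp1) 24 M hM1 hM2
    rw [e4] at h2
    have h3 := h2.2
    rw [h1.2] at h3
    have hlp : l ∈ ps := by
      have h4 : l ∣ ps.prod := hl.dvd_of_dvd_pow (hd.trans (Nat.dvd_of_mod_eq_zero e1))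
      obtain ⟨a, ha, hla⟩ := (Nat.Prime.prime hl).dvd_prod_iff.1 h4
      rcases (Nat.le_of_dvd (by have := (hps a ha).2.1; omega) hla).lt_or_eq with h | h
      · exact absurd ((hps a ha).2.2 l h hla) hl.one_lt.ne'
      · rwa [h]
    rw [List.prod_eq_zero (by
      rw [List.mem_map]; exact ⟨l, hlp, by rw [hl1, sub_self]⟩), zero_pow (by omega)] at h3
    exact one_ne_zero h3
  · have hb : Repr0 r α be (evL α be) := ⟨hbe, rfl⟩
    refine li_of_dual q n (by omega) hcF α (evL α be) ?_ ?_
    · have h2 := rep_tr hp hr hα q hq1 hq2 n _ _ _ _ (rep_mul hp hr hα hb (rep_xx (x := α) hr)) rep_zer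
      rw [e5] at h2
      have h3 := h2.2
      rw [h1.2, zero_add] at h3
      exact h3.symm
    · exact rep_dual hp hr hα q n hq1 hq2 be _ hb (n - 2) _ _ (rep_xx (x := α) hr) e6

theorem exc_row (p q n : ℕ) (r be ps : List ℕ) (hmem : (p, q, n, r, be, ps) ∈ exL)
    (hcF : Fintype.card F = q) (hrK : Module.finrank F K = n) :
    ∃ α : K, IsPrimitiveElt α ∧ IskNormal q n 1 F α := by
  have h := List.all_eq_true.1 exL_ok _ hmem
  have hs := exL_side _ hmem
  have hb : be.length = r.length :=
    (by decide +kernel : ∀ d ∈ exL, d.2.2.2.2.1.length = d.2.2.2.1.length) _ hmem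
  simp only [Bool.and_eq_true] at h hs
  obtain ⟨hE, hT⟩ := h
  obtain ⟨α, hp, hα, -, h1, h2⟩ := exc_core (F := F) (K := K) p q n r be ps hE hs hb hcF hrK
  have hr : 2 ≤ r.length :=
    (by decide +kernel : ∀ d ∈ exL, 2 ≤ d.2.2.2.1.length) _ hmem
  obtain ⟨hp1, hq1, hq2, hn, hM1, hM2, hps⟩ := hs
  refine ⟨α, h1, normal_of_LI q n (by omega) α h2 (mem_span_of_sum q n (by omega) α ?_)⟩
  have h3 := rep_tr hp hr hα q hq1 hq2 n _ _ _ _ (rep_xx (x := α) hr) rep_zer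
  rw [chkT, decide_eq_true_eq] at hT
  rw [hT, zero_add] at h3
  rw [← h3.2]; exact rep_zer.2

theorem exc43_ok : chkE 2 4 3 [0,1,1,0,1,1] [0,0,1,0,0,0] [3,7] = true ∧ sideE 2 4 3 [0,1,1,0,1,1] [3,7] := by decide +kernel
theorem exc43_rel :
    let r := [0,1,1,0,1,1]
    addL 2 r (powL 2 r (xx r) 6 16) (addL 2 r (powL 2 r (xx r) 6 25) (powL 2 r (xx r) 6 43)) = zer r := by decide +kernel

theorem exc43 (hcF : Fintype.card F = 4) (hrK : Module.finrank F K = 3) :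
    ∃ α : K, IsPrimitiveElt α ∧ IskNormal 4 3 1 F α := by
  obtain ⟨α, hp, hα, hM, h1, h2⟩ := exc_core (F := F) (K := K) 2 4 3 _ _ _ exc43_ok.1 exc43_ok.2 rfl hcF hrK
  refine ⟨α, h1, normal_of_LI 4 3 (by omega) α h2 ?_⟩
  have hr : 2 ≤ ([0,1,1,0,1,1] : List ℕ).length := by decide
  have hx := rep_xx (x := α) hr
  have h3 := rep_add hp (rep_pow hp hr hα hx 6 16 (by omega) (by omega)) (rep_add hp
    (rep_pow hp hr hα hx 6 25 (by omega) (by omega)) (rep_pow hp hr hα hx 6 43 (by omega) (by omega)))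
  rw [exc43_rel] at h3
  have h4 := h3.2
  rw [rep_zer.2] at h4
  norm_num at hM
  obtain ⟨c, hc⟩ := mem_range_of_pow (F := F) (α ^ 21) (by
    rw [hcF, ← pow_mul, show 21 * 4 = 63 + 21 by norm_num, pow_add, hM, one_mul])
  have h5 : α ^ 16 = -(c • α ^ 4 ^ 1 + (c ^ 2) • α ^ 4 ^ 0) := by
    rw [Algebra.smul_def, Algebra.smul_def, map_pow, hc]
    linear_combination -h4
  change α ^ 4 ^ 2 ∈ _
  norm_num only [] at h5 ⊢
  rw [h5]
  refine Submodule.neg_mem _ (Submodule.add_mem _ (Submodule.smul_mem _ _ ?_) (Submodule.smul_mem _ _ ?_))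
  · exact Submodule.subset_span ⟨1, by norm_num⟩
  · exact Submodule.subset_span ⟨0, by norm_num⟩

theorem exc_all (q n : ℕ) (hn : 3 ≤ n) (he : q ∈ exc n) (hcF : Fintype.card F = q) (hrK : Module.finrank F K = n) :
    ∃ α : K, IsPrimitiveElt α ∧ IskNormal q n 1 F α := by
  by_cases h43 : q = 4 ∧ n = 3
  · obtain ⟨rfl, rfl⟩ := h43
    exact exc43 hcF hrK
  have hn2 : n < 13 := by
    by_contra h
    obtain ⟨m, rfl⟩ : ∃ m, n = m + 13 := ⟨n - 13, by omega⟩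
    simp [exc] at he
  have hall : ∀ n < 13, ∀ q ∈ exc n, (q = 4 ∧ n = 3) ∨ ∃ d ∈ exL, d.2.1 = q ∧ d.2.2.1 = n := by decide +kernel
  rcases hall n hn2 q he with h | ⟨⟨p, q', n', r, be, ps⟩, hd, h1, h2⟩
  · exact absurd h h43
  · simp only at h1 h2
    subst h1 h2
    exact exc_row p _ _ r be ps hd hcF hrK

theorem final (q n : ℕ) (hq : IsPrimePow q) (hn : 3 ≤ n) (hcF : Fintype.card F = q) (hrK : Module.finrank F K = n) :
    ∃ α : K, IsPrimitiveElt α ∧ IskNormal q n 1 F α := by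
  by_cases he : q ∈ exc n
  · exact exc_all q n hn he hcF hrK
  · have hd : q - 1 ∣ q ^ n - 1 := by simpa using Nat.sub_dvd_pow_sub_pow q 1 n
    exact main_split q n ((q ^ n - 1) / (q - 1)) hq hn hcF hrK (Nat.div_mul_cancel hd) he
end
end

/-- **The Primitive 1-Normal Theorem.** For every prime power `q` and every `n ≥ 3` there is a
primitive `1`-normal element of `F_{qⁿ}` over `F_q`; for `n = 2` there is none. -/
theorem stmt_0 (q n : ℕ) (hq : IsPrimePow q)
    (F K : Type) [Field F] [Fintype F] [Field K] [Fintype K] [Algebra F K]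
    (hcF : Fintype.card F = q) (hrK : Module.finrank F K = n) :
    (3 ≤ n → ∃ α : K, IsPrimitiveElt α ∧ IskNormal q n 1 F α) ∧
    (n = 2 → ¬ ∃ α : K, IsPrimitiveElt α ∧ IskNormal q n 1 F α) := by
  refine ⟨fun hn => final q n hq hn hcF hrK, ?_⟩
  rintro rfl
  exact no_two q hcF hrK

end
end

section
/- Let q be a prime power, n a positive integer, and let f ∈ F_q[x] be a monic divisor of x^n − 1. Then there exists α ∈ F_{q^n} whose minimal polynomial with respect to the Frobenius σ_q equals f, i.e. f = m_{σ_q,α}. -/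
open Polynomial

noncomputable section

theorem frobComp_eq_aeval {F K : Type*} [Field F] [Fintype F] [Field K] [Algebra F K]
    (h : F[X]) (a : K) :
    frobComp (Fintype.card F) h a
      = (aeval (FiniteField.frobeniusAlgHom F K).toLinearMap h) a := by
  have key : ∀ i : ℕ, ∀ b : K, ((FiniteField.frobeniusAlgHom F K).toLinearMap ^ i) b
      = b ^ (Fintype.card F) ^ i := by
    intro i
    induction i with
    | zero => intro b; simp
    | succ k ih =>
      intro b
      rw [pow_succ, Module.End.mul_apply, ih]
      simp only [AlgHom.toLinearMap_apply, FiniteField.coe_frobeniusAlgHom]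
      rw [← pow_mul, pow_succ']
  rw [aeval_eq_sum_range, frobComp, LinearMap.sum_apply]
  refine Finset.sum_congr rfl fun i _ => ?_
  rw [LinearMap.smul_apply, key, Algebra.smul_def]

theorem exists_frob_cyclic (F K : Type*) [Field F] [Fintype F] [Field K] [Finite K] [Algebra F K] :
    ∃ x : K, ∀ h : F[X], (aeval (FiniteField.frobeniusAlgHom F K).toLinearMap h) x = 0 →
      (X ^ Module.finrank F K - 1 : F[X]) ∣ h := by
  obtain ⟨x, hx⟩ := Module.exists_ker_toSpanSingleton_eq_annihilator F[X]
    (Module.AEval' (FiniteField.frobeniusAlgHom F K).toLinearMap)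
  obtain ⟨x, rfl⟩ := (Module.AEval'.of _).surjective x
  rw [← span_minpoly_eq_annihilator, FiniteField.minpoly_frobeniusAlgHom] at hx
  refine ⟨x, fun h hh => ?_⟩
  rw [← Ideal.mem_span_singleton, ← hx, LinearMap.mem_ker, LinearMap.toSpanSingleton_apply]
  exact hh

/-- Every monic divisor `f` of `xⁿ - 1` arises as the `σ_q`-minimal polynomial of some
`α ∈ F_{qⁿ}`. -/
theorem stmt_2 (q n : ℕ) (hq : IsPrimePow q) (hn : 0 < n)
    (F K : Type) [Field F] [Fintype F] [Field K] [Fintype K] [Algebra F K]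
    (hcF : Fintype.card F = q) (hrK : Module.finrank F K = n)
    (f : F[X]) (hf : f.Monic) (hdvd : f ∣ X ^ n - 1) :
    ∃ α : K, IsFrobMinimal q f α := by
  obtain ⟨x, hx⟩ := exists_frob_cyclic F K
  obtain ⟨g, hg⟩ := hdvd
  subst hcF
  rw [hrK, hg] at hx
  have hne : (X ^ n - 1 : F[X]) ≠ 0 := X_pow_sub_C_ne_zero hn 1
  have hg0 : g ≠ 0 := by
    rintro rfl
    exact hne (by rw [hg, mul_zero])
  refine ⟨(aeval (FiniteField.frobeniusAlgHom F K).toLinearMap g) x, hf, ?_, ?_⟩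
  · rw [frobComp_eq_aeval, ← Module.End.mul_apply, ← map_mul, ← hg, ← hrK,
      ← FiniteField.minpoly_frobeniusAlgHom, minpoly.aeval, LinearMap.zero_apply]
  · intro h hm h0
    rw [frobComp_eq_aeval, ← Module.End.mul_apply, ← map_mul] at h0
    exact natDegree_le_of_dvd ((mul_dvd_mul_iff_right hg0).1 (hx _ h0)) hm.ne_zero

end
end

section
/- Let q be a prime power, n a positive integer and 0 ≤ k ≤ n. The number N_k of k-normal elements of F_{q^n} over F_q is given by N_k = Σ Φ_q(h), where the sum runs over all monic divisors h of x^n − 1 in F_q[x] of degree n − k. -/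
open Polynomial

noncomputable section

theorem aux_count {F M : Type*} [Field F] [AddCommGroup M] [Module F[X] M]
    (P h : F[X]) (hP : P ≠ 0) (hh : h ∣ P) (x : M)
    (hx : ∀ f : F[X], f • x = 0 ↔ P ∣ f) (hs : ∀ m : M, ∃ f : F[X], f • x = m) :
    Nat.card {m : M // ∀ f : F[X], f • m = 0 ↔ h ∣ f} = Nat.card (F[X] ⧸ Ideal.span {h})ˣ := by
  obtain ⟨g, rfl⟩ := hh
  have hh0 : h ≠ 0 := left_ne_zero_of_mul hP
  have hg0 : g ≠ 0 := right_ne_zero_of_mul hP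
  have hb : ∀ f : F[X], f • (g • x) = 0 ↔ h ∣ f := by
    intro f
    rw [smul_smul, hx, mul_dvd_mul_iff_right hg0]
  set b : M := g • x with hbdef
  have key : ∀ r s : F[X], r • b = s • b ↔
      (Ideal.Quotient.mk (Ideal.span {h}) r) = Ideal.Quotient.mk (Ideal.span {h}) s := by
    intro r s
    rw [Ideal.Quotient.eq, Ideal.mem_span_singleton, ← hb, sub_smul, sub_eq_zero]
  have lift : ∀ u : F[X] ⧸ Ideal.span {h}, ∃ r, Ideal.Quotient.mk (Ideal.span {h}) r = u :=
    Ideal.Quotient.mk_surjective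
  choose l hl using lift
  symm
  refine Nat.card_congr (Equiv.ofBijective
    (fun u : (F[X] ⧸ Ideal.span {h})ˣ => ⟨l u • b, ?_⟩) ⟨?_, ?_⟩)
  · intro f
    rw [smul_smul, hb]
    have h1 : ∀ a : F[X], h ∣ a ↔ Ideal.Quotient.mk (Ideal.span {h}) a = 0 := by
      intro a
      rw [Ideal.Quotient.eq_zero_iff_mem, Ideal.mem_span_singleton]
    rw [h1, h1, map_mul, hl, Units.mul_left_eq_zero]
  · intro u v huv
    have h2 : l u • b = l v • b := congrArg Subtype.val huv
    rw [key, hl, hl] at h2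
    exact Units.ext h2
  · rintro ⟨m, hm⟩
    obtain ⟨f, rfl⟩ := hs m
    have h3 : h • f • x = 0 := (hm h).2 dvd_rfl
    rw [smul_smul, hx, mul_dvd_mul_iff_left hh0] at h3
    obtain ⟨r, rfl⟩ := h3
    have h4 : (g * r) • x = r • b := by rw [hbdef, smul_smul, mul_comm]
    rw [h4] at hm
    have hu : IsUnit (Ideal.Quotient.mk (Ideal.span {h}) r) := by
      classical
      obtain ⟨h', hh'⟩ := EuclideanDomain.gcd_dvd_right r h
      obtain ⟨r', hr'⟩ := EuclideanDomain.gcd_dvd_left r h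
      have hab := EuclideanDomain.gcd_eq_gcd_ab r h
      set d := EuclideanDomain.gcd r h
      have h5 : h ∣ h' := by
        rw [← hm, smul_smul, hb]
        refine ⟨r', ?_⟩
        calc h' * r = h' * (d * r') := by rw [← hr']
          _ = (d * h') * r' := by ring
          _ = h * r' := by rw [← hh']
      obtain ⟨c, hc⟩ := h5
      have h6 : h * (d * c) = h * 1 := by
        calc h * (d * c) = d * (h * c) := by ring
          _ = h * 1 := by rw [← hc, ← hh', mul_one]
      have h7 := mul_left_cancel₀ hh0 h6
      rw [hab] at h7
      refine IsUnit.of_mul_eq_one (Ideal.Quotient.mk _ (EuclideanDomain.gcdA r h * c)) ?_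
      rw [← map_mul, ← map_one (Ideal.Quotient.mk (Ideal.span {h})), Ideal.Quotient.eq,
        Ideal.mem_span_singleton]
      refine ⟨- (EuclideanDomain.gcdB r h * c), ?_⟩
      rw [← h7]; ring
    obtain ⟨u, hu⟩ := hu
    refine ⟨u, Subtype.ext ?_⟩
    change l u • b = (g * r) • x
    rw [h4, key, hl, hu]

open Module in
theorem aux_span {F K : Type} [Field F] [Fintype F] [Field K] [Fintype K] [Algebra F K]
    (α : K) (h : F[X])
    (hm : ∀ f : F[X], aeval (FiniteField.frobeniusAlgHom F K).toLinearMap f α = 0 ↔ h ∣ f) :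
    finrank F (Submodule.span F (Set.range fun i : Fin (finrank F K) =>
      α ^ Fintype.card F ^ (i : ℕ))) = h.natDegree := by
  set φ := (FiniteField.frobeniusAlgHom F K).toLinearMap with hφ
  let T : F[X] →ₗ[F] K := (LinearMap.applyₗ α) ∘ₗ (aeval φ).toLinearMap
  have hT : ∀ f, T f = aeval φ f α := fun f => rfl
  have hpow : ∀ i : ℕ, (φ ^ i) α = α ^ Fintype.card F ^ i := by
    intro i
    induction i with
    | zero => simp
    | succ i ih =>
      rw [pow_succ', Module.End.mul_apply, ih, pow_succ, pow_mul]; rfl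
  have hperiod : φ ^ (finrank F K) = 1 := by
    have := minpoly.aeval F φ
    rw [hφ, FiniteField.minpoly_frobeniusAlgHom] at this
    simpa [sub_eq_zero] using this
  have hr : LinearMap.range T = Submodule.span F (Set.range fun i : Fin (finrank F K) =>
      α ^ Fintype.card F ^ (i : ℕ)) := by
    apply le_antisymm
    · rintro _ ⟨f, rfl⟩
      rw [hT, aeval_eq_sum_range, LinearMap.sum_apply]
      refine Submodule.sum_mem _ fun i _ => ?_
      rw [LinearMap.smul_apply]
      refine Submodule.smul_mem _ _ ?_
      rw [pow_eq_pow_mod i hperiod, hpow]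
      exact Submodule.subset_span ⟨⟨_, Nat.mod_lt _ finrank_pos⟩, rfl⟩
    · rw [Submodule.span_le]
      rintro _ ⟨i, rfl⟩
      refine ⟨X ^ (i : ℕ), ?_⟩
      rw [hT, map_pow, aeval_X, hpow]
  have hk : LinearMap.ker T = (Ideal.span {h}).restrictScalars F := by
    ext f
    rw [LinearMap.mem_ker, hT, hm, Submodule.restrictScalars_mem, Ideal.mem_span_singleton]
  rw [← hr, ← (T.quotKerEquivRange).finrank_eq, hk]
  exact finrank_quotient_span_eq_natDegree (f := h)

/-- The number of `k`-normal elements of `F_{qⁿ}` over `F_q` equals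
`Σ Φ_q(h)` over monic divisors `h` of `xⁿ - 1` of degree `n - k`. -/
theorem stmt_3 (q n k : ℕ) (hq : IsPrimePow q) (hn : 0 < n) (hk : k ≤ n)
    (F K : Type) [Field F] [Fintype F] [Field K] [Fintype K] [Algebra F K]
    (hcF : Fintype.card F = q) (hrK : Module.finrank F K = n) :
    Nat.card {α : K // IskNormal q n k F α} =
      ∑ᶠ h ∈ {h : F[X] | h.Monic ∧ h ∣ (X ^ n - 1) ∧ h.natDegree = n - k}, PhiPoly h := by
  classical
  subst hcF hrK
  set n := Module.finrank F K with hndef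
  have hP : (X ^ n - 1 : F[X]) ≠ 0 := by
    simpa using X_pow_sub_C_ne_zero (R := F) hn 1
  set φ := (FiniteField.frobeniusAlgHom F K).toLinearMap with hφ
  have hmin : minpoly F φ = X ^ n - 1 := by
    rw [hφ, FiniteField.minpoly_frobeniusAlgHom]
  -- annihilator generators
  have hann : ∀ α : K, ∃ h : F[X], h.Monic ∧ h ∣ (X ^ n - 1) ∧
      ∀ f : F[X], aeval φ f α = 0 ↔ h ∣ f := by
    intro α
    let I : Ideal F[X] :=
      { carrier := {f | aeval φ f α = 0}
        add_mem' := by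
          intro a b ha hb
          simp only [Set.mem_ofPred_eq] at *
          rw [map_add, LinearMap.add_apply, ha, hb, add_zero]
        zero_mem' := by simp
        smul_mem' := by
          intro c f hf
          simp only [Set.mem_ofPred_eq, smul_eq_mul] at *
          rw [map_mul, Module.End.mul_apply, hf, map_zero] }
    have hI : ∀ f, f ∈ I ↔ aeval φ f α = 0 := fun f => Iff.rfl
    obtain ⟨g, hg⟩ := (IsPrincipalIdealRing.principal I).principal
    have hg' : ∀ f : F[X], aeval φ f α = 0 ↔ g ∣ f := by
      intro f
      rw [← hI, hg]
      exact Ideal.mem_span_singleton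
    have hgP : g ∣ X ^ n - 1 := by
      rw [← hg', ← hmin, minpoly.aeval, LinearMap.zero_apply]
    have hg0 : g ≠ 0 := ne_zero_of_dvd_ne_zero hP hgP
    refine ⟨normalize g, monic_normalize hg0, normalize_dvd_iff.2 hgP, fun f => ?_⟩
    rw [hg', normalize_dvd_iff]
  choose m hmon hdvd hm using hann
  have huniq : ∀ α : K, ∀ h : F[X], h.Monic →
      (m α = h ↔ ∀ f : F[X], aeval φ f α = 0 ↔ h ∣ f) := by
    intro α h hh
    refine ⟨fun e => e ▸ hm α, fun H => ?_⟩
    refine eq_of_monic_of_associated (hmon α) hh (associated_of_dvd_dvd ?_ ?_)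
    · rw [← hm, H]
    · rw [← H, hm]
  -- cyclic generator
  obtain ⟨x, hx⟩ : ∃ x : K, m x = X ^ n - 1 := by
    obtain ⟨x, hx⟩ := Module.exists_ker_toSpanSingleton_eq_annihilator F[X] (Module.AEval' φ)
    obtain ⟨x, rfl⟩ := (Module.AEval'.of _).surjective x
    rw [← span_minpoly_eq_annihilator, hmin] at hx
    refine ⟨x, ?_⟩
    rw [huniq x _ (by simpa using monic_X_pow_sub_C (1 : F) hn.ne')]
    intro f
    rw [← Ideal.mem_span_singleton, ← hx, LinearMap.mem_ker, LinearMap.toSpanSingleton_apply]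
    change _ ↔ f • (Module.AEval.of F K φ) x = 0
    rw [← Module.AEval.of_aeval_smul]
    simp
  have hsurj : ∀ α : K, ∃ f : F[X], aeval φ f x = α := by
    have h1 := aux_span x (X ^ n - 1 : F[X]) (by rw [← huniq, hx]; simpa using monic_X_pow_sub_C (1 : F) hn.ne')
    rw [← C_1, natDegree_X_pow_sub_C] at h1
    have h2 := Submodule.eq_top_of_finrank_eq h1
    intro α
    have h3 : α ∈ (⊤ : Submodule F K) := trivial
    rw [← h2] at h3
    let T : F[X] →ₗ[F] K := (LinearMap.applyₗ x) ∘ₗ (aeval φ).toLinearMap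
    have hpow : ∀ i : ℕ, (φ ^ i) x = x ^ Fintype.card F ^ i := by
      intro i
      induction i with
      | zero => simp
      | succ i ih =>
        rw [pow_succ', Module.End.mul_apply, ih, pow_succ, pow_mul]; rfl
    have h4 : Submodule.span F (Set.range fun i : Fin (Module.finrank F K) =>
      x ^ Fintype.card F ^ (i : ℕ)) ≤ LinearMap.range T := by
      rw [Submodule.span_le]
      rintro _ ⟨i, rfl⟩
      refine ⟨X ^ (i : ℕ), ?_⟩
      change aeval φ (X ^ (i : ℕ)) x = _
      rw [map_pow, aeval_X, hpow]
    exact h4 h3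
  have hcount : ∀ h : F[X], h.Monic → h ∣ X ^ n - 1 →
      Nat.card {α : K // m α = h} = PhiPoly h := by
    intro h hh hd
    have hsm : ∀ (f : F[X]) (a : K), f • (Module.AEval'.of φ a) = Module.AEval'.of φ (aeval φ f a) := by
      intro f a
      exact (Module.AEval.of_aeval_smul φ f a).symm
    rw [PhiPoly, ← aux_count (M := Module.AEval' φ) (X ^ n - 1) h hP hd (Module.AEval'.of φ x)]
    · refine Nat.card_congr ((Module.AEval'.of φ).toEquiv.subtypeEquiv fun a => ?_)
      rw [huniq a h hh]
      refine forall_congr' fun f => ?_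
      change _ ↔ (f • (Module.AEval'.of φ a) = 0 ↔ _)
      rw [hsm, LinearEquiv.map_eq_zero_iff]
    · intro f
      rw [hsm, LinearEquiv.map_eq_zero_iff, hm, hx]
    · intro a
      obtain ⟨a, rfl⟩ := (Module.AEval'.of φ).surjective a
      obtain ⟨f, rfl⟩ := hsurj a
      exact ⟨f, hsm _ _⟩
  have hkn : ∀ α : K, IskNormal (Fintype.card F) n k F α ↔ (m α).natDegree = n - k := by
    intro α
    rw [IskNormal, aux_span α (m α) (hm α)]
  -- finiteness of the index set
  have hfin : {h : F[X] | h.Monic ∧ h ∣ (X ^ n - 1) ∧ h.natDegree = n - k}.Finite := by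
    refine (Set.finite_range m).subset ?_
    rintro h ⟨h1, h2, -⟩
    obtain ⟨g, hg⟩ := h2
    have hg0 : g ≠ 0 := by rintro rfl; rw [mul_zero] at hg; exact hP hg
    refine ⟨aeval φ g x, ?_⟩
    rw [huniq _ _ h1]
    intro f
    rw [← Module.End.mul_apply, ← map_mul, hm, hx, hg, mul_dvd_mul_iff_right hg0]
  rw [finsum_mem_eq_finite_toFinset_sum _ hfin, Nat.card_eq_fintype_card, Fintype.card_subtype,
    Finset.card_eq_sum_card_fiberwise (f := m) (t := hfin.toFinset)]
  · refine Finset.sum_congr rfl fun h hh => ?_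
    rw [Set.Finite.mem_toFinset] at hh
    rw [← hcount h hh.1 hh.2.1, Nat.card_eq_fintype_card, Fintype.card_subtype,
      Finset.filter_filter]
    congr 1
    ext α
    simp only [Finset.mem_filter, Finset.mem_univ, true_and, hkn]
    refine ⟨fun H => H.2, fun H => ⟨H ▸ hh.2.2, H⟩⟩
  · intro α hα
    simp only [Finset.coe_filter, Finset.mem_univ, true_and, Set.mem_ofPred_eq, hkn] at hα
    simp only [Set.Finite.coe_toFinset, Set.mem_ofPred_eq]
    exact ⟨hmon α, hdvd α, hα⟩

end
end
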